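/- arXiv:1703.09611 — 11 statements merged into one kernel-verified Lean document; each statement's English description precedes it below -/
import Mathlib

section
/- Let n ≥ 1 and let A be an n×n integer matrix with determinant ±1 such that no root in ℂ of the characteristic polynomial of A is a root of unity. Then the continuous group automorphism of the torus T^n induced by A is ergodic with respect to the Haar probability measure on T^n. -/
open MeasureTheory

namespace ToralErgodic

open Matrix

/-- No nonzero integer vector is periodic under the transpose of `A`. -/
theorem no_periodic {n : ℕ} (A : Matrix (Fin n) (Fin n) ℤ)
    (hroots : ∀ z : ℂ, (A.map (Int.cast : ℤ → ℂ)).charpoly.IsRoot z →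
      ¬ ∃ k : ℕ, 0 < k ∧ z ^ k = 1)
    (v : Fin n → ℤ) (hv : v ≠ 0) (k : ℕ) (hk : 0 < k) :
    v ᵥ* (A ^ k) ≠ v := by
  intro h
  set B : Matrix (Fin n) (Fin n) ℂ := A.map (Int.cast : ℤ → ℂ) with hB
  have hB' : B = (Int.castRingHom ℂ).mapMatrix A := rfl
  set w : Fin n → ℂ := fun i => (v i : ℂ) with hw
  have hw0 : w ≠ 0 := by
    intro h0
    apply hv
    funext i
    have := congrFun h0 i
    simpa [hw] using this
  have hwB : w ᵥ* (B ^ k) = w := by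
    funext i
    have h1 := congrArg (Int.cast : ℤ → ℂ) (congrFun h i)
    rw [hB', ← map_pow]
    simp only [Matrix.vecMul, dotProduct] at h1 ⊢
    push_cast at h1
    simpa [hw] using h1
  have hspec : (1 : ℂ) ∈ spectrum ℂ (B ^ k) := by
    rw [spectrum.mem_iff]
    intro hu
    rw [Matrix.isUnit_iff_isUnit_det, isUnit_iff_ne_zero] at hu
    apply hu
    rw [← Matrix.exists_vecMul_eq_zero_iff]
    refine ⟨w, hw0, ?_⟩
    rw [map_one, Matrix.vecMul_sub, hwB, Matrix.vecMul_one, sub_self]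
  rw [spectrum.map_pow_of_pos B hk] at hspec
  obtain ⟨z, hz, hzk⟩ := hspec
  exact hroots z (Matrix.mem_spectrum_iff_isRoot_charpoly.1 hz) ⟨k, hk, hzk⟩

theorem vecMul_inj {n : ℕ} (A : Matrix (Fin n) (Fin n) ℤ) (hdet : A.det = 1 ∨ A.det = -1)
    (j : ℕ) : Function.Injective (fun v : Fin n → ℤ => v ᵥ* (A ^ j)) := by
  have hu : IsUnit (A ^ j) := by
    apply IsUnit.pow
    rw [Matrix.isUnit_iff_isUnit_det]
    exact Int.isUnit_iff.2 hdet
  exact Matrix.vecMul_injective_of_isUnit hu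

theorem orbit_injective {n : ℕ} (A : Matrix (Fin n) (Fin n) ℤ) (hdet : A.det = 1 ∨ A.det = -1)
    (hroots : ∀ z : ℂ, (A.map (Int.cast : ℤ → ℂ)).charpoly.IsRoot z →
      ¬ ∃ k : ℕ, 0 < k ∧ z ^ k = 1)
    (v : Fin n → ℤ) (hv : v ≠ 0) : Function.Injective (fun k : ℕ => v ᵥ* (A ^ k)) := by
  have key : ∀ i j : ℕ, i < j → v ᵥ* (A ^ i) ≠ v ᵥ* (A ^ j) := by
    intro i j hij h
    apply no_periodic A hroots v hv (j - i) (by omega)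
    apply vecMul_inj A hdet i
    simp only [Matrix.vecMul_vecMul, ← pow_add]
    rw [Nat.sub_add_cancel hij.le, h]
  intro i j h
  rcases lt_trichotomy i j with hij | hij | hij
  · exact absurd h (key i j hij)
  · exact hij
  · exact absurd h.symm (key j i hij)

/-- The toral endomorphism as a homomorphism. -/
def toralHom {n : ℕ} (A : Matrix (Fin n) (Fin n) ℤ) :
    (Fin n → AddCircle (1 : ℝ)) →+ (Fin n → AddCircle (1 : ℝ)) where
  toFun x := fun i => ∑ j, A i j • x j
  map_zero' := by funext i; simp
  map_add' x y := by funext i; simp [Finset.sum_add_distrib]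

theorem toralHom_apply {n : ℕ} (A : Matrix (Fin n) (Fin n) ℤ) (x : Fin n → AddCircle (1 : ℝ))
    (i : Fin n) : toralHom A x i = ∑ j, A i j • x j := rfl

theorem toralHom_comp {n : ℕ} (A B : Matrix (Fin n) (Fin n) ℤ) (x : Fin n → AddCircle (1 : ℝ)) :
    toralHom A (toralHom B x) = toralHom (A * B) x := by
  funext i
  simp only [toralHom_apply, Matrix.mul_apply, Finset.smul_sum, Finset.sum_smul, mul_smul]
  rw [Finset.sum_comm]

theorem toralHom_surjective {n : ℕ} (A : Matrix (Fin n) (Fin n) ℤ)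
    (hdet : A.det = 1 ∨ A.det = -1) : Function.Surjective (toralHom A) := by
  intro y
  refine ⟨toralHom A⁻¹ y, ?_⟩
  rw [toralHom_comp, Matrix.mul_nonsing_inv _ (Int.isUnit_iff.2 hdet)]
  funext i
  simp [toralHom_apply, Matrix.one_apply]

theorem toralHom_continuous {n : ℕ} (A : Matrix (Fin n) (Fin n) ℤ) :
    Continuous (toralHom A) := by
  refine continuous_pi fun i => ?_
  simp only [toralHom_apply]
  fun_prop

theorem fourier_sum {ι : Type*} (s : Finset ι) (m : ℤ) (f : ι → AddCircle (1 : ℝ)) :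
    fourier m (∑ i ∈ s, f i) = ∏ i ∈ s, fourier m (f i) := by
  classical
  induction s using Finset.induction_on with
  | empty => simp
  | insert a s ha ih =>
    rw [Finset.sum_insert ha, Finset.prod_insert ha, ← ih]
    simp [fourier_apply, AddCircle.toCircle_add]

theorem fourier_sum_left {ι : Type*} (s : Finset ι) (m : ι → ℤ) (x : AddCircle (1 : ℝ)) :
    fourier (∑ i ∈ s, m i) x = ∏ i ∈ s, fourier (m i) x := by
  classical
  induction s using Finset.induction_on with
  | empty => simp
  | insert a s ha ih =>
    rw [Finset.sum_insert ha, Finset.prod_insert ha, ← ih, fourier_add]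

theorem mFourier_toralHom {n : ℕ} (A : Matrix (Fin n) (Fin n) ℤ) (m : Fin n → ℤ)
    (x : Fin n → AddCircle (1 : ℝ)) :
    UnitAddTorus.mFourier m (toralHom A x) = UnitAddTorus.mFourier (m ᵥ* A) x := by
  simp only [UnitAddTorus.mFourier, ContinuousMap.coe_mk, toralHom_apply, fourier_sum,
    Matrix.vecMul, dotProduct, fourier_sum_left]
  rw [Finset.prod_comm]
  refine Finset.prod_congr rfl fun j _ => Finset.prod_congr rfl fun i _ => ?_
  simp [fourier_apply, mul_smul]

section Core

noncomputable local instance instMS : MeasureSpace UnitAddCircle := ⟨AddCircle.haarAddCircle⟩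

local instance instHaar : Measure.IsAddHaarMeasure (volume : Measure UnitAddCircle) :=
  inferInstanceAs (Measure.IsAddHaarMeasure AddCircle.haarAddCircle)

local instance instProb : IsProbabilityMeasure (volume : Measure UnitAddCircle) :=
  inferInstanceAs (IsProbabilityMeasure AddCircle.haarAddCircle)

theorem core {n : ℕ} (A : Matrix (Fin n) (Fin n) ℤ) (hdet : A.det = 1 ∨ A.det = -1)
    (hroots : ∀ z : ℂ, (A.map (Int.cast : ℤ → ℂ)).charpoly.IsRoot z →
      ¬ ∃ k : ℕ, 0 < k ∧ z ^ k = 1) :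
    Ergodic (toralHom A) (volume : Measure (UnitAddTorus (Fin n))) := by
  have hmp : MeasurePreserving (toralHom A) (volume : Measure (UnitAddTorus (Fin n))) volume :=
    AddMonoidHom.measurePreserving (toralHom_continuous A) (toralHom_surjective A hdet) rfl
  refine ⟨hmp, ⟨fun s hs hinv => ?_⟩⟩
  let f := indicatorConstLp (μ := (volume : Measure (UnitAddTorus (Fin n)))) 2 hs
    (measure_ne_top _ s) (1 : ℂ)
  let g : UnitAddTorus (Fin n) → ℂ := s.indicator fun _ => 1
  have hfg : f =ᵐ[volume] g := indicatorConstLp_coeFn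
  have hgT : ∀ x, g (toralHom A x) = g x := by
    intro x
    have : toralHom A x ∈ s ↔ x ∈ s := by
      rw [← Set.mem_preimage, hinv]
    by_cases hx : x ∈ s
    · simp [g, hx, this.2 hx]
    · simp [g, hx, mt this.1 hx]
  have hcfg : ∀ m, UnitAddTorus.mFourierCoeff f m = UnitAddTorus.mFourierCoeff g m := by
    intro m
    refine integral_congr_ae ?_
    filter_upwards [hfg] with x hx
    rw [hx]
  have hgm : Measurable g := measurable_const.indicator hs
  have hstep : ∀ m, UnitAddTorus.mFourierCoeff g (m ᵥ* A) = UnitAddTorus.mFourierCoeff g m := by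
    intro m
    have h1 := hmp.map_eq
    unfold UnitAddTorus.mFourierCoeff
    conv_rhs => rw [← h1]
    rw [integral_map hmp.measurable.aemeasurable]
    · refine integral_congr_ae (Filter.Eventually.of_forall fun x => ?_)
      simp only
      rw [hgT, mFourier_toralHom, Matrix.neg_vecMul]
    · exact ((UnitAddTorus.mFourier (-m)).continuous.measurable.smul hgm).aestronglyMeasurable
  have horb : ∀ m (k : ℕ),
      UnitAddTorus.mFourierCoeff g (m ᵥ* (A ^ k)) = UnitAddTorus.mFourierCoeff g m := by
    intro m k
    induction k with
    | zero => simp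
    | succ k ih => rw [pow_succ, ← Matrix.vecMul_vecMul, hstep, ih]
  have hzero : ∀ m, m ≠ 0 → UnitAddTorus.mFourierCoeff f m = 0 := by
    intro m hm
    have hsum := (UnitAddTorus.hasSum_sq_mFourierCoeff f).summable.comp_injective
      (orbit_injective A hdet hroots m hm)
    have h2 := hsum.tendsto_atTop_zero
    simp only [Function.comp_def, hcfg, horb] at h2
    have h3 := tendsto_nhds_unique h2 tendsto_const_nhds
    rw [hcfg]
    simpa using h3.symm
  have hf0 : f = UnitAddTorus.mFourierCoeff f 0 • UnitAddTorus.mFourierLp 2 0 := by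
    refine (UnitAddTorus.hasSum_mFourier_series_L2 f).unique (hasSum_single 0 ?_)
    intro m hm
    rw [hzero m hm, zero_smul]
  set c := UnitAddTorus.mFourierCoeff f 0 with hc
  have hae : ∀ᵐ x : UnitAddTorus (Fin n), g x = c := by
    have h1 := Lp.coeFn_smul c (UnitAddTorus.mFourierLp (d := Fin n) 2 0)
    rw [← hf0] at h1
    filter_upwards [hfg, h1, UnitAddTorus.coeFn_mFourierLp (d := Fin n) 2 0] with x h2 h3 h4
    rw [← h2, h3, Pi.smul_apply, h4, UnitAddTorus.mFourier_zero]
    simp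
  rw [Filter.eventuallyConst_set]
  by_cases hc1 : c = 1
  · left
    filter_upwards [hae] with x hx
    by_contra hxs
    simp [g, hxs, hc1] at hx
  · right
    filter_upwards [hae] with x hx hxs
    simp only [g, Set.indicator_of_mem hxs] at hx
    exact hc1 hx.symm

theorem core' {n : ℕ} (A : Matrix (Fin n) (Fin n) ℤ) (hdet : A.det = 1 ∨ A.det = -1)
    (hroots : ∀ z : ℂ, (A.map (Int.cast : ℤ → ℂ)).charpoly.IsRoot z →
      ¬ ∃ k : ℕ, 0 < k ∧ z ^ k = 1) :
    Ergodic (toralHom A) (Measure.pi fun _ : Fin n => AddCircle.haarAddCircle (T := (1 : ℝ))) :=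
  core A hdet hroots

end Core

end ToralErgodic


/-- **Ergodicity of hyperbolic toral automorphisms.**
If `A ∈ GL(n, ℤ)` (an integer matrix with determinant `±1`) has no eigenvalue that is a
root of unity, then the induced automorphism of the torus `T^n = (ℝ/ℤ)^n` is ergodic with
respect to the Haar probability measure. -/
theorem toral_automorphism_ergodic (n : ℕ) (hn : 1 ≤ n)
    (A : Matrix (Fin n) (Fin n) ℤ) (hdet : A.det = 1 ∨ A.det = -1)
    (hroots : ∀ z : ℂ, (A.map (Int.cast : ℤ → ℂ)).charpoly.IsRoot z →
      ¬ ∃ k : ℕ, 0 < k ∧ z ^ k = 1) :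
    Ergodic (fun x : Fin n → AddCircle (1 : ℝ) => fun i => ∑ j, A i j • x j)
      (Measure.pi fun _ => volume) := by
  have h : (volume : Measure (AddCircle (1 : ℝ))) = AddCircle.haarAddCircle := by
    rw [AddCircle.volume_eq_smul_haarAddCircle]
    simp
  rw [h]
  exact ToralErgodic.core' A hdet hroots
end

section
/- Let n ≥ 2 and let v ∈ ℝ^n. If every coordinate of v is rational, then the orbit of the image of v in the torus T^n under the group of automorphisms of T^n induced by matrices in GL(n,ℤ) is a finite set. If at least one coordinate of v is irrational, then this orbit is dense in T^n. -/
/-- The orbit of (the image of) `v`. -/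
def torusOrbit {n : ℕ} (v : Fin n → ℝ) : Set (Fin n → AddCircle (1 : ℝ)) :=
  {y : Fin n → AddCircle (1 : ℝ) |
        ∃ A : Matrix (Fin n) (Fin n) ℤ, (A.det = 1 ∨ A.det = -1) ∧
          y = fun i => ∑ j, A i j • ((v j : AddCircle (1 : ℝ)))}

lemma torusOrbit_self {n : ℕ} (v : Fin n → ℝ) :
    (fun i => (v i : AddCircle (1 : ℝ))) ∈ torusOrbit v := by
  refine ⟨1, Or.inl Matrix.det_one, ?_⟩
  funext i
  simp [Matrix.one_apply, ite_smul]

lemma torusOrbit_transvection {n : ℕ} (v : Fin n → ℝ) (a b : Fin n) (hab : b ≠ a) (m : ℤ)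
    (y : Fin n → AddCircle (1 : ℝ)) (hy : y ∈ torusOrbit v) :
    Function.update y b (y b + m • y a) ∈ torusOrbit v := by
  obtain ⟨A, hA, rfl⟩ := hy
  refine ⟨Matrix.transvection b a m * A, ?_, ?_⟩
  · rwa [Matrix.det_mul, Matrix.det_transvection_of_ne b a hab, one_mul]
  · funext i
    by_cases hi : i = b
    · subst hi
      simp only [Function.update_self, Matrix.transvection_mul_apply_same, add_smul,
        Finset.sum_add_distrib, Finset.smul_sum, mul_smul]
    · simp only [Function.update_of_ne hi, Matrix.transvection_mul_apply_of_ne _ _ _ _ hi]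

lemma closure_torusOrbit_update {n : ℕ} (v : Fin n → ℝ) (a b : Fin n) (hab : b ≠ a)
    (y : Fin n → AddCircle (1 : ℝ)) (hy : y ∈ closure (torusOrbit v))
    (r : ℝ) (hr : Irrational r) (hya : y a = (r : AddCircle (1 : ℝ))) (t : AddCircle (1 : ℝ)) :
    Function.update y b t ∈ closure (torusOrbit v) := by
  have hd : DenseRange (fun m : ℤ => m • (r : AddCircle (1 : ℝ))) :=
    AddCircle.denseRange_zsmul_coe_iff.2 (by simpa using hr)
  have hcont : Continuous (fun s : AddCircle (1 : ℝ) => Function.update y b (y b + s)) := by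
    fun_prop
  have key : ∀ s : AddCircle (1 : ℝ), Function.update y b (y b + s) ∈ closure (torusOrbit v) := by
    intro s
    refine hd.induction_on (p := fun s => Function.update y b (y b + s) ∈ closure (torusOrbit v))
      s (isClosed_closure.preimage hcont) ?_
    intro m
    have hc : Continuous (fun z : Fin n → AddCircle (1 : ℝ) =>
        Function.update z b (z b + m • z a)) := by fun_prop
    have := map_mem_closure hc hy (fun z hz => torusOrbit_transvection v a b hab m z hz)
    simpa only [hya] using this
  simpa using key (t - y b)

lemma closure_torusOrbit_piecewise {n : ℕ} (v : Fin n → ℝ) (a : Fin n) (hr : Irrational (v a))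
    (y : Fin n → AddCircle (1 : ℝ)) (s : Finset (Fin n)) (hs : a ∉ s) :
    s.piecewise y (fun i => (v i : AddCircle (1 : ℝ))) ∈ closure (torusOrbit v) := by
  induction s using Finset.induction_on with
  | empty => simpa using subset_closure (torusOrbit_self v)
  | insert b s hb ih =>
    rw [Finset.mem_insert, not_or] at hs
    rw [Finset.piecewise_insert]
    exact closure_torusOrbit_update v a b (Ne.symm hs.1) _ (ih hs.2) _ hr (by simp [hs.2]) _

lemma dense_torusOrbit {n : ℕ} (hn : 2 ≤ n) (v : Fin n → ℝ) (a : Fin n)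
    (hr : Irrational (v a)) : Dense (torusOrbit v) := by
  haveI : Nontrivial (Fin n) := Fin.nontrivial_iff_two_le.2 hn
  obtain ⟨b, hb⟩ := exists_ne a
  have h1 : ∀ y : Fin n → AddCircle (1 : ℝ),
      Function.update y a (v a : AddCircle (1 : ℝ)) ∈ closure (torusOrbit v) := by
    intro y
    convert closure_torusOrbit_piecewise v a hr y (Finset.univ.erase a) (by simp) using 1
    funext i
    by_cases hi : i = a
    · subst hi; simp
    · simp [hi]
  have h2 : ∀ (y : Fin n → AddCircle (1 : ℝ)) (r : ℝ), Irrational r →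
      Function.update y b (r : AddCircle (1 : ℝ)) ∈ closure (torusOrbit v) := by
    intro y r hirr
    have := closure_torusOrbit_update v b a hb.symm _
      (h1 (Function.update y b (r : AddCircle (1 : ℝ)))) r hirr (by simp [hb]) (y a)
    convert this using 1
    funext i
    by_cases hi : i = a
    · subst hi; simp [hb.symm]
    · simp [hi]
  intro y
  obtain ⟨t, ht⟩ := QuotientAddGroup.mk_surjective (y b)
  have hcont : Continuous (fun s : ℝ => Function.update y b (s : AddCircle (1 : ℝ))) :=
    continuous_const.update b (AddCircle.continuous_mk' 1)
  have h3 : ∀ s : ℝ, Function.update y b (s : AddCircle (1 : ℝ)) ∈ closure (torusOrbit v) := by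
    intro s
    have := map_mem_closure hcont (dense_irrational s) (fun r hr' => h2 y r hr')
    simpa using this
  have := h3 t
  have ht' : (t : AddCircle (1 : ℝ)) = y b := ht
  rwa [ht', Function.update_eq_self] at this

lemma finite_torusOrbit {n : ℕ} (v : Fin n → ℝ) (h : ∀ i, ∃ q : ℚ, v i = (q : ℝ)) :
    (torusOrbit v).Finite := by
  haveI : Fact ((0 : ℝ) < 1) := ⟨one_pos⟩
  choose q hq using h
  set N : ℕ := ∏ i, (q i).den with hN
  have hpos : 0 < N := Finset.prod_pos fun i _ => (q i).den_pos
  have hz : ∀ i, N • (v i : AddCircle (1 : ℝ)) = 0 := by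
    intro i
    obtain ⟨k, hk⟩ : (q i).den ∣ N := Finset.dvd_prod_of_mem _ (Finset.mem_univ i)
    have : (q i).den • (v i : AddCircle (1 : ℝ)) = 0 := by
      rw [← AddCircle.coe_nsmul, AddCircle.coe_eq_zero_iff]
      refine ⟨(q i).num, ?_⟩
      rw [hq i, zsmul_eq_mul, nsmul_eq_mul, mul_one]
      exact_mod_cast (Rat.den_mul_eq_num (q i)).symm
    rw [hk, mul_comm, mul_smul, this, smul_zero]
  refine (Set.Finite.pi' (fun _ : Fin n => AddCircle.finite_torsion (1 : ℝ) hpos)).subset ?_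
  rintro y ⟨A, -, rfl⟩ i
  simp only [Set.mem_setOf_eq, Finset.smul_sum]
  refine Finset.sum_eq_zero fun j _ => ?_
  rw [smul_comm, hz, smul_zero]

/-- **Orbits of the `GL(n,ℤ)`-action on the torus.**
For `v ∈ ℝ^n` (`n ≥ 2`), the orbit of the image of `v` in `T^n = (ℝ/ℤ)^n` under the
automorphisms induced by integer matrices of determinant `±1` is finite when all coordinates
of `v` are rational, and is dense in `T^n` when some coordinate of `v` is irrational. -/
theorem torus_orbit_finite_or_dense (n : ℕ) (hn : 2 ≤ n) (v : Fin n → ℝ) :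
    ((∀ i, ∃ q : ℚ, v i = (q : ℝ)) →
      {y : Fin n → AddCircle (1 : ℝ) |
        ∃ A : Matrix (Fin n) (Fin n) ℤ, (A.det = 1 ∨ A.det = -1) ∧
          y = fun i => ∑ j, A i j • ((v j : AddCircle (1 : ℝ)))}.Finite) ∧
    ((∃ i, Irrational (v i)) →
      Dense {y : Fin n → AddCircle (1 : ℝ) |
        ∃ A : Matrix (Fin n) (Fin n) ℤ, (A.det = 1 ∨ A.det = -1) ∧
          y = fun i => ∑ j, A i j • ((v j : AddCircle (1 : ℝ)))}) := by
  exact ⟨fun h => finite_torusOrbit v h, fun ⟨i, hi⟩ => dense_torusOrbit hn v i hi⟩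
end

section
/- Let n ≥ 2 and let v ∈ ℝ^n be nonzero. The orbit {A·v : A ∈ SL(n,ℤ)} of v under the action of SL(n,ℤ) on ℝ^n by matrix multiplication is dense in ℝ^n if and only if v is not of the form t·q for some real number t and some vector q ∈ ℚ^n with rational coordinates. -/
/-- Two-dimensional lemma: a closed `SL(2,ℤ)`-invariant set containing a vector of irrational
slope is everything. -/
theorem aux_two_dim (D : Set (ℝ × ℝ)) (hD : IsClosed D)
    (hinv : ∀ (M : Matrix.SpecialLinearGroup (Fin 2) ℤ) (x y : ℝ), (x, y) ∈ D →
      ((M 0 0 : ℝ) * x + (M 0 1 : ℝ) * y, (M 1 0 : ℝ) * x + (M 1 1 : ℝ) * y) ∈ D)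
    (a b : ℝ) (hab : (a, b) ∈ D) (hirr : Irrational (a / b)) (u w : ℝ) : (u, w) ∈ D := by
  have hb : b ≠ 0 := by
    rintro rfl
    simp at hirr
  have step1 : ∀ t : ℝ, (t, (0 : ℝ)) ∈ D := by
    intro t
    rw [← hD.closure_eq, Metric.mem_closure_iff]
    intro ε hε
    obtain ⟨N, hN⟩ := exists_nat_gt (|b| / ε)
    have hN0 : 0 < N := by
      have : (0 : ℝ) < N := lt_of_le_of_lt (by positivity) hN
      exact_mod_cast this
    obtain ⟨q, hq, -⟩ := Real.exists_rat_abs_sub_le_and_den_le (a / b) hN0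
    have hden : (0 : ℝ) < q.den := by exact_mod_cast q.den_pos
    have hcop : IsCoprime (-q.num) (q.den : ℤ) := by
      rw [IsCoprime.neg_left_iff, Int.isCoprime_iff_nat_coprime]
      simpa using q.reduced
    have hqc : (q : ℝ) = q.num / q.den := by exact_mod_cast (Rat.num_div_den q).symm
    set y : ℝ := q.den * a - q.num * b with hy
    have hyq : y = b * q.den * (a / b - q) := by
      rw [hy, hqc]; field_simp
    have hy0 : y ≠ 0 := by
      rw [hyq]
      refine mul_ne_zero (mul_ne_zero hb hden.ne') ?_
      exact sub_ne_zero.2 (hirr.ne_rat q)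
    have hyε : |y| < ε := by
      rw [hyq, abs_mul, abs_mul, abs_of_pos hden]
      have h1 : |b| * q.den * |a / b - q| ≤ |b| * q.den * (1 / ((N + 1) * q.den)) := by
        gcongr
      have h2 : |b| * q.den * (1 / (((N : ℝ) + 1) * q.den)) = |b| / (N + 1) := by
        field_simp
      have h3 : |b| / ((N : ℝ) + 1) < ε := by
        rw [div_lt_iff₀ (by positivity)]
        rw [div_lt_iff₀ hε] at hN
        nlinarith
      linarith
    obtain ⟨M, hM0, hM1⟩ := hcop.symm.exists_SL2_row 1
    have h1 := hinv M a b hab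
    have hyM : (M 1 0 : ℝ) * a + (M 1 1 : ℝ) * b = y := by
      rw [hM0, hM1, hy]; push_cast; ring
    rw [hyM] at h1
    set x : ℝ := (M 0 0 : ℝ) * a + (M 0 1 : ℝ) * b with hx
    have h2 := hinv ⟨!![1, round ((t - x) / y); 0, 1], by simp⟩ x y h1
    simp only [Matrix.SpecialLinearGroup.coe_mk, Matrix.of_apply, Matrix.cons_val', Matrix.cons_val_zero,
      Matrix.cons_val_one, Matrix.cons_val_fin_one, Int.cast_one, Int.cast_zero, one_mul, zero_mul,
      zero_add] at h2
    refine ⟨_, h2, ?_⟩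
    rw [Prod.dist_eq, max_lt_iff, Real.dist_eq, Real.dist_eq]
    refine ⟨?_, by simpa using hyε⟩
    have h3 := abs_sub_round ((t - x) / y)
    have h4 : t - (x + (round ((t - x) / y) : ℝ) * y)
        = ((t - x) / y - round ((t - x) / y)) * y := by
      field_simp; ring
    simp only [h4, abs_mul]
    nlinarith [abs_nonneg y]
  have step2 : ∀ (s : ℝ) (m n : ℤ), IsCoprime m n → (s * m, s * n) ∈ D := by
    intro s m n h
    obtain ⟨M, hM0, hM1⟩ := h.exists_SL2_col 0
    have := hinv M s 0 (step1 s)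
    rw [hM0, hM1] at this
    simpa [mul_comm] using this
  have step3 : ∀ (t : ℝ) (r : ℚ), (t * r, t) ∈ D := by
    intro t r
    have hcop : IsCoprime r.num (r.den : ℤ) := by
      rw [Int.isCoprime_iff_nat_coprime]
      simpa using r.reduced
    have hden : (0 : ℝ) < r.den := by exact_mod_cast r.den_pos
    have hqc : (r : ℝ) = r.num / r.den := by exact_mod_cast (Rat.num_div_den r).symm
    have := step2 (t / r.den) _ _ hcop
    convert this using 2
    · rw [hqc]; ring
    · push_cast; field_simp
  have step4 : ∀ t s : ℝ, (t * s, t) ∈ D := by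
    intro t s
    have hc : IsClosed {s : ℝ | (t * s, t) ∈ D} := hD.preimage (by fun_prop)
    exact (Rat.denseRange_cast (𝕜 := ℝ)).induction_on s hc (fun r => step3 t r)
  have hc : IsClosed {t : ℝ | (u, t) ∈ D} := hD.preimage (by fun_prop)
  have hdense : Dense ({0}ᶜ : Set ℝ) := dense_compl_singleton 0
  have hsub : ({0}ᶜ : Set ℝ) ⊆ {t : ℝ | (u, t) ∈ D} := by
    intro t ht
    have ht' : t ≠ 0 := ht
    have := step4 t (u / t)
    rwa [mul_div_cancel₀ _ ht'] at this
  exact hc.closure_subset_iff.2 hsub (hdense w)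

/-- The orbit of `v`. -/
def auxOrbit {ι : Type*} [Fintype ι] [DecidableEq ι] (v : ι → ℝ) : Set (ι → ℝ) :=
  {w | ∃ A : Matrix.SpecialLinearGroup ι ℤ,
        w = ((A : Matrix ι ι ℤ).map (Int.cast : ℤ → ℝ)).mulVec v}

theorem auxOrbit_mulVec {ι : Type*} [Fintype ι] [DecidableEq ι] (v x : ι → ℝ)
    (hx : x ∈ closure (auxOrbit v)) (B : Matrix.SpecialLinearGroup ι ℤ) :
    ((B : Matrix ι ι ℤ).map (Int.cast : ℤ → ℝ)).mulVec x ∈ closure (auxOrbit v) := by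
  refine map_mem_closure (f := fun x => ((B : Matrix ι ι ℤ).map (Int.cast : ℤ → ℝ)).mulVec x)
    (by fun_prop) hx ?_
  rintro _ ⟨A, rfl⟩
  refine ⟨B * A, ?_⟩
  have := Matrix.map_mul (L := (B : Matrix ι ι ℤ)) (M := (A : Matrix ι ι ℤ))
    (f := Int.castRingHom ℝ)
  simp only [Matrix.mulVec_mulVec, Matrix.SpecialLinearGroup.coe_mul]
  congr 1
  exact this.symm

theorem auxOrbit_block {ι : Type*} [Fintype ι] [DecidableEq ι] (v x : ι → ℝ)
    (hx : x ∈ closure (auxOrbit v)) (i j : ι) (hij : i ≠ j)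
    (M : Matrix.SpecialLinearGroup (Fin 2) ℤ) :
    Function.update (Function.update x i ((M 0 0 : ℝ) * x i + (M 0 1 : ℝ) * x j)) j
      ((M 1 0 : ℝ) * x i + (M 1 1 : ℝ) * x j) ∈ closure (auxOrbit v) := by
  let κ := {k : ι // k ≠ i ∧ k ≠ j}
  let f : Fin 2 ⊕ κ → ι := Sum.elim ![i, j] Subtype.val
  have hf : Function.Bijective f := by
    constructor
    · rintro (a | ⟨a, ha⟩) (b | ⟨b, hb⟩) h
      · fin_cases a <;> fin_cases b <;> simp_all [f, eq_comm]
      · fin_cases a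
        · exact absurd h.symm hb.1
        · exact absurd h.symm hb.2
      · fin_cases b <;> simp_all [f]
      · simp_all [f]
    · intro k
      by_cases h1 : k = i
      · exact ⟨Sum.inl 0, by simp [f, h1]⟩
      by_cases h2 : k = j
      · exact ⟨Sum.inl 1, by simp [f, h2]⟩
      exact ⟨Sum.inr ⟨k, h1, h2⟩, rfl⟩
  let e : Fin 2 ⊕ κ ≃ ι := Equiv.ofBijective f hf
  let A : Matrix ι ι ℤ :=
    (Matrix.fromBlocks (M : Matrix (Fin 2) (Fin 2) ℤ) 0 0 1).submatrix e.symm e.symm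
  have hA : A.det = 1 := by
    simp [A, Matrix.det_submatrix_equiv_self]
  have key := auxOrbit_mulVec v x hx ⟨A, hA⟩
  convert key using 1
  have hmap : A.map (Int.cast : ℤ → ℝ) = (Matrix.fromBlocks
      ((M : Matrix (Fin 2) (Fin 2) ℤ).map (Int.cast : ℤ → ℝ)) 0 0
      (1 : Matrix κ κ ℝ)).submatrix e.symm e.symm := by
    simp only [A, ← Matrix.submatrix_map, Matrix.fromBlocks_map]
    congr 2 <;> simp
  change _ = (A.map (Int.cast : ℤ → ℝ)).mulVec x
  rw [hmap, Matrix.submatrix_mulVec_equiv]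
  funext k
  obtain ⟨l, rfl⟩ := e.surjective k
  simp only [Function.comp_apply, Equiv.symm_apply_apply, Equiv.symm_symm, Matrix.fromBlocks_mulVec]
  rcases l with a | ⟨k, hk⟩
  · have e0 : e (Sum.inl 0) = i := rfl
    have e1 : e (Sum.inl 1) = j := rfl
    fin_cases a
    · simp [e0, e1, hij, Matrix.mulVec, dotProduct, Fin.sum_univ_two]
    · simp [e0, e1, Matrix.mulVec, dotProduct, Fin.sum_univ_two]
  · have e2 : e (Sum.inr ⟨k, hk⟩) = k := rfl
    simp [e2, hk.1, hk.2]

theorem auxOrbit_pair {ι : Type*} [Fintype ι] [DecidableEq ι] (v x : ι → ℝ)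
    (hx : x ∈ closure (auxOrbit v)) (i j : ι) (hij : i ≠ j) (hirr : Irrational (x i / x j))
    (u w : ℝ) :
    Function.update (Function.update x i u) j w ∈ closure (auxOrbit v) := by
  refine aux_two_dim {p : ℝ × ℝ | Function.update (Function.update x i p.1) j p.2 ∈
    closure (auxOrbit v)} ?_ ?_ (x i) (x j) ?_ hirr u w
  · refine isClosed_closure.preimage ?_
    have h1 : Continuous fun p : ℝ × ℝ => Function.update x i p.1 :=
      continuous_const.update i continuous_fst
    exact h1.update j continuous_snd
  · intro M a b h
    have := auxOrbit_block v _ h i j hij M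
    simp only [Set.mem_ofPred_eq]
    convert this using 1
    funext k
    by_cases h2 : k = j
    · subst h2; simp [hij]
    by_cases h1 : k = i
    · subst h1; simp [hij]
    simp [h1, h2]
  · simpa using hx

theorem auxOrbit_add {ι : Type*} [Fintype ι] [DecidableEq ι] (v x : ι → ℝ)
    (hx : x ∈ closure (auxOrbit v)) (k i : ι) (hki : k ≠ i) (p : ℤ) :
    Function.update x k (x k + p * x i) ∈ closure (auxOrbit v) := by
  have := auxOrbit_block v x hx k i hki ⟨!![1, p; 0, 1], by simp⟩
  convert this using 1
  funext l
  by_cases h2 : l = i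
  · subst h2; simp [hki.symm]
  by_cases h1 : l = k
  · subst h1; simp [hki]
  simp [h1, h2]

theorem auxOrbit_single {ι : Type*} [Fintype ι] [DecidableEq ι] (v x : ι → ℝ)
    (hx : x ∈ closure (auxOrbit v)) (i j k : ι) (hki : k ≠ i) (hkj : k ≠ j)
    (hirr : Irrational (x i / x j)) (t : ℝ) :
    Function.update x k t ∈ closure (auxOrbit v) := by
  have hd := dense_addSubgroupClosure_pair_iff.2 hirr
  have hc : IsClosed {s : ℝ | Function.update x k (x k + s) ∈ closure (auxOrbit v)} :=
    isClosed_closure.preimage (continuous_const.update k (by fun_prop))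
  have hsub : (AddSubgroup.closure {x i, x j} : Set ℝ) ⊆
      {s : ℝ | Function.update x k (x k + s) ∈ closure (auxOrbit v)} := by
    intro s hs
    obtain ⟨p, q, rfl⟩ := AddSubgroup.mem_closure_pair.1 hs
    have h1 := auxOrbit_add v x hx k i hki p
    have h2 := auxOrbit_add v _ h1 k j hkj q
    simpa [hkj.symm, add_assoc] using h2
  have := hc.closure_subset_iff.2 hsub (hd (t - x k))
  simpa using this

theorem auxOrbit_dense {ι : Type*} [Fintype ι] [DecidableEq ι] (v : ι → ℝ)
    (i j : ι) (hij : i ≠ j) (hirr : Irrational (v i / v j)) : Dense (auxOrbit v) := by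
  intro w
  have hv : v ∈ closure (auxOrbit v) := subset_closure ⟨1, by simp⟩
  have key : ∀ s : Finset ι, i ∉ s → j ∉ s → s.piecewise w v ∈ closure (auxOrbit v) := by
    intro s
    induction s using Finset.induction_on with
    | empty => intro _ _; simpa using hv
    | insert k s hk ih =>
      intro hi hj
      simp only [Finset.mem_insert, not_or] at hi hj
      rw [Finset.piecewise_insert]
      refine auxOrbit_single v _ (ih hi.2 hj.2) i j k (Ne.symm hi.1) (Ne.symm hj.1) ?_ _
      simpa [hi.2, hj.2] using hirr
  have h := key (Finset.univ \ {i, j}) (by simp) (by simp)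
  have h2 := auxOrbit_pair v _ h i j hij (by simpa using hirr) (w i) (w j)
  convert h2 using 1
  funext k
  by_cases h2 : k = j
  · subst h2; simp
  by_cases h1 : k = i
  · subst h1; simp [hij]
  simp [h1, h2, Finset.piecewise]

/-- **Dense orbits of `SL(n,ℤ)` on `ℝ^n`.**
For `n ≥ 2` and nonzero `v ∈ ℝ^n`, the orbit of `v` under `SL(n,ℤ)` acting by matrix
multiplication is dense in `ℝ^n` if and only if `v` is not a real scalar multiple of a
rational vector. -/
theorem slnZ_orbit_dense_iff (n : ℕ) (hn : 2 ≤ n) (v : Fin n → ℝ) (hv : v ≠ 0) :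
    Dense {w : Fin n → ℝ | ∃ A : Matrix.SpecialLinearGroup (Fin n) ℤ,
        w = ((A : Matrix (Fin n) (Fin n) ℤ).map (Int.cast : ℤ → ℝ)).mulVec v} ↔
      ¬ ∃ (t : ℝ) (q : Fin n → ℚ), v = t • fun i => (q i : ℝ) := by
  constructor
  · rintro hd ⟨t, q, hq⟩
    have ht : t ≠ 0 := by
      rintro rfl
      exact hv (by simpa using hq)
    obtain ⟨d, hd0, z, hz⟩ : ∃ d : ℕ, d ≠ 0 ∧ ∃ z : Fin n → ℤ, ∀ i, (q i : ℝ) = z i / d := by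
      refine ⟨∏ i, (q i).den, Finset.prod_ne_zero_iff.2 fun i _ => (q i).den_nz, ?_⟩
      have : ∀ i, ∃ z : ℤ, (q i : ℝ) = z / ((∏ i, (q i).den : ℕ) : ℝ) := by
        intro i
        obtain ⟨c, hc⟩ := Finset.dvd_prod_of_mem (fun i => (q i).den) (Finset.mem_univ i)
        have h0 : (∏ i, (q i).den) ≠ 0 := Finset.prod_ne_zero_iff.2 fun i _ => (q i).den_nz
        refine ⟨(q i).num * c, ?_⟩
        have hc0 : (c : ℝ) ≠ 0 := by
          rintro h
          have : c = 0 := by exact_mod_cast h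
          exact h0 (by rw [hc, this, mul_zero])
        have hden : ((q i).den : ℝ) ≠ 0 := by exact_mod_cast (q i).den_nz
        have hqc : (q i : ℝ) = (q i).num / (q i).den := by
          exact_mod_cast (Rat.num_div_den (q i)).symm
        rw [hc, hqc]
        push_cast
        field_simp
      choose z hz using this
      exact ⟨z, hz⟩
    have hdR : (d : ℝ) ≠ 0 := by exact_mod_cast hd0
    set c : ℝ := t / d with hcdef
    have hc : c ≠ 0 := div_ne_zero ht hdR
    let i0 : Fin n := ⟨0, by omega⟩
    obtain ⟨w, ⟨A, hA⟩, hw⟩ := hd.exists_mem_open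
      (U := {w : Fin n → ℝ | w i0 / c ∈ Set.Ioo (0 : ℝ) 1})
      (isOpen_Ioo.preimage (by fun_prop)) ⟨fun _ => c / 2, by
        simp only [Set.mem_ofPred_eq]
        rw [div_right_comm, div_self hc]
        norm_num⟩
    have hwc : w i0 / c = ((∑ k, (A : Matrix (Fin n) (Fin n) ℤ) i0 k * z k : ℤ) : ℝ) := by
      rw [div_eq_iff hc, hA, hq]
      simp only [Matrix.mulVec, dotProduct, Matrix.map_apply, Pi.smul_apply, smul_eq_mul, hz]
      push_cast
      rw [Finset.sum_mul]
      refine Finset.sum_congr rfl fun k _ => ?_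
      rw [hcdef]
      ring
    have hw' : w i0 / c ∈ Set.Ioo (0 : ℝ) 1 := hw
    rw [hwc] at hw'
    obtain ⟨h1, h2⟩ := hw'
    have h1' := Int.cast_pos.1 h1
    have h2' : (∑ k, (A : Matrix (Fin n) (Fin n) ℤ) i0 k * z k : ℤ) < 1 := by exact_mod_cast h2
    omega
  · intro h
    obtain ⟨j, hj⟩ : ∃ j, v j ≠ 0 := by
      by_contra! h0
      exact hv (funext h0)
    obtain ⟨i, hi⟩ : ∃ i, Irrational (v i / v j) := by
      by_contra! h0
      simp only [Irrational, not_not, Set.mem_range] at h0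
      choose q hq using h0
      refine h ⟨v j, q, ?_⟩
      funext i
      simp only [Pi.smul_apply, smul_eq_mul, hq]
      field_simp
    have hij : i ≠ j := by
      rintro rfl
      rw [div_self hj] at hi
      exact hi ⟨1, by simp⟩
    exact auxOrbit_dense v i j hij hi
end

section
/- For every n ≥ 2 there exist a continuous group homomorphism ρ from the additive group ℝ^{n+1} into GL(2n,ℝ) and a vector v ∈ ℝ^{2n} such that the orbit {ρ(t)·v : t ∈ ℝ^{n+1}} is dense in ℝ^{2n}. -/
/-- Generic frequencies give a dense set of exponentials (Baire category argument). -/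
theorem exists_alpha_dense (n : ℕ) : ∃ α : Fin n → ℝ,
    DenseRange (fun p : (Fin n → ℝ) × ℝ => fun j : Fin n =>
      Complex.exp ((p.1 j : ℂ) + (p.2 : ℂ) * (α j : ℂ) * Complex.I)) := by
  classical
  let F : (Fin n → ℝ) → ((Fin n → ℝ) × ℝ) → (Fin n → ℂ) := fun α p j =>
    Complex.exp ((p.1 j : ℂ) + (p.2 : ℂ) * (α j : ℂ) * Complex.I)
  let B := TopologicalSpace.countableBasis (Fin n → ℂ)
  let G : Set (Fin n → ℂ) → Set (Fin n → ℝ) := fun U => {α | ∃ p, F α p ∈ U}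
  have hopen : ∀ U ∈ B, IsOpen (G U) := by
    intro U hU
    have : G U = ⋃ p, (fun α => F α p) ⁻¹' U := by
      ext α; simp [G]
    rw [this]
    refine isOpen_iUnion fun p => ?_
    refine (TopologicalSpace.isOpen_of_mem_countableBasis hU).preimage ?_
    fun_prop
  have hdense : ∀ U ∈ B, Dense (G U) := by
    intro U hU
    have hUo := TopologicalSpace.isOpen_of_mem_countableBasis hU
    have hUn := TopologicalSpace.nonempty_of_mem_countableBasis hU
    have hd : Dense (Set.pi Set.univ (fun _ : Fin n => ({0}ᶜ : Set ℂ))) :=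
      dense_pi _ fun i _ => dense_compl_singleton 0
    obtain ⟨w, hw, hwU⟩ := hd.exists_mem_open hUo hUn
    have hw0 : ∀ j, w j ≠ 0 := fun j => by simpa using hw j (Set.mem_univ j)
    rw [Metric.dense_iff]
    intro α0 ε hε
    obtain ⟨s, hs⟩ : ∃ s : ℝ, s = 4 * Real.pi / ε := ⟨_, rfl⟩
    have hs0 : 0 < s := by rw [hs]; positivity
    let k : Fin n → ℤ := fun j => ⌊(s * α0 j - (w j).arg) / (2 * Real.pi)⌋
    let α : Fin n → ℝ := fun j => ((w j).arg + 2 * Real.pi * k j) / s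
    have hsα : ∀ j, s * α j = (w j).arg + 2 * Real.pi * k j := fun j => by
      simp only [α]; field_simp
    refine ⟨α, ?_, ⟨(fun j => Real.log ‖w j‖, s), ?_⟩⟩
    · rw [Metric.mem_ball, dist_pi_lt_iff hε]
      intro j
      have h1 := Int.floor_le ((s * α0 j - (w j).arg) / (2 * Real.pi))
      have h2 := Int.lt_floor_add_one ((s * α0 j - (w j).arg) / (2 * Real.pi))
      rw [le_div_iff₀ (by positivity)] at h1
      rw [div_lt_iff₀ (by positivity)] at h2
      have h3 : s * ε = 4 * Real.pi := by rw [hs]; field_simp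
      have h4 := hsα j
      simp only [k] at h4
      have hpi := Real.pi_pos
      rw [Real.dist_eq, abs_lt]
      constructor
      · apply lt_of_mul_lt_mul_left _ hs0.le
        linarith
      · apply lt_of_mul_lt_mul_left _ hs0.le
        linarith
    · convert hwU using 1
      funext j
      have h5 : (s : ℂ) * (α j : ℂ) = (w j).arg + k j * (2 * Real.pi) := by
        have := hsα j
        rw [← Complex.ofReal_mul, this]; push_cast; ring
      simp only [F]
      rw [h5, add_mul, ← add_assoc, mul_assoc (k j : ℂ), Complex.exp_add,
        Complex.exp_int_mul_two_pi_mul_I, mul_one, Complex.exp_add, ← Complex.ofReal_exp,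
        Real.exp_log (norm_pos_iff.mpr (hw0 j)), Complex.norm_mul_exp_arg_mul_I]
  have hbig : Dense (⋂ U ∈ B, G U) :=
    dense_biInter_of_isOpen hopen (TopologicalSpace.countable_countableBasis _) hdense
  obtain ⟨α, hα⟩ := hbig.nonempty
  refine ⟨α, ?_⟩
  rw [DenseRange, (TopologicalSpace.isBasis_countableBasis (Fin n → ℂ)).dense_iff]
  intro U hU _
  obtain ⟨p, hp⟩ := Set.mem_iInter₂.mp hα U hU
  exact ⟨_, hp, p, rfl⟩

/-- **Linear actions of `ℝ^{n+1}` on `ℝ^{2n}` with a dense orbit.**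
For every `n ≥ 2` there exist a continuous group homomorphism
`ρ : (ℝ^{n+1}, +) → GL(2n, ℝ)` and a vector `v ∈ ℝ^{2n}` whose orbit
`{ρ(t)·v : t ∈ ℝ^{n+1}}` is dense in `ℝ^{2n}`. -/
theorem exists_dense_orbit_Rnplus1_on_R2n (n : ℕ) (hn : 2 ≤ n) :
    ∃ (ρ : (Fin (n + 1) → ℝ) → Matrix.GeneralLinearGroup (Fin (2 * n)) ℝ)
      (v : Fin (2 * n) → ℝ),
      (∀ s t : Fin (n + 1) → ℝ, ρ (s + t) = ρ s * ρ t) ∧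
      Continuous ρ ∧
      Dense {w : Fin (2 * n) → ℝ |
        ∃ t : Fin (n + 1) → ℝ, w = ((ρ t : Matrix (Fin (2 * n)) (Fin (2 * n)) ℝ)).mulVec v} := by
  classical
  obtain ⟨α, hα⟩ := exists_alpha_dense n
  have hfr : Module.finrank ℝ (Fin n → ℂ) = 2 * n := by
    rw [Module.finrank_pi_fintype]
    simp [Complex.finrank_real_complex, mul_comm]
  obtain ⟨b⟩ : Nonempty (Module.Basis (Fin (2 * n)) ℝ (Fin n → ℂ)) :=
    ⟨Module.finBasisOfFinrankEq _ _ hfr⟩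
  obtain ⟨M, hMb⟩ : ∃ M, M = Algebra.leftMulMatrix b := ⟨_, rfl⟩
  have hM : Continuous M := M.toLinearMap.continuous_of_finiteDimensional
  let c : (Fin (n + 1) → ℝ) → Fin n → ℂ := fun t j =>
    (t (Fin.castSucc j) : ℂ) + (t (Fin.last n) : ℂ) * (α j : ℂ) * Complex.I
  let E : (Fin (n + 1) → ℝ) → (Fin n → ℂ)ˣ := fun t =>
    { val := fun j => Complex.exp (c t j)
      inv := fun j => Complex.exp (-c t j)
      val_inv := by funext j; simp [← Complex.exp_add]
      inv_val := by funext j; simp [← Complex.exp_add] }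
  refine ⟨fun t => Units.map (M : (Fin n → ℂ) →* _) (E t), b.equivFun 1, ?_, ?_, ?_⟩
  · intro s t
    suffices hE : E (s + t) = E s * E t by
      simp only [hE, map_mul]
    apply Units.ext
    funext j
    simp only [E, c, Units.val_mul, Pi.mul_apply, ← Complex.exp_add, Pi.add_apply]
    congr 1
    push_cast
    ring
  · rw [Units.continuous_iff]
    constructor
    · change Continuous (fun t => M (fun j => Complex.exp (c t j)))
      refine hM.comp ?_
      fun_prop
    · change Continuous (fun t => M (fun j => Complex.exp (-c t j)))
      refine hM.comp ?_
      fun_prop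
  · have hb : Continuous b.equivFun :=
      b.equivFun.toLinearMap.continuous_of_finiteDimensional
    have h1 := b.equivFun.surjective.denseRange.comp hα hb
    refine h1.mono ?_
    rintro _ ⟨p, rfl⟩
    refine ⟨Fin.snoc (α := fun _ => ℝ) p.1 p.2, ?_⟩
    change _ = (M (fun j => Complex.exp (c _ j))).mulVec (b.repr 1)
    rw [hMb, Algebra.leftMulMatrix_mulVec_repr, mul_one]
    simp [c]
end

section
/- Let n ≥ 1 and let μ be a Borel probability measure on ℝ^n. Then the group I(μ) = {g ∈ GL(n,ℝ) : g∗μ = μ} is a real algebraic subgroup of GL(n,ℝ): there exists a finite set of real polynomials in the n² matrix entries and in the inverse of the determinant whose common zero set in GL(n,ℝ) is exactly I(μ). -/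
open MeasureTheory

/-- averaging -/
lemma exists_average {n : ℕ} (K : Subgroup (Matrix.GeneralLinearGroup (Fin n) ℝ)) [CompactSpace K]
    [MeasurableSpace K] [BorelSpace K] (ν : Measure K) [IsFiniteMeasure ν]
    (p : MvPolynomial (Fin n × Fin n) ℝ) :
    ∃ P : MvPolynomial (Fin n × Fin n) ℝ, ∀ x : Matrix (Fin n) (Fin n) ℝ,
      MvPolynomial.eval (fun ij => x ij.1 ij.2) P =
      ∫ k : K, MvPolynomial.eval
        (fun ij => (x * ((k : Matrix.GeneralLinearGroup (Fin n) ℝ) : Matrix (Fin n) (Fin n) ℝ)) ij.1 ij.2) p ∂ν := by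
  classical
  let q : MvPolynomial (Fin n × Fin n) (MvPolynomial (Fin n × Fin n) ℝ) :=
    MvPolynomial.eval₂ (MvPolynomial.C.comp MvPolynomial.C)
      (fun ij => ∑ l, MvPolynomial.X (ij.1, l) * MvPolynomial.C (MvPolynomial.X (l, ij.2))) p
  have hq : ∀ (x k : Matrix (Fin n) (Fin n) ℝ),
      MvPolynomial.eval₂ (MvPolynomial.eval (fun ij => k ij.1 ij.2)) (fun ij => x ij.1 ij.2) q =
      MvPolynomial.eval (fun ij => (x * k) ij.1 ij.2) p := by
    intro x k
    induction p using MvPolynomial.induction_on with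
    | C a => simp [q]
    | add p r hp hr =>
      simp only [q, MvPolynomial.eval₂_add, map_add] at hp hr ⊢
      rw [hp, hr]
    | mul_X p i hp =>
      simp only [q, MvPolynomial.eval₂_mul, MvPolynomial.eval₂_X, map_mul, MvPolynomial.eval_X] at hp ⊢
      rw [hp]
      congr 1
      rw [← MvPolynomial.coe_eval₂Hom, map_sum]
      simp [Matrix.mul_apply]
  refine ⟨∑ d ∈ q.support, MvPolynomial.monomial d (∫ k : K, MvPolynomial.eval (fun ij => ((k : Matrix.GeneralLinearGroup (Fin n) ℝ) : Matrix (Fin n) (Fin n) ℝ) ij.1 ij.2) (q.coeff d) ∂ν), fun x => ?_⟩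
  simp_rw [← hq, MvPolynomial.eval₂_eq]
  rw [integral_finsetSum]
  · simp only [map_sum, MvPolynomial.eval_monomial, integral_mul_const]
    rfl
  · intro d _
    apply Integrable.mul_const
    apply Continuous.integrable_of_hasCompactSupport
    · apply (MvPolynomial.continuous_eval _).comp
      refine continuous_pi fun ij => ?_
      exact (Units.continuous_val.comp continuous_subtype_val).matrix_elem _ _
    · exact HasCompactSupport.of_compactSpace _

lemma exists_sep {σ : Type} [Finite σ] (A B : Set (σ → ℝ)) (hA : IsCompact A) (hB : IsCompact B)
    (hAB : Disjoint A B) : ∃ p : MvPolynomial σ ℝ,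
      (∀ a ∈ A, MvPolynomial.eval a p ≤ 1/4) ∧
      (∀ a ∈ B, 3/4 ≤ MvPolynomial.eval a p) := by
  classical
  have := Fintype.ofFinite σ
  obtain ⟨f, hf0, hf1, -⟩ := exists_continuous_zero_one_of_isClosed hA.isClosed hB.isClosed hAB
  let X : Set (σ → ℝ) := A ∪ B
  have : CompactSpace X := isCompact_iff_compactSpace.mp (hA.union hB)
  let co : σ → C(X, ℝ) := fun i => ⟨fun x => x.1 i, (continuous_apply i).comp continuous_subtype_val⟩
  let Φ : MvPolynomial σ ℝ →ₐ[ℝ] C(X, ℝ) := MvPolynomial.aeval co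
  have hsep : Φ.range.SeparatesPoints := by
    intro x y hxy
    have : ∃ i, x.1 i ≠ y.1 i := by
      by_contra! h
      exact hxy (Subtype.ext (funext fun i => h i))
    obtain ⟨i, hij⟩ := this
    refine ⟨co i, ⟨co i, ⟨MvPolynomial.X i, by simp [Φ]⟩, rfl⟩, hij⟩
  obtain ⟨⟨g, ⟨p, rfl⟩⟩, hg⟩ :=
    ContinuousMap.exists_mem_subalgebra_near_continuousMap_of_separatesPoints Φ.range hsep
    (f.restrict X) (1/4) (by norm_num)
  have hev : ∀ x : X, Φ p x = MvPolynomial.eval x.1 p := by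
    intro x
    clear hg
    induction p using MvPolynomial.induction_on with
    | C a => simp [Φ]
    | add p q hp hq => simp only [map_add, ContinuousMap.add_apply, hp, hq]
    | mul_X p i hp =>
      simp only [map_mul, ContinuousMap.mul_apply, hp]
      simp [Φ, co]
  refine ⟨p, fun a ha => ?_, fun a ha => ?_⟩
  · have := (ContinuousMap.norm_coe_le_norm _ ⟨a, Or.inl ha⟩).trans hg.le
    have h0 : f a = 0 := hf0 ha
    change |Φ p ⟨a, Or.inl ha⟩ - f a| ≤ _ at this
    rw [hev, h0, abs_le] at this
    linarith [this.2]
  · have := (ContinuousMap.norm_coe_le_norm _ ⟨a, Or.inr ha⟩).trans hg.le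
    have h0 : f a = 1 := hf1 ha
    change |Φ p ⟨a, Or.inr ha⟩ - f a| ≤ _ at this
    rw [hev, h0, abs_le] at this
    linarith [this.1]

lemma compact_algebraic {n : ℕ} (K : Subgroup (Matrix.GeneralLinearGroup (Fin n) ℝ)) [CompactSpace K] :
    ∃ s : Finset (MvPolynomial (Fin n × Fin n) ℝ), ∀ h : Matrix (Fin n) (Fin n) ℝ,
      (∃ k ∈ K, (k : Matrix (Fin n) (Fin n) ℝ) = h) ↔
        ∀ p ∈ s, MvPolynomial.eval (fun ij => h ij.1 ij.2) p = 0 := by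
  classical
  let _ : MeasurableSpace K := borel K
  have : BorelSpace K := ⟨rfl⟩
  let ν : Measure K := Measure.haar
  let V : Ideal (MvPolynomial (Fin n × Fin n) ℝ) :=
    ⨅ k : K, RingHom.ker (MvPolynomial.eval (fun ij : Fin n × Fin n => ((k : Matrix.GeneralLinearGroup (Fin n) ℝ) : Matrix (Fin n) (Fin n) ℝ) ij.1 ij.2))
  obtain ⟨s, hs⟩ : V.FG := IsNoetherian.noetherian V
  refine ⟨s, fun h => ⟨?_, ?_⟩⟩
  · rintro ⟨k, hk, rfl⟩ p hp
    have : p ∈ V := hs ▸ Ideal.subset_span hp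
    exact (Ideal.mem_iInf.mp this) ⟨k, hk⟩
  · intro hz
    have hz' : ∀ p ∈ V, MvPolynomial.eval (fun ij => h ij.1 ij.2) p = 0 := by
      have : V ≤ RingHom.ker (MvPolynomial.eval (fun ij : Fin n × Fin n => h ij.1 ij.2)) := by
        rw [← hs]; exact Ideal.span_le.mpr hz
      exact fun p hp => this hp
    by_contra hh
    push Not at hh
    let v : K → Matrix (Fin n) (Fin n) ℝ := fun k => ((k : Matrix.GeneralLinearGroup (Fin n) ℝ) : Matrix (Fin n) (Fin n) ℝ)
    have hv : Continuous v := Units.continuous_val.comp continuous_subtype_val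
    have hvh : Continuous fun k => h * v k := continuous_const.mul hv
    have hw : ∀ x : Matrix (Fin n) (Fin n) ℝ,
        Continuous fun (k : K) (ij : Fin n × Fin n) => (x * v k) ij.1 ij.2 := fun x =>
      continuous_pi fun ij => (continuous_const.mul hv).matrix_elem _ _
    obtain ⟨p, hp0, hp1⟩ := exists_sep
      (Set.range fun (k : K) (ij : Fin n × Fin n) => ((1 : Matrix (Fin n) (Fin n) ℝ) * v k) ij.1 ij.2)
      (Set.range fun (k : K) (ij : Fin n × Fin n) => (h * v k) ij.1 ij.2)
      (isCompact_range (hw 1)) (isCompact_range (hw h)) (by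
        rw [Set.disjoint_left]
        rintro _ ⟨k, rfl⟩ ⟨k', hk'⟩
        apply hh (k * k'⁻¹ : K) (k * k'⁻¹ : K).2
        have : h * v k' = v k := by
          ext i j
          simpa using congrFun hk' (i, j)
        simp only [Subgroup.coe_mul, Units.val_mul, Subgroup.coe_inv]
        change v k * _ = h
        rw [← this, mul_assoc]
        simp [v])
    obtain ⟨P, hP⟩ := exists_average K ν p
    have hint : ∀ x : Matrix (Fin n) (Fin n) ℝ, Integrable (fun k : K => MvPolynomial.eval (fun ij => (x * v k) ij.1 ij.2) p) ν := by
      intro x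
      apply Continuous.integrable_of_hasCompactSupport
      · apply (MvPolynomial.continuous_eval _).comp
        exact hw x
      · exact HasCompactSupport.of_compactSpace _
    have hinv : ∀ k : K, MvPolynomial.eval (fun ij => v k ij.1 ij.2) P = MvPolynomial.eval (fun ij => (1 : Matrix (Fin n) (Fin n) ℝ) ij.1 ij.2) P := by
      intro k
      rw [hP, hP]
      have := integral_mul_left_eq_self (μ := ν) (fun k' : K => MvPolynomial.eval (fun ij => ((1 : Matrix (Fin n) (Fin n) ℝ) * v k') ij.1 ij.2) p) k
      rw [← this]
      simp [v]
    have hmem : P - MvPolynomial.C (MvPolynomial.eval (fun ij => (1 : Matrix (Fin n) (Fin n) ℝ) ij.1 ij.2) P) ∈ V := by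
      refine Ideal.mem_iInf.mpr fun k => ?_
      rw [RingHom.mem_ker, map_sub, MvPolynomial.eval_C, sub_eq_zero]
      exact hinv k
    have h1 := hz' _ hmem
    rw [map_sub, MvPolynomial.eval_C, sub_eq_zero, hP, hP] at h1
    have e1 : ∫ k : K, MvPolynomial.eval (fun ij => (h * v k) ij.1 ij.2) p ∂ν ≥ ∫ k : K, (3/4 : ℝ) ∂ν :=
      integral_mono (integrable_const _) (hint h) fun k => hp1 _ ⟨k, rfl⟩
    have e2 : ∫ k : K, MvPolynomial.eval (fun ij => ((1 : Matrix (Fin n) (Fin n) ℝ) * v k) ij.1 ij.2) p ∂ν ≤ ∫ k : K, (1/4 : ℝ) ∂ν :=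
      integral_mono (hint 1) (integrable_const _) fun k => hp0 _ ⟨k, rfl⟩
    have hm : 0 < ν.real Set.univ := by
      rw [measureReal_def]
      exact ENNReal.toReal_pos (NeZero.ne _) (measure_ne_top _ _)
    simp only [integral_const, smul_eq_mul] at e1 e2
    change ∫ k : K, MvPolynomial.eval (fun ij => (h * v k) ij.1 ij.2) p ∂ν = ∫ k : K, MvPolynomial.eval (fun ij => ((1 : Matrix (Fin n) (Fin n) ℝ) * v k) ij.1 ij.2) p ∂ν at h1
    linarith

lemma exists_min_subspace {n : ℕ} (μ : Measure (Fin n → ℝ)) :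
    ∃ W : Submodule ℝ (Fin n → ℝ), (∀ᵐ v ∂μ, v ∈ W) ∧
      ∀ W' : Submodule ℝ (Fin n → ℝ), (∀ᵐ v ∂μ, v ∈ W') → W ≤ W' := by
  obtain ⟨W, hW, hmin⟩ := wellFounded_lt.has_min {W : Submodule ℝ (Fin n → ℝ) | ∀ᵐ v ∂μ, v ∈ W}
    ⟨⊤, by simp⟩
  refine ⟨W, hW, fun W' hW' => ?_⟩
  have h : (W ⊓ W') ∈ {W : Submodule ℝ (Fin n → ℝ) | ∀ᵐ v ∂μ, v ∈ W} := by
    filter_upwards [hW, hW'] with v h1 h2 using ⟨h1, h2⟩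
  have := hmin _ h
  by_contra hc
  exact this (lt_of_le_of_ne inf_le_left fun e => hc (inf_eq_left.mp e))

lemma exists_proj {n : ℕ} (W : Submodule ℝ (Fin n → ℝ)) :
    ∃ B : Matrix (Fin n) (Fin n) ℝ, (∀ v, B.mulVec v ∈ W) ∧ ∀ v ∈ W, B.mulVec v = v := by
  obtain ⟨f, hf⟩ := LinearMap.exists_leftInverse_of_injective W.subtype (by simp)
  refine ⟨LinearMap.toMatrix' (W.subtype ∘ₗ f), fun v => ?_, fun v hv => ?_⟩
  · rw [LinearMap.toMatrix'_mulVec]; simp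
  · rw [LinearMap.toMatrix'_mulVec]
    have := LinearMap.congr_fun hf ⟨v, hv⟩
    simpa using congrArg Subtype.val this

lemma measurable_mulVec {n : ℕ} (a : Matrix (Fin n) (Fin n) ℝ) :
    Measurable (fun v : Fin n → ℝ => a.mulVec v) :=
  (Continuous.matrix_mulVec continuous_const continuous_id).measurable

/-- the set of matrices preserving the measure -/
def preservers {n : ℕ} (μ : Measure (Fin n → ℝ)) : Set (Matrix (Fin n) (Fin n) ℝ) :=
  {a | Measure.map (fun v => a.mulVec v) μ = μ}

lemma preservers_mul {n : ℕ} {μ : Measure (Fin n → ℝ)} {a b : Matrix (Fin n) (Fin n) ℝ}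
    (ha : a ∈ preservers μ) (hb : b ∈ preservers μ) : a * b ∈ preservers μ := by
  unfold preservers at *
  simp only [Set.mem_ofPred_eq] at *
  conv_rhs => rw [← ha, ← hb]
  rw [Measure.map_map (measurable_mulVec a) (measurable_mulVec b)]
  congr 1
  ext v : 1
  simp [Matrix.mulVec_mulVec]

lemma preservers_one {n : ℕ} (μ : Measure (Fin n → ℝ)) :
    (1 : Matrix (Fin n) (Fin n) ℝ) ∈ preservers μ := by
  simp [preservers]

lemma preservers_inv {n : ℕ} {μ : Measure (Fin n → ℝ)} {a b : Matrix (Fin n) (Fin n) ℝ}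
    (ha : a ∈ preservers μ) (hb : b * a = 1) : b ∈ preservers μ := by
  unfold preservers at *
  simp only [Set.mem_ofPred_eq] at *
  conv_lhs => rw [← ha]
  rw [Measure.map_map (measurable_mulVec b) (measurable_mulVec a)]
  have : ((fun v => b.mulVec v) ∘ fun v => a.mulVec v) = id := by
    ext v : 1
    simp [Matrix.mulVec_mulVec, hb]
  rw [this, Measure.map_id]

section CompactPart

open Filter Topology

attribute [local instance] Matrix.linftyOpNormedRing Matrix.linftyOpNormedAlgebra

lemma isClosed_preservers {n : ℕ} (μ : Measure (Fin n → ℝ)) [IsProbabilityMeasure μ] :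
    IsClosed (preservers μ) := by
  have : preservers μ = ⋂ f : BoundedContinuousFunction (Fin n → ℝ) ℝ,
      {a | ∫ v, f (a.mulVec v) ∂μ = ∫ v, f v ∂μ} := by
    ext a
    simp only [Set.mem_iInter, Set.mem_ofPred_eq]
    have hm : ∀ f : BoundedContinuousFunction (Fin n → ℝ) ℝ,
        ∫ v, f v ∂(Measure.map (fun v => a.mulVec v) μ) = ∫ v, f (a.mulVec v) ∂μ := fun f =>
      integral_map (measurable_mulVec a).aemeasurable f.continuous.aestronglyMeasurable
    constructor
    · intro ha f
      rw [← hm, show Measure.map (fun v => a.mulVec v) μ = μ from ha]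
    · intro h
      have := Measure.isProbabilityMeasure_map (μ := μ) (measurable_mulVec a).aemeasurable
      exact ext_of_forall_integral_eq_of_IsFiniteMeasure fun f => by rw [hm, h]
  rw [this]
  refine isClosed_iInter fun f => isClosed_eq ?_ continuous_const
  have hfc : FirstCountableTopology (Matrix (Fin n) (Fin n) ℝ) :=
    inferInstanceAs (FirstCountableTopology (Fin n → Fin n → ℝ))
  refine continuous_of_dominated (bound := fun _ => ‖f‖) ?_ ?_ (integrable_const _) ?_
  · intro a
    exact (f.continuous.measurable.comp (measurable_mulVec a)).aestronglyMeasurable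
  · intro a
    exact ae_of_all _ fun v => f.norm_coe_le_norm _
  · exact ae_of_all _ fun v => f.continuous.comp
      (Continuous.matrix_mulVec continuous_id continuous_const)

/-- escape of mass -/
lemma escape {n : ℕ} (μ : Measure (Fin n → ℝ)) [IsProbabilityMeasure μ]
    (g : ℕ → Matrix (Fin n) (Fin n) ℝ) (hg : ∀ k, g k ∈ preservers μ)
    (hlim : Tendsto (fun k => ‖g k‖) atTop atTop) (h : Matrix (Fin n) (Fin n) ℝ)
    (hh : Tendsto (fun k => ‖g k‖⁻¹ • g k) atTop (𝓝 h)) :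
    ∀ᵐ v ∂μ, h.mulVec v = 0 := by
  have hNm : MeasurableSet {v : Fin n → ℝ | h.mulVec v = 0} :=
    measurable_mulVec h (measurableSet_singleton 0)
  have key : ∀ R : ℕ, μ (Metric.closedBall 0 R) ≤ μ {v | h.mulVec v = 0} := by
    intro R
    let A : ℕ → Set (Fin n → ℝ) := fun k =>
      (fun v => (g k).mulVec v) ⁻¹' (Metric.closedBall 0 R) ∩ {v | h.mulVec v = 0}ᶜ
    have hAm : ∀ k, MeasurableSet (A k) := fun k =>
      (measurable_mulVec (g k) Metric.isClosed_closedBall.measurableSet).inter hNm.compl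
    have hA : Tendsto (fun k => μ (A k)) atTop (𝓝 (μ ∅)) := by
      refine tendsto_measure_of_ae_tendsto_indicator_of_isFiniteMeasure atTop
        MeasurableSet.empty hAm (ae_of_all _ fun v => ?_)
      simp only [Set.mem_empty_iff_false, iff_false]
      by_cases hv : h.mulVec v = 0
      · exact Eventually.of_forall fun k hk => hk.2 hv
      · have h1 : Tendsto (fun k => ‖(‖g k‖⁻¹ • g k).mulVec v‖) atTop (𝓝 ‖h.mulVec v‖) :=
          by
          have hc : Continuous fun a : Matrix (Fin n) (Fin n) ℝ => ‖a.mulVec v‖ :=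
            (Continuous.matrix_mulVec continuous_id continuous_const).norm
          exact (hc.tendsto h).comp hh
        have h2 := hlim.atTop_mul_pos (norm_pos_iff.mpr hv) h1
        filter_upwards [h2.eventually_gt_atTop (R : ℝ), hlim.eventually_gt_atTop 0] with k hk hk0 hkA
        have h3 := hkA.1
        simp only [Set.mem_preimage, mem_closedBall_zero_iff] at h3
        rw [Matrix.smul_mulVec, norm_smul, norm_inv, norm_norm, ← mul_assoc,
          mul_inv_cancel₀ hk0.ne', one_mul] at hk
        linarith
    have hle : ∀ k, μ (Metric.closedBall 0 R) ≤ μ (A k) + μ {v | h.mulVec v = 0} := by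
      intro k
      have : μ (Metric.closedBall 0 R) = μ ((fun v => (g k).mulVec v) ⁻¹' (Metric.closedBall 0 R)) := by
        conv_lhs => rw [← show Measure.map (fun v => (g k).mulVec v) μ = μ from hg k]
        exact Measure.map_apply (measurable_mulVec _) Metric.isClosed_closedBall.measurableSet
      rw [this]
      refine (measure_mono ?_).trans (measure_union_le _ _)
      intro v hv
      by_cases h0 : h.mulVec v = 0
      · exact Or.inr h0
      · exact Or.inl ⟨hv, h0⟩
    have := ge_of_tendsto' (hA.add_const (μ {v | h.mulVec v = 0})) hle
    simpa using this
  have hu : Tendsto (fun R : ℕ => μ (Metric.closedBall (0 : Fin n → ℝ) R)) atTop (𝓝 (μ Set.univ)) := by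
    rw [← Metric.iUnion_closedBall_nat (0 : Fin n → ℝ)]
    exact tendsto_measure_iUnion_atTop fun a b hab =>
      Metric.closedBall_subset_closedBall (by exact_mod_cast hab)
  have h1 := le_of_tendsto' hu key
  rw [measure_univ] at h1
  have h2 : μ {v | h.mulVec v = 0} = 1 := le_antisymm prob_le_one h1
  exact (prob_compl_eq_zero_iff hNm).mpr h2

lemma isCompact_preservers {n : ℕ} (μ : Measure (Fin n → ℝ)) [IsProbabilityMeasure μ]
    (W : Submodule ℝ (Fin n → ℝ)) 
    (hmin : ∀ W' : Submodule ℝ (Fin n → ℝ), (∀ᵐ v ∂μ, v ∈ W') → W ≤ W')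
    (B : Matrix (Fin n) (Fin n) ℝ) (hB : ∀ v, B.mulVec v ∈ W) :
    IsCompact (preservers μ ∩ {a | a * (1 - B) = 1 - B}) := by
  refine Metric.isCompact_of_isClosed_isBounded
    ((isClosed_preservers μ).inter (isClosed_eq (continuous_id.mul continuous_const) continuous_const)) ?_
  by_contra hb
  have : ∀ k : ℕ, ∃ a ∈ (preservers μ ∩ {a | a * (1 - B) = 1 - B}), (k : ℝ) < ‖a‖ := by
    intro k
    by_contra! hc
    exact hb (isBounded_iff_forall_norm_le.mpr ⟨k, hc⟩)
  choose g hg hgk using this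
  have hsph : ∀ k, ‖g k‖⁻¹ • g k ∈ Metric.sphere (0 : Matrix (Fin n) (Fin n) ℝ) 1 := by
    intro k
    have : 0 < ‖g k‖ := (Nat.cast_nonneg k).trans_lt (hgk k)
    rw [mem_sphere_zero_iff_norm, norm_smul, norm_inv, norm_norm, inv_mul_cancel₀ this.ne']
  obtain ⟨h, hh1, φ, hφ, hlim⟩ := (isCompact_sphere (0 : Matrix (Fin n) (Fin n) ℝ) 1).tendsto_subseq hsph
  have hinf : Tendsto (fun k => ‖g k‖) atTop atTop :=
    tendsto_atTop_mono (fun k => (hgk k).le) tendsto_natCast_atTop_atTop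
  have hinf' := hinf.comp hφ.tendsto_atTop
  have hes := escape μ (g ∘ φ) (fun k => (hg _).1) hinf' h hlim
  have hW : W ≤ LinearMap.ker (Matrix.mulVecLin h) := hmin _ (by simpa using hes)
  have hhB : h * B = 0 := by
    apply Matrix.ext_of_mulVec_single
    intro i
    rw [← Matrix.mulVec_mulVec]
    rw [Matrix.zero_mulVec]
    exact hW (hB (Pi.single i 1))
  have hh2 : h * (1 - B) = 0 := by
    have l1 : Tendsto (fun k => (‖g (φ k)‖⁻¹ • g (φ k)) * (1 - B)) atTop (𝓝 (h * (1 - B))) :=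
      hlim.mul_const _
    have l2 : Tendsto (fun k => ‖g (φ k)‖⁻¹ • (1 - B)) atTop (𝓝 ((0:ℝ) • (1 - B))) :=
      (tendsto_inv_atTop_zero.comp hinf').smul_const _
    rw [zero_smul] at l2
    refine tendsto_nhds_unique l1 (l2.congr fun k => ?_)
    rw [smul_mul_assoc, (hg _).2]
  have : h = 0 := by
    have : h = h * B + h * (1 - B) := by rw [← mul_add]; simp
    rw [this, hhB, hh2, add_zero]
  rw [this] at hh1
  simp at hh1

lemma isUnit_of_preserver {n : ℕ} {μ : Measure (Fin n → ℝ)}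
    {W : Submodule ℝ (Fin n → ℝ)} 
    (hmin : ∀ W' : Submodule ℝ (Fin n → ℝ), (∀ᵐ v ∂μ, v ∈ W') → W ≤ W')
    {B : Matrix (Fin n) (Fin n) ℝ} (hB : ∀ v, B.mulVec v ∈ W)
    {a : Matrix (Fin n) (Fin n) ℝ} (ha : a ∈ preservers μ) (ha2 : a * (1 - B) = 1 - B) :
    IsUnit a := by
  have hW : W ≤ LinearMap.range (Matrix.mulVecLin a) := by
    apply hmin
    rw [← show Measure.map (fun v => a.mulVec v) μ = μ from ha]
    rw [ae_map_iff (measurable_mulVec a).aemeasurable]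
    · exact ae_of_all _ fun v => ⟨v, rfl⟩
    · exact (Submodule.closed_of_finiteDimensional (LinearMap.range (Matrix.mulVecLin a))).measurableSet
  rw [← Matrix.mulVec_surjective_iff_isUnit]
  intro v
  obtain ⟨w, hw⟩ := hW (hB v)
  refine ⟨w + (1 - B).mulVec v, ?_⟩
  simp only [Matrix.mulVecLin_apply] at hw
  rw [Matrix.mulVec_add, hw, Matrix.mulVec_mulVec, ha2, Matrix.sub_mulVec]
  simp

/-- the compact group attached to the measure -/
def cptGroup {n : ℕ} (μ : Measure (Fin n → ℝ)) (B : Matrix (Fin n) (Fin n) ℝ) :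
    Subgroup (Matrix.GeneralLinearGroup (Fin n) ℝ) where
  carrier := {g | (g : Matrix (Fin n) (Fin n) ℝ) ∈ preservers μ ∩ {a | a * (1 - B) = 1 - B}}
  one_mem' := ⟨by simpa using preservers_one μ, by simp⟩
  mul_mem' := by
    rintro a b ⟨ha, ha2⟩ ⟨hb, hb2⟩
    refine ⟨by simpa using preservers_mul ha hb, ?_⟩
    simp only [Set.mem_ofPred_eq, Units.val_mul] at *
    rw [mul_assoc, hb2, ha2]
  inv_mem' := by
    rintro a ⟨ha, ha2⟩
    refine ⟨preservers_inv ha (Units.inv_mul a), ?_⟩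
    simp only [Set.mem_ofPred_eq] at *
    conv_lhs => rw [← ha2]
    rw [← mul_assoc, Units.inv_mul, one_mul]

lemma compactSpace_cptGroup {n : ℕ} (μ : Measure (Fin n → ℝ)) [IsProbabilityMeasure μ]
    (W : Submodule ℝ (Fin n → ℝ)) 
    (hmin : ∀ W' : Submodule ℝ (Fin n → ℝ), (∀ᵐ v ∂μ, v ∈ W') → W ≤ W')
    (B : Matrix (Fin n) (Fin n) ℝ) (hB : ∀ v, B.mulVec v ∈ W) :
    CompactSpace (cptGroup μ B) := by
  apply (isCompact_iff_compactSpace (s := (cptGroup μ B : Set (Matrix.GeneralLinearGroup (Fin n) ℝ)))).mp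
  have he := (Units.isOpenEmbedding_val (R := Matrix (Fin n) (Fin n) ℝ)).isInducing
  refine he.isCompact_iff.mpr ?_
  have heq : Set.image Units.val (cptGroup μ B : Set (Matrix.GeneralLinearGroup (Fin n) ℝ)) =
      preservers μ ∩ {a | a * (1 - B) = 1 - B} := by
    ext a
    constructor
    · rintro ⟨g, hg, rfl⟩
      exact hg
    · intro ha
      obtain ⟨u, rfl⟩ := isUnit_of_preserver hmin hB ha.1 ha.2
      exact ⟨u, ha, rfl⟩
  rw [heq]
  exact isCompact_preservers μ W hmin B hB

end CompactPart

open MeasureTheory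

/-- **The invariance group of a probability measure on `ℝ^n` is real algebraic.**
For a Borel probability measure `μ` on `ℝ^n`, the group
`I(μ) = {g ∈ GL(n,ℝ) : g∗μ = μ}` is a real algebraic subgroup of `GL(n,ℝ)`: there is a
finite set of real polynomials in the matrix entries `g i j` and in `(det g)⁻¹` whose
common zero set in `GL(n,ℝ)` is exactly `I(μ)`. -/
theorem invariance_group_is_algebraic (n : ℕ) (hn : 1 ≤ n)
    (μ : Measure (Fin n → ℝ)) [IsProbabilityMeasure μ] :
    ∃ s : Finset (MvPolynomial ((Fin n × Fin n) ⊕ Unit) ℝ),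
      ∀ g : Matrix.GeneralLinearGroup (Fin n) ℝ,
        (Measure.map (fun v => ((g : Matrix (Fin n) (Fin n) ℝ)).mulVec v) μ = μ) ↔
        ∀ p ∈ s,
          MvPolynomial.eval
            (Sum.elim (fun ij : Fin n × Fin n => (g : Matrix (Fin n) (Fin n) ℝ) ij.1 ij.2)
              (fun _ : Unit => ((g : Matrix (Fin n) (Fin n) ℝ).det)⁻¹)) p = 0 := by
  classical
  obtain ⟨W, hW, hmin⟩ := exists_min_subspace μ
  obtain ⟨B, hB, hBW⟩ := exists_proj W
  have := compactSpace_cptGroup μ W hmin B hB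
  obtain ⟨s, hs⟩ := compact_algebraic (cptGroup μ B)
  let θ : MvPolynomial (Fin n × Fin n) ℝ →ₐ[ℝ] MvPolynomial ((Fin n × Fin n) ⊕ Unit) ℝ :=
    MvPolynomial.aeval fun ij => (∑ l, MvPolynomial.X (Sum.inl (ij.1, l)) * MvPolynomial.C (B l ij.2))
      + MvPolynomial.C ((1 - B) ij.1 ij.2)
  have hθ : ∀ (g : Matrix (Fin n) (Fin n) ℝ) (t : Unit → ℝ) (p : MvPolynomial (Fin n × Fin n) ℝ),
      MvPolynomial.eval (Sum.elim (fun ij : Fin n × Fin n => g ij.1 ij.2) t) (θ p) =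
      MvPolynomial.eval (fun ij => (g * B + (1 - B)) ij.1 ij.2) p := by
    intro g t p
    induction p using MvPolynomial.induction_on with
    | C a => simp [θ]
    | add p q hp hq => simp only [map_add, hp, hq]
    | mul_X p i hp =>
      simp only [map_mul, hp, MvPolynomial.eval_X]
      congr 1
      simp [θ, Matrix.mul_apply]
  have hBB : B * B = B := by
    apply Matrix.ext_of_mulVec_single
    intro i
    rw [← Matrix.mulVec_mulVec]
    exact hBW _ (hB _)
  have hmap : ∀ g : Matrix (Fin n) (Fin n) ℝ,
      Measure.map (fun v => g.mulVec v) μ = Measure.map (fun v => (g * B + (1 - B)).mulVec v) μ := by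
    intro g
    apply Measure.map_congr
    filter_upwards [hW] with v hv
    rw [Matrix.add_mulVec, ← Matrix.mulVec_mulVec, Matrix.sub_mulVec, hBW v hv]
    simp
  have hfix : ∀ g : Matrix (Fin n) (Fin n) ℝ, (g * B + (1 - B)) * (1 - B) = 1 - B := by
    intro g
    have h1 : B * (1 - B) = 0 := by rw [mul_sub, hBB]; simp
    rw [add_mul, mul_assoc, h1, sub_mul, h1]
    simp
  refine ⟨s.image θ, fun g => ?_⟩
  have h1 := hs ((g : Matrix (Fin n) (Fin n) ℝ) * B + (1 - B))
  simp only [Finset.mem_image, forall_exists_index, and_imp, forall_apply_eq_imp_iff₂, hθ]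
  rw [← h1, hmap]
  constructor
  · intro h
    obtain ⟨u, hu⟩ := isUnit_of_preserver (μ := μ) hmin hB h (hfix g)
    refine ⟨u, ?_, hu⟩
    change (u : Matrix (Fin n) (Fin n) ℝ) ∈ preservers μ ∩ {a | a * (1 - B) = 1 - B}
    rw [hu]
    exact ⟨h, hfix g⟩
  · rintro ⟨u, hu, hug⟩
    rw [← hug]
    exact hu.1
end

section
/- Let n ≥ 1 and let μ be a Borel probability measure on ℝ^n that is invariant under the action of a compact, connected, infinite subgroup K of GL(n,ℝ). Assume that no nonzero vector of ℝ^n is fixed by every element of K, and that μ(U) = 0 for every proper linear subspace U of ℝ^n. Then the n-fold convolution power μ^{*n} is absolutely continuous with respect to Lebesgue measure on ℝ^n. -/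
open MeasureTheory

/-- The `k`-fold additive convolution power of a measure (`k = 0` gives the Dirac mass
at `0`). -/
noncomputable def convPow {E : Type*} [AddMonoid E] [MeasurableSpace E]
    (μ : Measure E) : ℕ → Measure E
  | 0 => Measure.dirac 0
  | k + 1 => Measure.conv (convPow μ k) μ

/-- nonvanishing a.e. of analytic functions. -/
lemma ae_ne_zero_of_analytic : ∀ (k : ℕ) (f : (Fin k → ℝ) → ℝ), AnalyticOnNhd ℝ f Set.univ →
    (∃ t, f t ≠ 0) → ∀ᵐ t, f t ≠ 0
  | 0, f, _, ⟨t, ht⟩ => by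
      filter_upwards with s
      rwa [Subsingleton.elim s t]
  | k+1, f, hf, ⟨t, ht⟩ => by
      have hmp := volume_preserving_piFinSuccAbove (fun _ : Fin (k+1) => ℝ) 0
      have hmp' := hmp.symm
      have hA : ∀ p : ℝ × (Fin k → ℝ), AnalyticAt ℝ (fun p : ℝ × (Fin k → ℝ) => (Fin.cons p.1 p.2 : Fin (k+1) → ℝ)) p := by
        intro p
        rw [analyticAt_pi_iff]
        intro i
        refine Fin.cases ?_ (fun j => ?_) i
        · simpa using analyticAt_fst
        · simp only [Fin.cons_succ]
          exact (ContinuousLinearMap.analyticAt (ContinuousLinearMap.proj (R := ℝ) (φ := fun _ : Fin k => ℝ) j) _).comp analyticAt_snd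
      have hg : ∀ p, AnalyticAt ℝ (fun p : ℝ × (Fin k → ℝ) => f (Fin.cons p.1 p.2)) p := fun p =>
        (hf _ (Set.mem_univ _)).comp (hA p)
      have key : ∀ᵐ p : ℝ × (Fin k → ℝ), f (Fin.cons p.1 p.2) ≠ 0 := by
        have hms : MeasurableSet {p : ℝ × (Fin k → ℝ) | f (Fin.cons p.1 p.2) ≠ 0} := by
          have : Continuous (fun p : ℝ × (Fin k → ℝ) => f (Fin.cons p.1 p.2)) :=
            continuous_iff_continuousAt.2 fun p => (hg p).continuousAt
          exact (isOpen_ne_fun this continuous_const).measurableSet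
        refine (Measure.ae_prod_iff_ae_ae hms).2 ?_
        have h1 : ∀ᵐ a : ℝ, f (Fin.cons a (Fin.tail t)) ≠ 0 := by
          have hs : AnalyticOnNhd ℝ (fun a : ℝ => f (Fin.cons a (Fin.tail t))) Set.univ := fun a _ =>
            (hg (a, Fin.tail t)).comp (f := fun a : ℝ => (a, Fin.tail t)) (analyticAt_id.prod analyticAt_const)
          have h2 := hs.preimage_zero_mem_codiscrete (x := t 0) (by simpa using ht)
          have h3 := ae_restrict_le_codiscreteWithin (μ := (volume : Measure ℝ)) MeasurableSet.univ h2
          rw [Measure.restrict_univ] at h3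
          exact h3
        filter_upwards [h1] with a ha
        exact ae_ne_zero_of_analytic k (fun s => f (Fin.cons a s))
          (fun s _ => (hg (a, s)).comp (f := fun s : Fin k → ℝ => (a, s)) (analyticAt_const.prod analyticAt_id)) ⟨_, ha⟩
      have := hmp.quasiMeasurePreserving.ae key
      filter_upwards [this] with s hs
      simpa using hs

lemma ae_linInd (n : ℕ) (μ : Measure (Fin n → ℝ)) [IsProbabilityMeasure μ]
   (hnull : ∀ U : Submodule ℝ (Fin n → ℝ), U ≠ ⊤ → μ (U : Set (Fin n → ℝ)) = 0) :
    ∀ k ≤ n, ∀ᵐ x : Fin k → Fin n → ℝ ∂(Measure.pi fun _ => μ), LinearIndependent ℝ x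
  | 0, _ => by filter_upwards with x; exact linearIndependent_empty_type
  | k+1, hk => by
      have ih := ae_linInd n μ hnull k (by omega)
      have hmp := measurePreserving_piFinSuccAbove (fun _ : Fin (k+1) => μ) 0
      have key : ∀ᵐ p : (Fin n → ℝ) × (Fin k → Fin n → ℝ) ∂(μ.prod (Measure.pi fun _ => μ)), LinearIndependent ℝ (Fin.cons p.1 p.2 : Fin (k+1) → Fin n → ℝ) := by
        have hc : Continuous (fun p : (Fin n → ℝ) × (Fin k → Fin n → ℝ) => (Fin.cons p.1 p.2 : Fin (k+1) → Fin n → ℝ)) := by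
          refine continuous_pi fun i => ?_
          refine Fin.cases ?_ (fun j => ?_) i
          · simpa using continuous_fst
          · simp only [Fin.cons_succ]; fun_prop
        have hms : MeasurableSet {p : (Fin n → ℝ) × (Fin k → Fin n → ℝ) | LinearIndependent ℝ (Fin.cons p.1 p.2 : Fin (k+1) → Fin n → ℝ)} :=
          (isOpen_setOfPred_linearIndependent.preimage hc).measurableSet
        have hae : ∀ᵐ y : Fin k → Fin n → ℝ ∂(Measure.pi fun _ => μ), ∀ᵐ x ∂μ, LinearIndependent ℝ (Fin.cons x y : Fin (k+1) → Fin n → ℝ) := by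
          filter_upwards [ih] with y hy
          have hne : Submodule.span ℝ (Set.range y) ≠ ⊤ := by
            intro h
            have h1 := finrank_range_le_card (R := ℝ) y
            rw [Set.finrank, h, finrank_top] at h1
            simp at h1
            omega
          have h0 := hnull _ hne
          have : ∀ᵐ x ∂μ, x ∉ Submodule.span ℝ (Set.range y) := measure_eq_zero_iff_ae_notMem.1 h0
          filter_upwards [this] with x hx
          exact linearIndependent_finCons.2 ⟨hy, hx⟩
        have := (Measure.ae_prod_iff_ae_ae (μ := Measure.pi fun _ : Fin k => μ) (ν := μ) (p := fun q => LinearIndependent ℝ (Fin.cons q.2 q.1 : Fin (k+1) → Fin n → ℝ)) (measurable_swap hms)).2 hae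
        exact Measure.measurePreserving_swap.quasiMeasurePreserving.ae this
      filter_upwards [hmp.quasiMeasurePreserving.ae key] with s hs
      simpa using hs

lemma convPow_eq_map {E : Type*} [AddCommMonoid E] [MeasurableSpace E] [MeasurableAdd₂ E]
    (μ : Measure E) [IsProbabilityMeasure μ] :
    ∀ k : ℕ, convPow μ k = Measure.map (fun x : Fin k → E => ∑ i, x i) (Measure.pi fun _ => μ)
  | 0 => by
      rw [convPow]
      simp [Measure.map_const]
  | k+1 => by
      have hmp := measurePreserving_piFinSuccAbove (fun _ : Fin (k+1) => μ) 0
      have hsum : Measurable (fun x : Fin k → E => ∑ i, x i) := by fun_prop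
      have h1 : (fun x : Fin (k+1) → E => ∑ i, x i) =
        (fun p : E × (Fin k → E) => p.1 + ∑ i, p.2 i) ∘ (MeasurableEquiv.piFinSuccAbove (fun _ : Fin (k+1) => E) 0) := by
        funext x
        simp [Fin.sum_univ_succ, Fin.tail]
      have : IsProbabilityMeasure (Measure.map (fun x : Fin k → E => ∑ i, x i) (Measure.pi fun _ => μ)) :=
        Measure.isProbabilityMeasure_map hsum.aemeasurable
      rw [convPow, convPow_eq_map μ k, Measure.conv_comm, h1, ← Measure.map_map (by fun_prop) (MeasurableEquiv.measurable _), hmp.map_eq]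
      rw [Measure.conv]
      have h2 : μ.prod (Measure.map (fun x : Fin k → E => ∑ i, x i) (Measure.pi fun _ => μ)) =
        Measure.map (Prod.map id (fun x : Fin k → E => ∑ i, x i)) (μ.prod (Measure.pi fun _ => μ)) := by
        rw [← Measure.map_prod_map _ _ measurable_id hsum, Measure.map_id]
      rw [h2, Measure.map_map (by fun_prop) (by fun_prop)]
      rfl

lemma null_preimage_of_det {n : ℕ} (F : (Fin n → ℝ) → (Fin n → ℝ))
    (F' : (Fin n → ℝ) → (Fin n → ℝ) →L[ℝ] (Fin n → ℝ)) (hF : ∀ t, HasStrictFDerivAt F (F' t) t)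
    (hF' : Continuous F')
    (N : Set (Fin n → ℝ)) (hNm : MeasurableSet N) (hN : volume N = 0) :
    volume {t | (F' t).det ≠ 0 ∧ F t ∈ N} = 0 := by
  have hdet : Continuous fun t => (F' t).det := by
    exact ContinuousLinearMap.continuous_det.comp hF'
  have hFc : Continuous F := continuous_iff_continuousAt.2 fun t => (hF t).hasFDerivAt.continuousAt
  refine measure_null_of_locally_null _ ?_
  rintro t ⟨h0, htN⟩
  have hu : IsUnit (F' t).det := isUnit_iff_ne_zero.2 h0
  let e := (F' t).toContinuousLinearEquivOfDetNeZero h0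
  have he : HasStrictFDerivAt F (e : (Fin n → ℝ) →L[ℝ] (Fin n → ℝ)) t := by
    simpa [e] using hF t
  let P := he.toOpenPartialHomeomorph F
  have hP : (P : (Fin n → ℝ) → (Fin n → ℝ)) = F := he.toOpenPartialHomeomorph_coe
  have hsrc : t ∈ P.source := he.mem_toOpenPartialHomeomorph_source
  refine ⟨P.source ∩ {t | (F' t).det ≠ 0 ∧ F t ∈ N}, ?_, ?_⟩
  · exact Filter.inter_mem (mem_nhdsWithin_of_mem_nhds (P.open_source.mem_nhds hsrc)) self_mem_nhdsWithin
  · set s := P.source ∩ {t | (F' t).det ≠ 0 ∧ F t ∈ N} with hs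
    have hsm : MeasurableSet s := by
      refine P.open_source.measurableSet.inter (MeasurableSet.inter ?_ ?_)
      · exact (isOpen_ne_fun hdet continuous_const).measurableSet
      · exact hFc.measurable hNm
    have hinj : Set.InjOn F s := by
      rw [← hP]; exact P.injOn.mono Set.inter_subset_left
    have hint := lintegral_abs_det_fderiv_eq_addHaar_image volume hsm
      (fun x _ => (hF x).hasFDerivAt.hasFDerivWithinAt) hinj
    have h2 : volume (F '' s) = 0 := by
      refine measure_mono_null ?_ hN
      rintro _ ⟨x, hx, rfl⟩
      exact hx.2.2
    rw [h2] at hint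
    by_contra hne
    have hpos := (setLIntegral_pos_iff (μ := volume) (s := s) (f := fun x => ENNReal.ofReal |(F' x).det|) hdet.abs.measurable.ennreal_ofReal).2 (by
      rw [Set.inter_eq_self_of_subset_right]
      · exact pos_iff_ne_zero.2 hne
      · intro x hx
        simp [hx.2.1])
    rw [hint] at hpos
    exact lt_irrefl _ hpos

lemma exists_det_ne_zero {n : ℕ} {ι : Type*} [Fintype ι] (C : ι → Matrix (Fin n) (Fin n) ℝ)
    (hC : (∑ j, C j * C j).det ≠ 0) (x : Fin n → Fin n → ℝ) (hx : LinearIndependent ℝ x) :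
    ∃ r : Fin n → ι, (Matrix.of fun i => (C (r i) * C (r i)).mulVec (x i)).det ≠ 0 := by
  classical
  by_contra! h
  have h1 : (Matrix.of x).det ≠ 0 := by
    have := (Matrix.linearIndependent_rows_iff_isUnit (A := Matrix.of x)).1 hx
    rw [Matrix.isUnit_iff_isUnit_det] at this
    exact this.ne_zero
  have h2 : (Matrix.of fun i => ∑ j, (C j * C j).mulVec (x i)).det = 0 := by
    have := MultilinearMap.map_sum (Matrix.detRowAlternating (n := Fin n) (R := ℝ)).toMultilinearMap
      (fun i j => (C j * C j).mulVec (x i))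
    refine this.trans (Finset.sum_eq_zero fun r _ => ?_)
    exact h r
  have h3 : (Matrix.of fun i => ∑ j, (C j * C j).mulVec (x i)) = Matrix.of x * (∑ j, C j * C j).transpose := by
    ext i k
    simp only [Matrix.of_apply, Matrix.mul_apply, Matrix.transpose_apply, Finset.sum_apply, Matrix.mulVec, dotProduct, Matrix.sum_apply]
    rw [Finset.sum_comm]
    refine Finset.sum_congr rfl fun l _ => ?_
    rw [Finset.mul_sum]
    refine Finset.sum_congr rfl fun l _ => ?_
    simp [mul_comm]
  rw [h3, Matrix.det_mul, Matrix.det_transpose] at h2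
  exact mul_ne_zero h1 hC h2

section MatrixNorm
attribute [local instance] Matrix.linftyOpNormedRing Matrix.linftyOpNormedAlgebra

lemma exists_invariant_form {n : ℕ} (K : Subgroup (Matrix.GeneralLinearGroup (Fin n) ℝ))
    (hKcpt : IsCompact (K : Set (Matrix.GeneralLinearGroup (Fin n) ℝ))) :
    ∃ P : Matrix (Fin n) (Fin n) ℝ, (∀ v, v ≠ 0 → 0 < v ⬝ᵥ P.mulVec v) ∧
      ∀ g ∈ K, (g : Matrix (Fin n) (Fin n) ℝ).transpose * P * (g : Matrix (Fin n) (Fin n) ℝ) = P := by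
  have : CompactSpace K := isCompact_iff_compactSpace.1 hKcpt
  let _ : MeasurableSpace K := borel K
  have : BorelSpace K := ⟨rfl⟩
  let ν : Measure K := Measure.haar
  let f : K → (Fin n → Fin n → ℝ) := fun g => Matrix.of.symm <|
    ((g⁻¹ : K) : Matrix.GeneralLinearGroup (Fin n) ℝ).val.transpose * ((g⁻¹ : K) : Matrix.GeneralLinearGroup (Fin n) ℝ).val
  have hfc : Continuous f := by
    have h1 : Continuous fun g : K => ((g⁻¹ : K) : Matrix.GeneralLinearGroup (Fin n) ℝ).val :=
      Units.continuous_val.comp (continuous_subtype_val.comp continuous_inv)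
    exact h1.matrix_transpose.mul h1
  have hfi : Integrable f ν := hfc.integrable_of_hasCompactSupport (HasCompactSupport.of_compactSpace f)
  refine ⟨Matrix.of (∫ g, f g ∂ν), ?_, ?_⟩
  · intro v hv
    let L : (Fin n → Fin n → ℝ) →L[ℝ] ℝ := LinearMap.toContinuousLinearMap
      { toFun := fun A => v ⬝ᵥ (Matrix.of A).mulVec v
        map_add' := by intro A B; rw [← Matrix.of_add_of]; simp [Matrix.add_mulVec, -Matrix.of_add_of]
        map_smul' := by intro c A; rw [← Matrix.smul_of]; simp [Matrix.smul_mulVec, -Matrix.smul_of] }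
    have h1 : v ⬝ᵥ (Matrix.of (∫ g, f g ∂ν)).mulVec v = ∫ g, L (f g) ∂ν := (L.integral_comp_comm hfi).symm
    have h2 : ∀ g, L (f g) = (((g⁻¹ : K) : Matrix.GeneralLinearGroup (Fin n) ℝ).val.mulVec v) ⬝ᵥ (((g⁻¹ : K) : Matrix.GeneralLinearGroup (Fin n) ℝ).val.mulVec v) := by
      intro g
      change v ⬝ᵥ (Matrix.of (f g)).mulVec v = _
      simp only [f, Equiv.apply_symm_apply]
      rw [← Matrix.mulVec_mulVec, Matrix.dotProduct_mulVec, Matrix.vecMul_transpose]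
    rw [h1]
    refine Continuous.integral_pos_of_hasCompactSupport_nonneg_nonzero (x := 1) (L.continuous.comp hfc) (HasCompactSupport.of_compactSpace _) ?_ ?_
    · intro g
      change 0 ≤ L (f g)
      rw [h2]
      exact Finset.sum_nonneg fun i _ => mul_self_nonneg _
    · rw [h2]
      simpa using hv
  · intro h hh
    let M : (Fin n → Fin n → ℝ) →L[ℝ] (Fin n → Fin n → ℝ) := LinearMap.toContinuousLinearMap
      { toFun := fun A => Matrix.of.symm (h.val.transpose * Matrix.of A * h.val)
        map_add' := by intro A B; rw [← Matrix.of_add_of, mul_add, add_mul]; rfl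
        map_smul' := by intro c A; rw [← Matrix.smul_of]; simp [-Matrix.smul_of]; rfl }
    have h1 : h.val.transpose * Matrix.of (∫ g, f g ∂ν) * h.val = ∫ g, M (f g) ∂ν := (M.integral_comp_comm hfi).symm
    have h2 : ∀ g, M (f g) = f ((⟨h, hh⟩ : K)⁻¹ * g) := by
      intro g
      change Matrix.of.symm (h.val.transpose * Matrix.of (f g) * h.val) = _
      simp only [f, Equiv.apply_symm_apply]
      simp [Matrix.transpose_mul, mul_assoc]
    rw [h1]
    simp_rw [h2]
    exact integral_mul_left_eq_self f _

lemma skew_of_exp {n : ℕ} (P C : Matrix (Fin n) (Fin n) ℝ)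
   (h : ∀ t : ℝ, (NormedSpace.exp (t • C)).transpose * P * NormedSpace.exp (t • C) = P) :
   C.transpose * P + P * C = 0 := by
  have h1 := hasDerivAt_exp_smul_const (𝕂 := ℝ) C 0
  have h2 := hasDerivAt_exp_smul_const (𝕂 := ℝ) C.transpose 0
  have h3 := (h2.mul_const P).mul h1
  have h4 : (fun t : ℝ => NormedSpace.exp (t • C.transpose) * P) * (fun t : ℝ => NormedSpace.exp (t • C)) = fun _ => P := by
    funext t
    rw [Pi.mul_apply, ← Matrix.transpose_smul, Matrix.exp_transpose]
    exact h t
  have h5 : HasDerivAt ((fun t : ℝ => NormedSpace.exp (t • C.transpose) * P) * (fun t : ℝ => NormedSpace.exp (t • C))) 0 (0:ℝ) := by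
    rw [h4]; exact hasDerivAt_const _ _
  have := h3.unique h5
  simpa using this

lemma det_sum_sq_ne_zero {n : ℕ} {ι : Type*} [Fintype ι] (P : Matrix (Fin n) (Fin n) ℝ) (C : ι → Matrix (Fin n) (Fin n) ℝ)
    (hP : ∀ v, v ≠ 0 → 0 < v ⬝ᵥ P.mulVec v) (hC : ∀ j, (C j).transpose * P + P * C j = 0)
    (hker : ∀ v, (∀ j, (C j).mulVec v = 0) → v = 0) : (∑ j, C j * C j).det ≠ 0 := by
  intro h
  obtain ⟨v, hv, hv0⟩ := Matrix.exists_mulVec_eq_zero_iff.2 h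
  refine hv (hker v ?_)
  have h1 : ∀ j, v ⬝ᵥ P.mulVec ((C j * C j).mulVec v) = - ((C j).mulVec v ⬝ᵥ P.mulVec ((C j).mulVec v)) := by
    intro j
    have : P * C j = - ((C j).transpose * P) := by rw [eq_neg_iff_add_eq_zero, add_comm]; exact hC j
    rw [Matrix.mulVec_mulVec, ← mul_assoc, this, neg_mul, Matrix.neg_mulVec, dotProduct_neg, ← Matrix.mulVec_mulVec,
      ← Matrix.mulVec_mulVec, Matrix.dotProduct_mulVec, Matrix.vecMul_transpose]
  have h2 : ∑ j, ((C j).mulVec v ⬝ᵥ P.mulVec ((C j).mulVec v)) = 0 := by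
    have : v ⬝ᵥ P.mulVec ((∑ j, C j * C j).mulVec v) = 0 := by rw [hv0]; simp
    rw [Matrix.sum_mulVec, Matrix.mulVec_sum, dotProduct_sum] at this
    simp_rw [h1] at this
    rw [Finset.sum_neg_distrib] at this
    linarith
  have hnn : ∀ w, 0 ≤ w ⬝ᵥ P.mulVec w := fun w => by
    by_cases hw : w = 0
    · simp [hw]
    · exact (hP w hw).le
  intro j
  by_contra hj
  have := (Finset.sum_eq_zero_iff_of_nonneg (fun j _ => hnn _)).1 h2 j (Finset.mem_univ _)
  exact (hP _ hj).ne' this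
end MatrixNorm

section OneParam
open Filter Topology

lemma pow_sub_pow_bound {𝔸 : Type*} [NormedRing 𝔸] (a b : 𝔸) (M R : ℝ) (hM : 0 ≤ M) (N : ℕ)
    (ha : ∀ i, ‖a ^ i‖ ≤ M) (hb : ∀ i ≤ N, ‖b ^ i‖ ≤ R) :
    ∀ i j, i + j ≤ N → ‖(a ^ i - b ^ i) * b ^ j‖ ≤ i * (M * ‖a - b‖ * R)
  | 0, j, _ => by simp
  | i+1, j, h => by
    have e : (a ^ (i+1) - b ^ (i+1)) * b ^ j = a ^ i * (a - b) * b ^ j + (a ^ i - b ^ i) * b ^ (j+1) := by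
      rw [pow_succ a, pow_succ b, pow_succ' b j]; noncomm_ring
    rw [e]
    have h1 := pow_sub_pow_bound a b M R hM N ha hb i (j+1) (by omega)
    have h2 : ‖a ^ i * (a - b) * b ^ j‖ ≤ M * ‖a - b‖ * R := by
      refine (norm_mul_le _ _).trans ?_
      refine mul_le_mul ((norm_mul_le _ _).trans ?_) (hb j (by omega)) (norm_nonneg _) (by positivity)
      exact mul_le_mul_of_nonneg_right (ha i) (norm_nonneg _)
    refine (norm_add_le _ _).trans ?_
    push_cast
    linarith

lemma exp_neg_mul_exp {𝔸 : Type*} [NormedRing 𝔸] [NormedAlgebra ℝ 𝔸] [CompleteSpace 𝔸] (C : 𝔸) (t : ℝ) :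
    NormedSpace.exp ((-t) • C) * NormedSpace.exp (t • C) = 1 := by
  have : NormedAlgebra ℚ 𝔸 := NormedAlgebra.restrictScalars ℚ ℝ 𝔸
  rw [← NormedSpace.exp_add_of_commute (((Commute.refl C).smul_left _).smul_right _), ← add_smul]
  simp

lemma delta_tendsto {𝔸 : Type*} [NormedRing 𝔸] [NormedAlgebra ℝ 𝔸] [CompleteSpace 𝔸]
    (g : ℕ → 𝔸) (ε : ℕ → ℝ) (C : 𝔸) (hε : ∀ m, 0 < ε m) (hε0 : Tendsto ε atTop (𝓝 0))
    (hC : Tendsto (fun m => (ε m)⁻¹ • (g m - 1)) atTop (𝓝 C)) :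
    Tendsto (fun m => ‖g m - NormedSpace.exp (ε m • C)‖ / ε m) atTop (𝓝 0) := by
  have h1 := hasDerivAt_exp_smul_const (𝕂 := ℝ) C 0
  have h2 := h1.tendsto_slope_zero
  have h3 : Tendsto ε atTop (𝓝[≠] 0) := tendsto_nhdsWithin_iff.2 ⟨hε0, Eventually.of_forall fun m => (hε m).ne'⟩
  have h4 := h2.comp h3
  have h5 := (hC.sub h4).norm
  simp only [zero_smul, NormedSpace.exp_zero, one_mul, sub_self, norm_zero, Function.comp_def, zero_add] at h5
  refine h5.congr fun m => ?_
  rw [← smul_sub, norm_smul, norm_inv, Real.norm_eq_abs, abs_of_pos (hε m)]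
  rw [sub_sub_sub_cancel_right, div_eq_inv_mul]

lemma exp_mem_of_tendsto {𝔸 : Type*} [NormedRing 𝔸] [NormedAlgebra ℝ 𝔸] [CompleteSpace 𝔸]
    (S : Set 𝔸) (hS : IsCompact S) (hpow : ∀ a ∈ S, ∀ i : ℕ, a ^ i ∈ S)
    (g : ℕ → 𝔸) (hg : ∀ m, g m ∈ S) (ε : ℕ → ℝ) (C : 𝔸) (hε : ∀ m, 0 < ε m) (hε0 : Tendsto ε atTop (𝓝 0))
    (hC : Tendsto (fun m => (ε m)⁻¹ • (g m - 1)) atTop (𝓝 C)) (t : ℝ) (ht : 0 ≤ t) :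
    NormedSpace.exp (t • C) ∈ S := by
  have hδ := delta_tendsto g ε C hε hε0 hC
  obtain ⟨M, hM⟩ := hS.isBounded.exists_norm_le
  have hM0 : 0 ≤ M := (norm_nonneg _).trans (hM _ (hg 0))
  have hexpc : Continuous fun s : ℝ => NormedSpace.exp (s • C) :=
    continuous_iff_continuousAt.2 fun s => (hasDerivAt_exp_smul_const (𝕂 := ℝ) C s).continuousAt
  obtain ⟨R, hR⟩ := ((isCompact_Icc (a := (0:ℝ)) (b := t)).image hexpc).isBounded.exists_norm_le
  have hR' : ∀ s, 0 ≤ s → s ≤ t → ‖NormedSpace.exp (s • C)‖ ≤ R := fun s h1 h2 =>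
    hR _ ⟨s, ⟨h1, h2⟩, rfl⟩
  have hR0 : 0 ≤ R := (norm_nonneg _).trans (hR' 0 le_rfl ht)
  let N : ℕ → ℕ := fun m => ⌊t / ε m⌋₊
  have hN1 : ∀ m, (N m : ℝ) * ε m ≤ t := fun m => by
    have := Nat.floor_le (div_nonneg ht (hε m).le)
    rwa [le_div_iff₀ (hε m)] at this
  have hN2 : ∀ m, t - ε m ≤ (N m : ℝ) * ε m := fun m => by
    have := (Nat.lt_floor_add_one (t / ε m)).le
    rw [div_le_iff₀ (hε m)] at this
    have e : ((⌊t / ε m⌋₊ : ℝ) + 1) * ε m = N m * ε m + ε m := by simp only [N]; ring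
    linarith
  have hNt : Tendsto (fun m => (N m : ℝ) * ε m) atTop (𝓝 t) := by
    refine tendsto_of_tendsto_of_tendsto_of_le_of_le (g := fun m => t - ε m) ?_ tendsto_const_nhds hN2 hN1
    simpa using tendsto_const_nhds.sub hε0
  have hb : ∀ (m i : ℕ), (NormedSpace.exp (ε m • C)) ^ i = NormedSpace.exp (((i : ℝ) * ε m) • C) := fun m i => by
    have : NormedAlgebra ℚ 𝔸 := NormedAlgebra.restrictScalars ℚ ℝ 𝔸
    rw [mul_smul, ← NormedSpace.exp_nsmul, Nat.cast_smul_eq_nsmul]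
  have hlim1 : Tendsto (fun m => (NormedSpace.exp (ε m • C)) ^ N m) atTop (𝓝 (NormedSpace.exp (t • C))) := by
    simp_rw [hb]
    exact (hexpc.tendsto t).comp hNt
  have hdiff : Tendsto (fun m => g m ^ N m - (NormedSpace.exp (ε m • C)) ^ N m) atTop (𝓝 0) := by
    refine squeeze_zero_norm (a := fun m => t * M * R * (‖g m - NormedSpace.exp (ε m • C)‖ / ε m)) (fun m => ?_) (by simpa using hδ.const_mul (t * M * R))
    have := pow_sub_pow_bound (g m) (NormedSpace.exp (ε m • C)) M R hM0 (N m)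
      (fun i => hM _ (hpow _ (hg m) i)) (fun i hi => by
        rw [hb]
        refine hR' _ (by have := hε m; positivity) (le_trans ?_ (hN1 m))
        exact mul_le_mul_of_nonneg_right (by exact_mod_cast hi) (hε m).le) (N m) 0 le_rfl
    rw [pow_zero, mul_one] at this
    refine this.trans ?_
    have h2 : (N m : ℝ) ≤ t / ε m := by rw [le_div_iff₀ (hε m)]; exact hN1 m
    calc (N m : ℝ) * (M * ‖g m - NormedSpace.exp (ε m • C)‖ * R)
        ≤ t / ε m * (M * ‖g m - NormedSpace.exp (ε m • C)‖ * R) :=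
          mul_le_mul_of_nonneg_right h2 (by positivity)
      _ = _ := by ring
  have hlim : Tendsto (fun m => g m ^ N m) atTop (𝓝 (NormedSpace.exp (t • C))) := by
    simpa using hdiff.add hlim1
  exact hS.isClosed.mem_of_tendsto hlim (Eventually.of_forall fun m => hpow _ (hg m) _)

attribute [local instance] Matrix.linftyOpNormedRing Matrix.linftyOpNormedAlgebra

lemma exp_mulVec_of_mulVec_zero {n : ℕ} (C : Matrix (Fin n) (Fin n) ℝ) (v : Fin n → ℝ) (h : C.mulVec v = 0) (t : ℝ) :
    (NormedSpace.exp (t • C)).mulVec v = v := by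
  let L : Matrix (Fin n) (Fin n) ℝ →L[ℝ] (Fin n → ℝ) := LinearMap.toContinuousLinearMap
      { toFun := fun A => A.mulVec v
        map_add' := by intro A B; simp [Matrix.add_mulVec]
        map_smul' := by intro c A; simp [Matrix.smul_mulVec] }
  have hd : ∀ s : ℝ, HasDerivAt (fun s : ℝ => L (NormedSpace.exp (s • C))) 0 s := fun s => by
    have := L.hasFDerivAt.comp_hasDerivAt s (hasDerivAt_exp_smul_const (𝕂 := ℝ) C s)
    have e : L (NormedSpace.exp (s • C) * C) = 0 := by
      change (NormedSpace.exp (s • C) * C).mulVec v = 0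
      rw [← Matrix.mulVec_mulVec, h, Matrix.mulVec_zero]
    exact e ▸ this
  have := is_const_of_deriv_eq_zero (fun s => (hd s).differentiableAt) (fun s => (hd s).deriv) t 0
  change L (NormedSpace.exp (t • C)) = v
  rw [this]
  change (NormedSpace.exp ((0:ℝ) • C)).mulVec v = v
  simp

lemma exists_oneParam {n : ℕ} (K : Subgroup (Matrix.GeneralLinearGroup (Fin n) ℝ))
    (hKcpt : IsCompact (K : Set (Matrix.GeneralLinearGroup (Fin n) ℝ)))
    (hKconn : IsConnected (K : Set (Matrix.GeneralLinearGroup (Fin n) ℝ)))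
    (v : Fin n → ℝ) (g₀ : Matrix.GeneralLinearGroup (Fin n) ℝ) (hg₀ : g₀ ∈ K)
    (hv : g₀.val.mulVec v ≠ v) :
    ∃ C : Matrix (Fin n) (Fin n) ℝ, (∀ t : ℝ, ∃ g ∈ K, g.val = NormedSpace.exp (t • C)) ∧ C.mulVec v ≠ 0 := by
  by_contra! hcon
  have : CompactSpace K := isCompact_iff_compactSpace.1 hKcpt
  have : ConnectedSpace K := isConnected_iff_connectedSpace.1 hKconn
  let φ : K → Matrix (Fin n) (Fin n) ℝ := fun g => g.1.val
  have hφ : IsEmbedding φ := Units.isOpenEmbedding_val.isEmbedding.comp .subtypeVal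
  let H : Subgroup K :=
    { carrier := {g | (φ g).mulVec v = v}
      one_mem' := by simp [φ]
      mul_mem' := by
        intro a b ha hb
        simp only [Set.mem_ofPred_eq] at ha hb ⊢
        change (φ a * φ b).mulVec v = v
        rw [← Matrix.mulVec_mulVec, hb, ha]
      inv_mem' := by
        intro a ha
        simp only [Set.mem_ofPred_eq] at ha ⊢
        have : (φ a⁻¹ * φ a) = 1 := by
          change φ a⁻¹ * φ a = φ 1
          rw [← inv_mul_cancel a]; rfl
        nth_rw 1 [← ha]
        rw [Matrix.mulVec_mulVec, this, Matrix.one_mulVec] }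
  have hHclosed : IsClosed (H : Set K) := by
    refine isClosed_eq ?_ continuous_const
    exact hφ.continuous.matrix_mulVec continuous_const
  have hHnot : (H : Set K) ∉ 𝓝 (1 : K) := by
    intro h
    have hopen := H.isOpen_of_mem_nhds h
    have := IsClopen.eq_univ ⟨hHclosed, hopen⟩ ⟨1, H.one_mem⟩
    have h2 : (⟨g₀, hg₀⟩ : K) ∈ (H : Set K) := by rw [this]; trivial
    exact hv h2
  have hk : ∀ m : ℕ, ∃ k : K, k ∉ H ∧ ‖φ k - 1‖ < 1 / ((m : ℝ) + 1) := by
    intro m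
    by_contra! hc
    refine hHnot ?_
    rw [hφ.isInducing.nhds_eq_comap]
    refine ⟨Metric.ball 1 (1 / ((m : ℝ) + 1)), Metric.ball_mem_nhds _ (by positivity), ?_⟩
    intro k hk
    by_contra hkH
    have := hc k hkH
    rw [Set.mem_preimage, mem_ball_iff_norm] at hk
    linarith
  choose k hkH hk1 using hk
  have hmin : ∀ m, ∃ h ∈ (H : Set K), ∀ h' ∈ (H : Set K), ‖φ (k m * h) - 1‖ ≤ ‖φ (k m * h') - 1‖ := by
    intro m
    have hc : Continuous fun h : K => ‖φ (k m * h) - 1‖ :=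
      ((hφ.continuous.comp (continuous_const.mul continuous_id)).sub continuous_const).norm
    obtain ⟨h, hh, hh2⟩ := hHclosed.isCompact.exists_isMinOn ⟨1, H.one_mem⟩ hc.continuousOn
    exact ⟨h, hh, fun h' hh' => hh2 hh'⟩
  choose h hhH hhmin using hmin
  have hφmul : ∀ a b, φ (a * b) = φ a * φ b := fun a b => rfl
  let g : ℕ → K := fun m => k m * h m
  have hgH : ∀ m, g m ∉ H := fun m hm => hkH m ((H.mul_mem_cancel_right (hhH m)).1 hm)
  let ε : ℕ → ℝ := fun m => ‖φ (g m) - 1‖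
  have hε : ∀ m, 0 < ε m := fun m => by
    refine norm_pos_iff.2 (sub_ne_zero.2 fun he => hgH m ?_)
    change (φ (g m)).mulVec v = v
    rw [he, Matrix.one_mulVec]
  have hεle : ∀ m, ε m ≤ 1 / ((m : ℝ) + 1) := fun m => by
    have := hhmin m 1 H.one_mem
    rw [mul_one] at this
    exact this.trans (hk1 m).le
  have hε0 : Tendsto ε atTop (𝓝 0) :=
    squeeze_zero (fun m => (hε m).le) hεle tendsto_one_div_add_atTop_nhds_zero_nat
  have : ProperSpace (Matrix (Fin n) (Fin n) ℝ) := FiniteDimensional.proper_real _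
  obtain ⟨C, hCs, ψ, hψ, hC⟩ := (isCompact_sphere (0 : Matrix (Fin n) (Fin n) ℝ) 1).tendsto_subseq
    (x := fun m => (ε m)⁻¹ • (φ (g m) - 1)) (fun m => by
      rw [mem_sphere_zero_iff_norm, norm_smul, norm_inv, Real.norm_eq_abs, abs_of_pos (hε m)]
      exact inv_mul_cancel₀ (hε m).ne')
  have hε0' := hε0.comp hψ.tendsto_atTop
  have hcompact : IsCompact (Set.range φ) := isCompact_range hφ.continuous
  have hpos : ∀ t : ℝ, 0 ≤ t → NormedSpace.exp (t • C) ∈ Set.range φ := fun t ht =>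
    exp_mem_of_tendsto (Set.range φ) hcompact (by
      rintro _ ⟨a, rfl⟩ i
      exact ⟨a ^ i, rfl⟩) (fun m => φ (g (ψ m))) (fun m => ⟨_, rfl⟩) (fun m => ε (ψ m)) C (fun m => hε _) hε0' hC t ht
  have hall : ∀ t : ℝ, NormedSpace.exp (t • C) ∈ Set.range φ := by
    intro t
    rcases le_total 0 t with ht | ht
    · exact hpos t ht
    · obtain ⟨a, ha⟩ := hpos (-t) (by linarith)
      refine ⟨a⁻¹, ?_⟩
      have h1 : φ a⁻¹ * φ a = 1 := by
        rw [← hφmul, inv_mul_cancel]; rfl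
      have h2 : φ a * NormedSpace.exp (t • C) = 1 := by
        rw [ha]
        exact exp_neg_mul_exp C t
      exact left_inv_eq_right_inv h1 h2
  have hCv : C.mulVec v = 0 := hcon C fun t => by
    obtain ⟨a, ha⟩ := hall t
    exact ⟨a.1, a.2, ha⟩
  have hδ := delta_tendsto (fun m => φ (g (ψ m))) (fun m => ε (ψ m)) C (fun m => hε _) hε0' hC
  have hexp : Tendsto (fun m => ‖NormedSpace.exp ((-ε (ψ m)) • C)‖) atTop (𝓝 ‖NormedSpace.exp ((0:ℝ) • C)‖) := by
    have hexpc : Continuous fun s : ℝ => NormedSpace.exp (s • C) :=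
      continuous_iff_continuousAt.2 fun s => (hasDerivAt_exp_smul_const (𝕂 := ℝ) C s).continuousAt
    have := hε0'.neg
    rw [neg_zero] at this
    exact ((hexpc.tendsto 0).comp this).norm
  have hprod := hδ.mul hexp
  rw [zero_mul] at hprod
  obtain ⟨m, hm⟩ := (hprod.eventually (gt_mem_nhds one_pos)).exists
  obtain ⟨a, ha⟩ := hall (-ε (ψ m))
  have haH : a ∈ H := by
    change (φ a).mulVec v = v
    rw [ha]; exact exp_mulVec_of_mulVec_zero C v hCv _
  have h1 := hhmin (ψ m) (h (ψ m) * a) (H.mul_mem (hhH _) haH)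
  have h2 : φ (k (ψ m) * (h (ψ m) * a)) - 1 = (φ (g (ψ m)) - NormedSpace.exp (ε (ψ m) • C)) * φ a := by
    rw [← mul_assoc, hφmul, sub_mul]
    congr 1
    rw [ha]
    have := exp_neg_mul_exp C (-ε (ψ m))
    rw [neg_neg] at this
    exact this.symm
  rw [h2] at h1
  have h3 := h1.trans (norm_mul_le _ _)
  have h4 : ε (ψ m) ≤ ‖φ (g (ψ m)) - NormedSpace.exp (ε (ψ m) • C)‖ * ‖φ a‖ := h3
  rw [← ha, div_mul_eq_mul_div, div_lt_one (hε _)] at hm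
  exact absurd h4 (not_le.2 hm)
end OneParam

section Main
open Filter Topology

lemma det_deriv_eq_zero {n : ℕ} (v : Fin n → ℝ → Fin n → ℝ) (w : Fin n → Fin n → ℝ)
    (hv : ∀ i, HasDerivAt (v i) (w i) 0)
    (h0 : ∀ t : Fin n → ℝ, (Matrix.of fun i => v i (t i)).det = 0) : (Matrix.of w).det = 0 := by
  classical
  have key : ∀ (s : Finset (Fin n)) (t : Fin n → ℝ),
      (Matrix.of fun i => if i ∈ s then w i else v i (t i)).det = 0 := by
    intro s
    induction s using Finset.induction_on with
    | empty => intro t; simpa using h0 t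
    | insert a s ha ih =>
      intro t
      let base : Fin n → Fin n → ℝ := fun i => if i ∈ s then w i else v i (t i)
      let ℓ : (Fin n → ℝ) →L[ℝ] ℝ := LinearMap.toContinuousLinearMap
        ((Matrix.detRowAlternating (n := Fin n) (R := ℝ)).toMultilinearMap.toLinearMap base a)
      have hℓ : ∀ u, ℓ u = (Matrix.of (Function.update base a u)).det := fun u => rfl
      have h1 : ∀ τ, ℓ (v a τ) = 0 := fun τ => by
        rw [hℓ, ← ih (Function.update t a τ)]
        congr 2
        funext i
        by_cases hi : i = a
        · subst hi; simp [ha]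
        · simp [hi, base]
      have h2 : HasDerivAt (fun τ => ℓ (v a τ)) (ℓ (w a)) 0 := ℓ.hasFDerivAt.comp_hasDerivAt 0 (hv a)
      have h3 : (fun τ => ℓ (v a τ)) = fun _ => 0 := funext h1
      rw [h3] at h2
      have h4 := h2.unique (hasDerivAt_const _ _)
      rw [← h4, hℓ]
      congr 2
      funext i
      by_cases hi : i = a
      · subst hi; simp
      · simp [hi, base]
  simpa using key Finset.univ 0

attribute [local instance] Matrix.linftyOpNormedRing Matrix.linftyOpNormedAlgebra

/-- evaluation at a vector, after right multiplication. -/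
noncomputable def evalCLM {n : ℕ} (D : Matrix (Fin n) (Fin n) ℝ) (v : Fin n → ℝ) :
    Matrix (Fin n) (Fin n) ℝ →L[ℝ] (Fin n → ℝ) := LinearMap.toContinuousLinearMap
      { toFun := fun A => (A * D).mulVec v
        map_add' := by intro A B; simp [Matrix.add_mulVec, add_mul]
        map_smul' := by intro c A; simp [Matrix.smul_mulVec] }

lemma hasStrictDerivAt_curve {n : ℕ} (C D : Matrix (Fin n) (Fin n) ℝ) (v : Fin n → ℝ) (s : ℝ) :
    HasStrictDerivAt (fun s : ℝ => (NormedSpace.exp (s • C) * D).mulVec v)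
      ((NormedSpace.exp (s • C) * C * D).mulVec v) s :=
  (evalCLM D v).hasStrictFDerivAt.comp_hasStrictDerivAt s (hasStrictDerivAt_exp_smul_const (𝕂 := ℝ) C s)

lemma analyticAt_curve {n : ℕ} (C D : Matrix (Fin n) (Fin n) ℝ) (v : Fin n → ℝ) (k : Fin n) (s : ℝ) :
    AnalyticAt ℝ (fun s : ℝ => (NormedSpace.exp (s • C) * D).mulVec v k) s := by
  have h1 : AnalyticAt ℝ (fun s : ℝ => s • C) s := analyticAt_id.smul analyticAt_const
  have h2 : AnalyticAt ℝ (fun s : ℝ => NormedSpace.exp (s • C)) s :=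
    AnalyticAt.comp (f := fun s : ℝ => s • C) (NormedSpace.exp_analytic (𝕂 := ℝ) (s • C)) h1
  have h3 : AnalyticAt ℝ (fun s : ℝ => evalCLM D v (NormedSpace.exp (s • C))) s :=
    ((evalCLM D v).analyticAt _).comp h2
  exact (analyticAt_pi_iff.1 h3) k

lemma exp_mul_comm' {n : ℕ} (C : Matrix (Fin n) (Fin n) ℝ) (s t : ℝ) :
    NormedSpace.exp (s • C) * C * NormedSpace.exp (t • C) = NormedSpace.exp ((s + t) • C) * C := by
  have h1 : Commute C (NormedSpace.exp (t • C)) := ((Commute.refl C).smul_right t).exp_right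
  have h2 : NormedSpace.exp ((s + t) • C) = NormedSpace.exp (s • C) * NormedSpace.exp (t • C) := by
    rw [add_smul]
    exact Matrix.exp_add_of_commute _ _ (((Commute.refl C).smul_left _).smul_right _)
  rw [h2, mul_assoc, mul_assoc, h1.eq]

/-- The Jacobian. -/
noncomputable def Jac {n : ℕ} (C : Fin n → Matrix (Fin n) (Fin n) ℝ) (x : Fin n → Fin n → ℝ) (t : Fin n → ℝ) : ℝ :=
  (Matrix.of fun i => (NormedSpace.exp (t i • C i) * C i).mulVec (x i)).det

lemma jac_analytic {n : ℕ} (C : Fin n → Matrix (Fin n) (Fin n) ℝ) (x : Fin n → Fin n → ℝ) :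
    AnalyticOnNhd ℝ (Jac C x) Set.univ := by
  intro t _
  have : Jac C x = fun t => ∑ σ : Equiv.Perm (Fin n), ((Equiv.Perm.sign σ : ℤ) : ℝ) *
      ∏ i, (NormedSpace.exp (t (σ i) • C (σ i)) * C (σ i)).mulVec (x (σ i)) i := by
    funext t
    rw [Jac, Matrix.det_apply']
    rfl
  rw [this]
  refine Finset.analyticAt_fun_sum _ fun σ _ => analyticAt_const.mul (Finset.analyticAt_fun_prod _ fun i _ => ?_)
  exact (analyticAt_curve (C (σ i)) (C (σ i)) (x (σ i)) i (t (σ i))).comp (f := fun t : Fin n → ℝ => t (σ i))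
    ((ContinuousLinearMap.proj (R := ℝ) (φ := fun _ : Fin n => ℝ) (σ i)).analyticAt t)

lemma exp_cont {n : ℕ} (C : Matrix (Fin n) (Fin n) ℝ) : Continuous fun s : ℝ => NormedSpace.exp (s • C) :=
  continuous_iff_continuousAt.2 fun s => (hasDerivAt_exp_smul_const (𝕂 := ℝ) C s).continuousAt

lemma null_fiber {n : ℕ} (C : Fin n → Matrix (Fin n) (Fin n) ℝ) (x : Fin n → Fin n → ℝ)
    (N : Set (Fin n → ℝ)) (hNm : MeasurableSet N) (hN : volume N = 0) :
    volume {t : Fin n → ℝ | Jac C x t ≠ 0 ∧ ∑ i, (NormedSpace.exp (t i • C i)).mulVec (x i) ∈ N} = 0 := by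
  let w : (Fin n → ℝ) → Fin n → Fin n → ℝ := fun t i => (NormedSpace.exp (t i • C i) * C i).mulVec (x i)
  let F' : (Fin n → ℝ) → (Fin n → ℝ) →L[ℝ] (Fin n → ℝ) := fun t =>
    ∑ i, (ContinuousLinearMap.proj (R := ℝ) (φ := fun _ : Fin n => ℝ) i).smulRight (w t i)
  have hw : Continuous w := by
    refine continuous_pi fun i => ?_
    exact (((exp_cont (C i)).comp (continuous_apply i)).mul continuous_const).matrix_mulVec continuous_const
  have hF'c : Continuous F' := by
    refine continuous_finsetSum _ fun i _ => ?_
    exact (ContinuousLinearMap.smulRightL ℝ (Fin n → ℝ) (Fin n → ℝ) (ContinuousLinearMap.proj (R := ℝ) (φ := fun _ : Fin n => ℝ) i)).continuous.comp ((continuous_apply i).comp hw)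
  have hdet : ∀ t, (F' t).det = Jac C x t := by
    intro t
    have : (F' t : (Fin n → ℝ) →ₗ[ℝ] (Fin n → ℝ)) = Matrix.toLin' (Matrix.of (w t)).transpose := by
      refine LinearMap.ext fun u => ?_
      funext k
      simp [F', Matrix.mulVec, dotProduct, mul_comm]
    rw [ContinuousLinearMap.det, this, LinearMap.det_toLin', Matrix.det_transpose]
    rfl
  have hF : ∀ t, HasStrictFDerivAt (fun t : Fin n → ℝ => ∑ i, (NormedSpace.exp (t i • C i)).mulVec (x i)) (F' t) t := by
    intro t
    refine HasStrictFDerivAt.fun_sum fun i _ => ?_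
    have h1 := (hasStrictDerivAt_curve (C i) 1 (x i) (t i)).hasStrictFDerivAt
    have h2 := HasStrictFDerivAt.comp (f := fun t : Fin n → ℝ => t i) t h1 (ContinuousLinearMap.proj (R := ℝ) (φ := fun _ : Fin n => ℝ) i).hasStrictFDerivAt
    simp only [mul_one] at h2
    convert h2 using 1
    ext u k
    simp [w]
  have := null_preimage_of_det _ F' hF hF'c N hNm hN
  simp_rw [hdet] at this
  exact this

lemma null_on_good {n : ℕ} (μ : Measure (Fin n → ℝ)) [IsProbabilityMeasure μ]
    (C : Fin n → Matrix (Fin n) (Fin n) ℝ)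
    (hC : ∀ i (t : ℝ), Measure.map (fun v => (NormedSpace.exp (t • C i)).mulVec v) μ = μ)
    (N : Set (Fin n → ℝ)) (hNm : MeasurableSet N) (hN : volume N = 0) :
    (Measure.pi fun _ : Fin n => μ) {x | (∑ i, x i ∈ N) ∧ ∃ t, Jac C x t ≠ 0} = 0 := by
  have hGo : IsOpen {x : Fin n → Fin n → ℝ | ∃ t, Jac C x t ≠ 0} := by
    have : {x : Fin n → Fin n → ℝ | ∃ t, Jac C x t ≠ 0} = ⋃ t, {x | Jac C x t ≠ 0} := by ext x; simp
    rw [this]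
    refine isOpen_iUnion fun t => isOpen_ne_fun ?_ continuous_const
    refine Continuous.matrix_det ?_
    refine continuous_matrix fun i j => ?_
    have h : Continuous fun x : Fin n → Fin n → ℝ => (NormedSpace.exp (t i • C i) * C i).mulVec (x i) :=
      continuous_const.matrix_mulVec (continuous_apply i)
    exact (continuous_apply j).comp h
  have hFc : Continuous fun p : (Fin n → Fin n → ℝ) × (Fin n → ℝ) => ∑ i, (NormedSpace.exp (p.2 i • C i)).mulVec (p.1 i) := by
    refine continuous_finsetSum _ fun i _ => ?_
    exact ((exp_cont (C i)).comp ((continuous_apply i).comp continuous_snd)).matrix_mulVec ((continuous_apply i).comp continuous_fst)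
  let S : Set ((Fin n → Fin n → ℝ) × (Fin n → ℝ)) :=
    {p | (∑ i, (NormedSpace.exp (p.2 i • C i)).mulVec (p.1 i) ∈ N) ∧ ∃ t, Jac C p.1 t ≠ 0}
  have hS : MeasurableSet S := (hFc.measurable hNm).inter (measurable_fst hGo.measurableSet)
  have hS0 : ((Measure.pi fun _ : Fin n => μ).prod volume) S = 0 := by
    rw [Measure.measure_prod_null hS]
    filter_upwards with x
    by_cases hx : ∃ t, Jac C x t ≠ 0
    · have h1 := ae_ne_zero_of_analytic n (Jac C x) (jac_analytic C x) hx
      have h2 := measure_eq_zero_iff_ae_notMem.1 (null_fiber C x N hNm hN)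
      refine measure_eq_zero_iff_ae_notMem.2 ?_
      filter_upwards [h1, h2] with t ht1 ht2 hmem
      exact ht2 ⟨ht1, hmem.1⟩
    · have : Prod.mk x ⁻¹' S = ∅ := by
        ext t
        simp only [Set.mem_preimage, Set.mem_empty_iff_false, iff_false]
        exact fun h => hx h.2
      rw [this]; simp
  have hae := Measure.ae_ae_of_ae_prod (Measure.measurePreserving_swap.quasiMeasurePreserving.ae
    (μa := volume.prod (Measure.pi fun _ : Fin n => μ)) (measure_eq_zero_iff_ae_notMem.1 hS0))
  obtain ⟨t, ht⟩ := hae.exists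
  have hmp : MeasurePreserving (fun (x : Fin n → Fin n → ℝ) i => (NormedSpace.exp (t i • C i)).mulVec (x i))
      (Measure.pi fun _ : Fin n => μ) (Measure.pi fun _ : Fin n => μ) :=
    measurePreserving_pi (fun _ : Fin n => μ) (fun _ : Fin n => μ) fun i =>
      ⟨(continuous_const.matrix_mulVec continuous_id).measurable, hC i (t i)⟩
  have hEm : MeasurableSet {x : Fin n → Fin n → ℝ | (∑ i, x i ∈ N) ∧ ∃ t, Jac C x t ≠ 0} := by
    refine MeasurableSet.inter ?_ hGo.measurableSet
    have : Measurable fun x : Fin n → Fin n → ℝ => ∑ i, x i := by fun_prop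
    exact this hNm
  rw [← hmp.measure_preimage hEm.nullMeasurableSet]
  refine measure_mono_null ?_ (measure_eq_zero_iff_ae_notMem.2 ht)
  rintro x ⟨hx1, s, hs⟩
  refine ⟨hx1, fun i => s i + t i, ?_⟩
  have e : Jac C x (fun i => s i + t i) = Jac C (fun i => (NormedSpace.exp (t i • C i)).mulVec (x i)) s := by
    unfold Jac
    congr 2
    funext i
    rw [Matrix.mulVec_mulVec, exp_mul_comm']
  rw [← e] at hs
  exact hs

lemma exists_family {n : ℕ} (K : Subgroup (Matrix.GeneralLinearGroup (Fin n) ℝ))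
    (hKcpt : IsCompact (K : Set (Matrix.GeneralLinearGroup (Fin n) ℝ)))
    (hKconn : IsConnected (K : Set (Matrix.GeneralLinearGroup (Fin n) ℝ)))
    (hnofix : ∀ v : Fin n → ℝ,
      (∀ g ∈ K, ((g : Matrix (Fin n) (Fin n) ℝ)).mulVec v = v) → v = 0) :
    ∃ S : Finset (Matrix (Fin n) (Fin n) ℝ),
      (∀ C ∈ S, ∀ t : ℝ, ∃ g ∈ K, g.val = NormedSpace.exp (t • C)) ∧
      (∑ C : S, C.1 * C.1).det ≠ 0 := by
  let 𝔨 : Set (Matrix (Fin n) (Fin n) ℝ) := {C | ∀ t : ℝ, ∃ g ∈ K, g.val = NormedSpace.exp (t • C)}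
  obtain ⟨S, hS, hspan⟩ := (Submodule.fg_span_iff_fg_span_finset_subset 𝔨).1 (IsNoetherian.noetherian (Submodule.span ℝ 𝔨))
  refine ⟨S, fun C hC => hS hC, ?_⟩
  obtain ⟨P, hP, hPinv⟩ := exists_invariant_form K hKcpt
  refine det_sum_sq_ne_zero P (fun C : S => C.1) hP (fun C => skew_of_exp P C.1 fun t => ?_) ?_
  · obtain ⟨g, hg, hge⟩ := hS C.2 t
    rw [← hge]
    exact hPinv g hg
  · intro v hv
    refine hnofix v fun g hg => ?_
    by_contra hne
    obtain ⟨C, hC, hCv⟩ := exists_oneParam K hKcpt hKconn v g hg hne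
    have hker : ∀ D ∈ Submodule.span ℝ (S : Set (Matrix (Fin n) (Fin n) ℝ)), D.mulVec v = 0 := by
      intro D hD
      induction hD using Submodule.span_induction with
      | mem D hD => exact hv ⟨D, hD⟩
      | zero => simp
      | add A B _ _ hA hB => rw [Matrix.add_mulVec, hA, hB, add_zero]
      | smul c A _ hA => rw [Matrix.smul_mulVec, hA, smul_zero]
    exact hCv (hker C (hspan ▸ Submodule.subset_span hC))

end Main

/-- **Absolute continuity of convolution powers of `K`-invariant measures.**
Let `μ` be a Borel probability measure on `ℝ^n` invariant under a compact, connected,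
infinite subgroup `K` of `GL(n,ℝ)`. If no nonzero vector is fixed by all of `K` and every
proper linear subspace of `ℝ^n` is `μ`-null, then the `n`-fold convolution power `μ^{*n}`
is absolutely continuous with respect to Lebesgue measure. -/
theorem conv_pow_abs_continuous (n : ℕ) (hn : 1 ≤ n)
    (μ : Measure (Fin n → ℝ)) [IsProbabilityMeasure μ]
    (K : Subgroup (Matrix.GeneralLinearGroup (Fin n) ℝ))
    (hKcpt : IsCompact (K : Set (Matrix.GeneralLinearGroup (Fin n) ℝ)))
    (hKconn : IsConnected (K : Set (Matrix.GeneralLinearGroup (Fin n) ℝ)))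
    (hKinf : (K : Set (Matrix.GeneralLinearGroup (Fin n) ℝ)).Infinite)
    (hinv : ∀ g ∈ K,
      Measure.map (fun v => ((g : Matrix (Fin n) (Fin n) ℝ)).mulVec v) μ = μ)
    (hnofix : ∀ v : Fin n → ℝ,
      (∀ g ∈ K, ((g : Matrix (Fin n) (Fin n) ℝ)).mulVec v = v) → v = 0)
    (hnull : ∀ U : Submodule ℝ (Fin n → ℝ), U ≠ ⊤ → μ (U : Set (Fin n → ℝ)) = 0) :
    convPow μ n ≪ volume := by
  obtain ⟨S, hSK, hdet⟩ := exists_family K hKcpt hKconn hnofix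
  refine Measure.AbsolutelyContinuous.mk fun N hNm hN => ?_
  rw [convPow_eq_map, Measure.map_apply (by fun_prop) hNm]
  have h1 := ae_linInd n μ hnull n le_rfl
  have h2 : ∀ r : Fin n → S, ∀ᵐ x ∂(Measure.pi fun _ : Fin n => μ),
      x ∉ {x : Fin n → Fin n → ℝ | (∑ i, x i ∈ N) ∧ ∃ t, Jac (fun i => (r i).1) x t ≠ 0} := fun r => by
    refine measure_eq_zero_iff_ae_notMem.1 (null_on_good μ (fun i => (r i).1) (fun i t => ?_) N hNm hN)
    obtain ⟨g, hg, hge⟩ := hSK _ (r i).2 t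
    rw [← hge]
    exact hinv g hg
  refine measure_eq_zero_iff_ae_notMem.2 ?_
  filter_upwards [h1, ae_all_iff.2 h2] with x hx1 hx2 hxN
  obtain ⟨r, hr⟩ := exists_det_ne_zero (fun C : S => C.1) hdet x hx1
  refine hx2 r ⟨hxN, ?_⟩
  by_contra! h0
  refine hr (det_deriv_eq_zero (fun i s => (NormedSpace.exp (s • (r i).1) * (r i).1).mulVec (x i)) _ (fun i => ?_) h0)
  have := (hasStrictDerivAt_curve (r i).1 (r i).1 (x i) 0).hasDerivAt
  simpa using this
end

section
/- Let n ≥ 1, let H be a subgroup of GL(n,ℝ), and let μ be a finite Borel measure on ℝ^n invariant under the action of H. Then for every point x in the support of μ, the orbit {h·x : h ∈ H} is a bounded subset of ℝ^n (i.e., it is contained in a compact set). -/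
open MeasureTheory

/-- The support of a Borel measure: the smallest closed set whose complement is null,
realized as the intersection of all closed sets with null complement. -/
def measureSupport {X : Type*} [TopologicalSpace X] [MeasurableSpace X]
    (μ : Measure X) : Set X :=
  ⋂₀ {s : Set X | IsClosed s ∧ μ sᶜ = 0}

/-- Operators with norms tending to infinity contradict invariance off a proper subspace. -/
theorem bounded_aux (n : ℕ) (μ : Measure (Fin n → ℝ)) [IsFiniteMeasure μ]
    (S : Set ((Fin n → ℝ) →L[ℝ] (Fin n → ℝ)))
    (hS : ∀ g ∈ S, Measure.map (fun v => g v) μ = μ)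
    (W : Submodule ℝ (Fin n → ℝ)) (hW : μ (W : Set (Fin n → ℝ))ᶜ = 0)
    (hmin : ∀ U : Submodule ℝ (Fin n → ℝ), U < W → μ (U : Set (Fin n → ℝ))ᶜ ≠ 0)
    (P : (Fin n → ℝ) →L[ℝ] (Fin n → ℝ)) (hPW : ∀ v, P v ∈ W) (hP : ∀ v ∈ W, P v = v) :
    ∃ C : ℝ, ∀ g ∈ S, ‖g.comp P‖ ≤ C := by
  by_contra hcon
  push Not at hcon
  have h1 : ∀ k : ℕ, ∃ g ∈ S, ((k : ℝ) + 1) < ‖g.comp P‖ := fun k => hcon _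
  choose g hgS hg using h1
  let L : ℕ → ((Fin n → ℝ) →L[ℝ] (Fin n → ℝ)) := fun k => (g k).comp P
  have hL : ∀ k : ℕ, ((k : ℝ) + 1) < ‖L k‖ := hg
  have hLpos : ∀ k, 0 < ‖L k‖ := fun k => lt_trans (by positivity) (hL k)
  have hsph : ∀ k, (‖L k‖⁻¹ • L k) ∈ Metric.sphere (0 : (Fin n → ℝ) →L[ℝ] (Fin n → ℝ)) 1 := by
    intro k
    rw [mem_sphere_zero_iff_norm, norm_smul, norm_inv, norm_norm]
    exact inv_mul_cancel₀ (hLpos k).ne'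
  have : ProperSpace ((Fin n → ℝ) →L[ℝ] (Fin n → ℝ)) := FiniteDimensional.proper ℝ _
  obtain ⟨A, hA, φ, hφ, hlim⟩ := (isCompact_sphere _ _).tendsto_subseq hsph
  have hpt : ∀ v, Filter.Tendsto (fun k => ‖L (φ k)‖⁻¹ • L (φ k) v) Filter.atTop (nhds (A v)) := by
    intro v
    have := ((ContinuousLinearMap.apply ℝ (Fin n → ℝ) v).continuous.tendsto A).comp hlim
    exact this
  have hAP : ∀ v, A (P v) = A v := by
    intro v
    refine tendsto_nhds_unique (hpt (P v)) ?_
    have : ∀ k, L k (P v) = L k v := fun k => by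
      simp only [L, ContinuousLinearMap.comp_apply, hP _ (hPW v)]
    simpa only [this] using hpt v
  have hA0 : A ≠ 0 := by
    rintro rfl
    simp at hA
  let U : Submodule ℝ (Fin n → ℝ) := W ⊓ LinearMap.ker (A : (Fin n → ℝ) →ₗ[ℝ] (Fin n → ℝ))
  have hUW : U < W := by
    refine lt_of_le_of_ne inf_le_left fun h => hA0 ?_
    ext1 v
    have h2 : P v ∈ U := h ▸ hPW v
    have h3 : A (P v) = 0 := h2.2
    rw [← hAP v, h3]; rfl
  have hU := hmin U hUW
  have hnorm : Filter.Tendsto (fun k => ‖L (φ k)‖) Filter.atTop Filter.atTop := by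
    have : Filter.Tendsto (fun k => ‖L k‖) Filter.atTop Filter.atTop :=
      Filter.tendsto_atTop_mono (fun k => by linarith [hL k]) tendsto_natCast_atTop_atTop
    exact this.comp hφ.tendsto_atTop
  have hdiv : ∀ v ∈ W, v ∉ U →
      Filter.Tendsto (fun k => ‖g (φ k) v‖) Filter.atTop Filter.atTop := by
    intro v hv hvU
    have hAv : A v ≠ 0 := fun h => hvU ⟨hv, h⟩
    have h4 := hnorm.atTop_mul_pos (norm_pos_iff.2 hAv) (hpt v).norm
    refine h4.congr fun k => ?_
    rw [norm_smul, norm_inv, norm_norm, mul_inv_cancel_left₀ (hLpos _).ne']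
    simp only [L, ContinuousLinearMap.comp_apply, hP v hv]
  -- tightness
  have htight : ∃ N : ℕ, μ {v | (N : ℝ) < ‖v‖} < μ (U : Set (Fin n → ℝ))ᶜ := by
    have hanti : Antitone (fun N : ℕ => {v : Fin n → ℝ | (N : ℝ) < ‖v‖}) := by
      intro a b hab v hv
      have : (a : ℝ) ≤ b := by exact_mod_cast hab
      exact lt_of_le_of_lt this hv
    have ht := tendsto_measure_iInter_atTop (μ := μ)
      (fun N => (measurableSet_lt measurable_const measurable_norm).nullMeasurableSet)
      hanti ⟨0, measure_ne_top _ _⟩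
    have hempty : (⋂ N : ℕ, {v : Fin n → ℝ | (N : ℝ) < ‖v‖}) = ∅ := by
      ext v
      simp only [Set.mem_iInter, Set.mem_ofPred_eq, Set.mem_empty_iff_false, iff_false, not_forall,
        not_lt]
      exact exists_nat_ge ‖v‖
    rw [hempty, measure_empty] at ht
    exact (ht.eventually (gt_mem_nhds (pos_iff_ne_zero.2 hU))).exists
  obtain ⟨N, hN⟩ := htight
  let E : ℕ → Set (Fin n → ℝ) := fun k => {v | (N : ℝ) < ‖g (φ k) v‖}
  have hE : ∀ k, μ (E k) = μ {v | (N : ℝ) < ‖v‖} := by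
    intro k
    conv_rhs => rw [← hS _ (hgS (φ k))]
    rw [Measure.map_apply (g (φ k)).continuous.measurable
      (measurableSet_lt measurable_const measurable_norm)]
    rfl
  let T : ℕ → Set (Fin n → ℝ) := fun m => {v | ∀ k, m ≤ k → v ∈ E k}
  have hT : Monotone T := fun a b hab v hv k hk => hv k (hab.trans hk)
  have hTU : μ (⋃ m, T m) ≤ μ {v | (N : ℝ) < ‖v‖} := by
    rw [hT.measure_iUnion]
    exact iSup_le fun m => (measure_mono (show T m ⊆ E m from fun v hv => hv m le_rfl)).trans (hE m).le
  have hsub : (U : Set (Fin n → ℝ))ᶜ ⊆ (⋃ m, T m) ∪ (W : Set (Fin n → ℝ))ᶜ := by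
    intro v hv
    by_cases hvW : v ∈ W
    · left
      obtain ⟨m, hm⟩ := Filter.eventually_atTop.1 ((hdiv v hvW hv).eventually_gt_atTop (N : ℝ))
      exact Set.mem_iUnion.2 ⟨m, hm⟩
    · exact Or.inr hvW
  have := calc μ (U : Set (Fin n → ℝ))ᶜ ≤ μ (⋃ m, T m) + μ (W : Set (Fin n → ℝ))ᶜ :=
        (measure_mono hsub).trans (measure_union_le _ _)
    _ ≤ μ {v | (N : ℝ) < ‖v‖} := by rw [hW, add_zero]; exact hTU
  exact absurd hN (not_lt.2 this)

/-- **Orbits through the support of a finite invariant measure are bounded.**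
If a finite Borel measure `μ` on `ℝ^n` is invariant under a subgroup `H` of `GL(n,ℝ)`,
then for every point `x` in the support of `μ` the orbit `{h·x : h ∈ H}` is a bounded
subset of `ℝ^n`. -/
theorem orbit_of_support_bounded (n : ℕ) (hn : 1 ≤ n)
    (μ : Measure (Fin n → ℝ)) [IsFiniteMeasure μ]
    (H : Subgroup (Matrix.GeneralLinearGroup (Fin n) ℝ))
    (hinv : ∀ g ∈ H,
      Measure.map (fun v => ((g : Matrix (Fin n) (Fin n) ℝ)).mulVec v) μ = μ) :
    ∀ x ∈ measureSupport μ,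
      Bornology.IsBounded
        {w : Fin n → ℝ | ∃ h ∈ H, w = ((h : Matrix (Fin n) (Fin n) ℝ)).mulVec x} := by
  intro x hx
  obtain ⟨W, hW, hmin⟩ := (wellFounded_lt (α := Submodule ℝ (Fin n → ℝ))).has_min
    {W | μ (W : Set (Fin n → ℝ))ᶜ = 0} ⟨⊤, by simp⟩
  obtain ⟨p, hp⟩ := W.subtype.exists_leftInverse_of_injective W.ker_subtype
  let P : (Fin n → ℝ) →L[ℝ] (Fin n → ℝ) := LinearMap.toContinuousLinearMap (W.subtype.comp p)
  have hPW : ∀ v, P v ∈ W := fun v => (p v).2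
  have hP : ∀ v ∈ W, P v = v := fun v hv =>
    congrArg Subtype.val (LinearMap.congr_fun hp ⟨v, hv⟩)
  let T : Matrix (Fin n) (Fin n) ℝ → ((Fin n → ℝ) →L[ℝ] (Fin n → ℝ)) :=
    fun M => LinearMap.toContinuousLinearMap M.mulVecLin
  obtain ⟨C, hC⟩ := bounded_aux n μ
    {t | ∃ h ∈ H, t = T (h : Matrix (Fin n) (Fin n) ℝ)}
    (by rintro _ ⟨h, hh, rfl⟩; exact hinv h hh) W hW (fun U hU h0 => hmin U h0 hU) P hPW hP
  have hxW : x ∈ W := hx _ ⟨W.closed_of_finiteDimensional, hW⟩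
  refine isBounded_iff_forall_norm_le.2 ⟨C * ‖x‖, ?_⟩
  rintro _ ⟨h, hh, rfl⟩
  have h1 := ((T (h : Matrix (Fin n) (Fin n) ℝ)).comp P).le_of_opNorm_le (hC _ ⟨h, hh, rfl⟩) x
  rw [ContinuousLinearMap.comp_apply, hP x hxW] at h1
  exact h1
end

section
/- Let n ≥ 2 and let μ be a Borel probability measure on ℝ^n that is invariant under the action of SL(n,ℝ) by matrix–vector multiplication. Then μ is the Dirac point mass at the origin. -/
open MeasureTheory

theorem aux_scale (n : ℕ)
    (μ : Measure (Fin n → ℝ))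
    (hinv : ∀ A : Matrix.SpecialLinearGroup (Fin n) ℝ,
      Measure.map (fun v => ((A : Matrix (Fin n) (Fin n) ℝ)).mulVec v) μ = μ)
    (i j : Fin n) (hij : i ≠ j) (t : ℝ) (ht : t ≠ 0) :
    μ {v | |t * v i| ≤ 1} = μ {v | |v i| ≤ 1} := by
  have hdet : (Matrix.diagonal (Pi.mulSingle i t * Pi.mulSingle j t⁻¹ : Fin n → ℝ)).det = 1 := by
    rw [Matrix.det_diagonal]
    simp only [Pi.mul_apply, Finset.prod_mul_distrib]
    simp [Finset.prod_pi_mulSingle', ht]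
  have h := hinv ⟨_, hdet⟩
  have hm : MeasurableSet {v : Fin n → ℝ | |v i| ≤ 1} := by
    apply IsClosed.measurableSet
    exact isClosed_le (by fun_prop) (by fun_prop)
  have hmeas : Measurable (fun v : Fin n → ℝ =>
      (Matrix.diagonal (Pi.mulSingle i t * Pi.mulSingle j t⁻¹ : Fin n → ℝ)).mulVec v) := by
    apply Continuous.measurable
    fun_prop
  conv_rhs => rw [← h]
  rw [Measure.map_apply hmeas hm]
  congr 1
  ext v
  simp [Matrix.mulVec_diagonal, Pi.mulSingle_eq_of_ne hij]

/-- **The only `SL(n,ℝ)`-invariant probability measure on `ℝ^n` is `δ₀`.**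
For `n ≥ 2`, a Borel probability measure on `ℝ^n` invariant under the action of `SL(n,ℝ)`
by matrix–vector multiplication is the Dirac point mass at the origin. -/
theorem slnR_invariant_prob_eq_dirac_zero (n : ℕ) (hn : 2 ≤ n)
    (μ : Measure (Fin n → ℝ)) [IsProbabilityMeasure μ]
    (hinv : ∀ A : Matrix.SpecialLinearGroup (Fin n) ℝ,
      Measure.map (fun v => ((A : Matrix (Fin n) (Fin n) ℝ)).mulVec v) μ = μ) :
    μ = Measure.dirac 0 := by
  have key : ∀ i : Fin n, ∀ᵐ v ∂μ, v i = 0 := by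
    intro i
    haveI : Nontrivial (Fin n) := Fin.nontrivial_iff_two_le.mpr hn
    obtain ⟨j, hj⟩ := exists_ne i
    have hs := aux_scale n μ hinv i j hj.symm
    have hmono : Monotone (fun m : ℕ => {v : Fin n → ℝ | |((m : ℝ) + 1)⁻¹ * v i| ≤ 1}) := by
      intro a b hab v hv
      simp only [Set.mem_setOf_eq, abs_mul] at hv ⊢
      refine le_trans ?_ hv
      have ha : (0 : ℝ) < (a : ℝ) + 1 := by positivity
      have hb : (0 : ℝ) < (b : ℝ) + 1 := by positivity
      rw [abs_of_pos (inv_pos.mpr ha), abs_of_pos (inv_pos.mpr hb)]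
      gcongr
    have hU : (⋃ m : ℕ, {v : Fin n → ℝ | |((m : ℝ) + 1)⁻¹ * v i| ≤ 1}) = Set.univ := by
      refine Set.eq_univ_of_forall fun v => Set.mem_iUnion.mpr ?_
      obtain ⟨m, hm⟩ := exists_nat_ge |v i|
      refine ⟨m, ?_⟩
      have ha : (0 : ℝ) < (m : ℝ) + 1 := by positivity
      simp only [Set.mem_setOf_eq, abs_mul]
      rw [abs_of_pos (inv_pos.mpr ha), inv_mul_le_iff₀ ha]
      linarith
    have h1 : μ {v | |v i| ≤ 1} = 1 := by
      have := hmono.measure_iUnion (μ := μ)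
      rw [hU, measure_univ] at this
      rw [this]
      have h2 : ∀ m : ℕ, μ {v : Fin n → ℝ | |((m : ℝ) + 1)⁻¹ * v i| ≤ 1} = μ {v | |v i| ≤ 1} :=
        fun m => hs _ (by positivity)
      simp only [h2, ciSup_const]
    have h3 : ∀ m : ℕ, ∀ᵐ v ∂μ, |((m : ℝ) + 1) * v i| ≤ 1 := by
      intro m
      have hm : MeasurableSet {v : Fin n → ℝ | |((m : ℝ) + 1) * v i| ≤ 1} := by
        apply IsClosed.measurableSet
        exact isClosed_le (by fun_prop) (by fun_prop)
      have h4 := (hs ((m : ℝ) + 1) (by positivity)).trans h1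
      exact (prob_compl_eq_zero_iff hm).mpr h4
    filter_upwards [ae_all_iff.mpr h3] with v hv
    by_contra hne
    have hp : 0 < |v i| := abs_pos.mpr hne
    obtain ⟨m, hm⟩ := exists_nat_gt (|v i|⁻¹)
    have := hv m
    have ha : (0 : ℝ) < (m : ℝ) + 1 := by positivity
    rw [abs_mul, abs_of_pos ha] at this
    have h5 : |v i|⁻¹ * |v i| = 1 := inv_mul_cancel₀ hp.ne'
    nlinarith
  have hz : ∀ᵐ v ∂μ, v = 0 := by
    filter_upwards [ae_all_iff.mpr key] with v hv
    exact funext hv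
  have hid : Measure.map (fun v => v) μ = Measure.map (fun _ => (0 : Fin n → ℝ)) μ :=
    Measure.map_congr hz
  rw [Measure.map_const] at hid
  simpa using hid
end

section
/- Let G be a group with center Z. Then the set S of all shear automorphisms of G, namely S = {τ_φ : φ is a group homomorphism G → G with φ(G) ⊆ Z and φ(Z) = {1}}, where τ_φ(x) = x·φ(x), is an abelian subgroup of the automorphism group Aut(G), and S is normal in Aut(G). -/
/-- An automorphism is a shear iff it acts trivially on the center and modulo the center. -/
def IsShearAux {G : Type*} [Group G] (τ : MulAut G) : Prop :=
  (∀ x : G, ∃ c ∈ Subgroup.center G, τ x = x * c) ∧ ∀ z ∈ Subgroup.center G, τ z = z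

theorem isShearAux_iff {G : Type*} [Group G] (τ : MulAut G) :
    IsShearAux τ ↔ ∃ φ : G →* G, (∀ x : G, φ x ∈ Subgroup.center G) ∧
          (∀ z ∈ Subgroup.center G, φ z = 1) ∧ ∀ x : G, τ x = x * φ x := by
  constructor
  · rintro ⟨h1, h2⟩
    have h3 : ∀ x : G, x⁻¹ * τ x ∈ Subgroup.center G := by
      intro x
      obtain ⟨c, hc, h⟩ := h1 x
      rw [h, inv_mul_cancel_left]
      exact hc
    refine ⟨MonoidHom.mk' (fun x => x⁻¹ * τ x) ?_, h3, ?_, ?_⟩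
    · intro x y
      have h := Subgroup.mem_center_iff.1 (h3 x) y⁻¹
      calc (x * y)⁻¹ * τ (x * y) = (y⁻¹ * (x⁻¹ * τ x)) * τ y := by
            rw [map_mul]; group
        _ = (x⁻¹ * τ x) * (y⁻¹ * τ y) := by rw [h, mul_assoc]
    · intro z hz
      simp [h2 z hz]
    · intro x
      simp
  · rintro ⟨φ, h1, h2, h3⟩
    refine ⟨fun x => ⟨φ x, h1 x, h3 x⟩, fun z hz => ?_⟩
    rw [h3, h2 z hz, mul_one]

theorem map_mem_center_aux {G : Type*} [Group G] (g : MulAut G) {z : G}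
    (hz : z ∈ Subgroup.center G) : g z ∈ Subgroup.center G := by
  rw [Subgroup.mem_center_iff] at hz ⊢
  intro x
  have h := congrArg g (hz (g⁻¹ x))
  simpa only [map_mul, MulAut.apply_inv_self] using h

/-- The subgroup of shear automorphisms. -/
def shearSubgroupAux (G : Type*) [Group G] : Subgroup (MulAut G) where
  carrier := {τ | IsShearAux τ}
  one_mem' := ⟨fun x => ⟨1, one_mem _, by simp⟩, fun z _ => rfl⟩
  mul_mem' := by
    rintro a b ⟨ha, ha'⟩ ⟨hb, hb'⟩
    refine ⟨fun x => ?_, fun z hz => ?_⟩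
    · obtain ⟨c, hc, h⟩ := hb x
      obtain ⟨d, hd, h'⟩ := ha x
      exact ⟨d * c, mul_mem hd hc, by
        rw [MulAut.mul_apply, h, map_mul, h', ha' c hc, mul_assoc]⟩
    · rw [MulAut.mul_apply, hb' z hz, ha' z hz]
  inv_mem' := by
    rintro a ⟨ha, ha'⟩
    refine ⟨fun x => ?_, fun z hz => ?_⟩
    · obtain ⟨c, hc, h⟩ := ha (a⁻¹ x)
      refine ⟨c⁻¹, inv_mem hc, ?_⟩
      rw [MulAut.apply_inv_self] at h
      exact eq_mul_inv_of_mul_eq h.symm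
    · have h := congrArg (a⁻¹ : MulAut G) (ha' z hz)
      rw [MulAut.inv_apply_self] at h
      exact h.symm

/-- **Shear automorphisms form an abelian normal subgroup of `Aut(G)`.**
Let `G` be a group with center `Z`. The set of all shear automorphisms, i.e. the
automorphisms of the form `x ↦ x·φ(x)` with `φ : G → G` a homomorphism taking values in
`Z` and vanishing on `Z`, is an abelian subgroup of `Aut(G)` which is normal in
`Aut(G)`. -/
theorem shear_automorphisms_abelian_normal_subgroup (G : Type*) [Group G] :
    ∃ S : Subgroup (MulAut G),
      (∀ τ : MulAut G, τ ∈ S ↔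
        ∃ φ : G →* G, (∀ x : G, φ x ∈ Subgroup.center G) ∧
          (∀ z ∈ Subgroup.center G, φ z = 1) ∧ ∀ x : G, τ x = x * φ x) ∧
      (∀ a ∈ S, ∀ b ∈ S, a * b = b * a) ∧
      S.Normal := by
  refine ⟨shearSubgroupAux G, fun τ => isShearAux_iff τ, ?_, ⟨?_⟩⟩
  · rintro a ⟨ha, ha'⟩ b ⟨hb, hb'⟩
    ext x
    obtain ⟨c, hc, h⟩ := hb x
    obtain ⟨d, hd, h'⟩ := ha x
    rw [MulAut.mul_apply, MulAut.mul_apply, h, h', map_mul, map_mul, h, h', ha' c hc, hb' d hd,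
      mul_assoc, mul_assoc, Subgroup.mem_center_iff.1 hc d]
  · rintro a ⟨ha, ha'⟩ g
    refine ⟨fun x => ?_, fun z hz => ?_⟩
    · obtain ⟨c, hc, h⟩ := ha (g⁻¹ x)
      refine ⟨g c, map_mem_center_aux g hc, ?_⟩
      rw [MulAut.mul_apply, MulAut.mul_apply, h, map_mul, MulAut.apply_inv_self]
    · rw [MulAut.mul_apply, MulAut.mul_apply, ha' _ (map_mem_center_aux g⁻¹ hz),
        MulAut.apply_inv_self]
end

section
/- Let n ≥ 2 and let A be an abelian subgroup of GL(n,ℤ) such that some point of the torus T^n has dense orbit under the action of A by the induced automorphisms of T^n. Then there exists a single element g ∈ A and a point x ∈ T^n such that the orbit {g^k(x) : k ∈ ℤ} of x under the automorphism of T^n induced by g is dense in T^n. -/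
section Helpers
open scoped Pointwise

/-- The elements of `A` acting as a root of unity modulo the ideal `P`. -/
def torsSub {R A : Type*} [CommRing R] [CommGroup A] (ρ : A →* R) (P : Ideal R) : Subgroup A where
  carrier := {a | ∃ k : ℕ, 0 < k ∧ ρ a ^ k - 1 ∈ P}
  one_mem' := ⟨1, one_pos, by simp⟩
  mul_mem' := by
    rintro a b ⟨k, hk, ha⟩ ⟨l, hl, hb⟩
    refine ⟨k * l, Nat.mul_pos hk hl, ?_⟩
    rw [← Ideal.Quotient.eq_zero_iff_mem] at *
    simp only [map_sub, map_pow, map_one, map_mul, sub_eq_zero] at *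
    rw [mul_pow, pow_mul, ha, mul_comm k l, pow_mul, hb]; simp
  inv_mem' := by
    rintro a ⟨k, hk, ha⟩
    refine ⟨k, hk, ?_⟩
    have h1 : ρ a⁻¹ ^ k * ρ a ^ k = 1 := by rw [← mul_pow, ← map_mul]; simp
    have : ρ a⁻¹ ^ k - 1 = - (ρ a⁻¹ ^ k) * (ρ a ^ k - 1) := by linear_combination h1
    rw [this]; exact P.mul_mem_left _ ha

lemma roots_finite (K : Type*) [Field K] [Algebra ℚ K] [inst : FiniteDimensional ℚ K] :
    {x : K | ∃ k : ℕ, 0 < k ∧ x ^ k = 1}.Finite := by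
  have : CharZero K := algebraRat.charZero K
  have : NumberField K :=
    { to_charZero := inferInstance, to_finiteDimensional := by
        convert! inst
        exact Subsingleton.elim _ _ }
  refine (NumberField.Embeddings.finite_of_norm_le K ℂ 1).subset ?_
  rintro x ⟨k, hk, hx⟩
  refine ⟨?_, fun φ => ?_⟩
  · exact IsIntegral.of_pow hk (hx ▸ isIntegral_one)
  · exact (pow_eq_one_iff_of_nonneg (norm_nonneg _) hk.ne' |>.mp (by rw [← norm_pow, ← map_pow, hx, map_one, norm_one])).le

lemma quot_finite {R A : Type*} [CommRing R] [Algebra ℚ R] [FiniteDimensional ℚ R]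
    [CommGroup A] (ρ : A →* R) (P : Ideal R) [P.IsPrime] (h : torsSub ρ P = ⊤) :
    (Set.range fun a => Ideal.Quotient.mk P (ρ a)).Finite := by
  have : IsArtinianRing R := isArtinian_of_tower ℚ inferInstance
  have : P.IsMaximal := inferInstance
  let _ : Field (R ⧸ P) := Ideal.Quotient.field P
  have : @FiniteDimensional ℚ (R ⧸ P) _ _ Algebra.toModule :=
    Module.Finite.of_surjective (Ideal.Quotient.mkₐ ℚ P).toLinearMap Ideal.Quotient.mk_surjective
  refine (roots_finite (R ⧸ P)).subset ?_
  rintro _ ⟨a, rfl⟩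
  have : a ∈ torsSub ρ P := h ▸ trivial
  obtain ⟨k, hk, ha⟩ := this
  refine ⟨k, hk, ?_⟩
  rw [← Ideal.Quotient.eq_zero_iff_mem] at ha
  simpa [sub_eq_zero] using ha

lemma exists_elt {R V A : Type*} [CommRing R] [Algebra ℚ R] [FiniteDimensional ℚ R]
    [AddCommGroup V] [Module R V] [Module.Finite R V] [CommGroup A] (ρ : A →* R)
    (h : ∀ v : V, v ≠ 0 → ¬ (Set.range fun a => ρ a • v).Finite) :
    ∃ g, ∀ v : V, v ≠ 0 → ∀ k : ℕ, 0 < k → ρ g ^ k • v ≠ v := by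
  have : IsArtinianRing R := isArtinian_of_tower ℚ inferInstance
  have : IsNoetherianRing R := inferInstance
  have hfin := associatedPrimes.finite R V
  by_contra! hcon
  have hcov : ⋃ P ∈ hfin.toFinset, (1 : A) • ((torsSub ρ P : Subgroup A) : Set A) = Set.univ := by
    rw [Set.eq_univ_iff_forall]
    intro g
    obtain ⟨v, hv, k, hk, hg⟩ := hcon g
    obtain ⟨P, hP, hle⟩ := exists_le_isAssociatedPrime_of_isNoetherianRing R v hv
    simp only [Set.mem_iUnion, Set.Finite.mem_toFinset, one_smul]
    refine ⟨P, hP, k, hk, hle ?_⟩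
    rw [Submodule.mem_colon_singleton, sub_smul, hg]; simp
  obtain ⟨P, hP, hfi⟩ := Subgroup.exists_finiteIndex_of_leftCoset_cover hcov
  have hP : IsAssociatedPrime P V := hfin.mem_toFinset.mp hP
  have hPp := hP.isPrime
  have htop : torsSub ρ P = ⊤ := by
    rw [Subgroup.eq_top_iff']
    intro a
    obtain ⟨k, hk, hka⟩ := Subgroup.exists_pow_mem_of_index_ne_zero hfi.index_ne_zero a
    obtain ⟨l, hl, hal⟩ := hka.2
    exact ⟨k * l, Nat.mul_pos hk hl, by rwa [map_pow, ← pow_mul] at hal⟩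
  have hq := quot_finite ρ P htop
  obtain ⟨-, v, hv⟩ := isAssociatedPrime_iff.mp hP
  have hv0 : v ≠ 0 := by
    rintro rfl
    exact hPp.ne_top (by rw [hv]; ext; simp)
  have hmem : ∀ r, r ∈ P ↔ r • v = 0 := fun r => by
    rw [hv, Submodule.mem_colon_singleton, Submodule.mem_bot]
  apply h v hv0
  choose! s hs using fun q : R ⧸ P => Ideal.Quotient.mk_surjective q
  refine (hq.image fun q => s q • v).subset ?_
  rintro _ ⟨a, rfl⟩
  refine ⟨_, ⟨a, rfl⟩, ?_⟩
  have := hs (Ideal.Quotient.mk P (ρ a))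
  rw [Ideal.Quotient.eq, hmem, sub_smul, sub_eq_zero] at this
  exact this

open MeasureTheory UnitAddTorus

noncomputable local instance instMSU : MeasureSpace UnitAddCircle := ⟨AddCircle.haarAddCircle⟩

local instance instHaarU : Measure.IsAddHaarMeasure (volume : Measure UnitAddCircle) :=
  inferInstanceAs (Measure.IsAddHaarMeasure AddCircle.haarAddCircle)

local instance instProbU : IsProbabilityMeasure (volume : Measure UnitAddCircle) :=
  inferInstanceAs (IsProbabilityMeasure AddCircle.haarAddCircle)

/-- The endomorphism of the torus given by an integer matrix. -/
def torusHom {n : ℕ} (M : Matrix (Fin n) (Fin n) ℤ) : UnitAddTorus (Fin n) →+ UnitAddTorus (Fin n) where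
  toFun x := fun i => ∑ j, M i j • x j
  map_zero' := by ext; simp
  map_add' x y := by ext i; simp [Finset.sum_add_distrib]

lemma torusHom_apply {n : ℕ} (M : Matrix (Fin n) (Fin n) ℤ) (x : UnitAddTorus (Fin n)) :
    torusHom M x = fun i => ∑ j, M i j • x j := rfl

lemma torusHom_mul {n : ℕ} (M N : Matrix (Fin n) (Fin n) ℤ) (x : UnitAddTorus (Fin n)) :
    torusHom (M * N) x = torusHom M (torusHom N x) := by
  ext i
  simp only [torusHom_apply, Matrix.mul_apply, Finset.sum_smul, Finset.smul_sum, mul_smul]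
  exact Finset.sum_comm

lemma torusHom_one {n : ℕ} (x : UnitAddTorus (Fin n)) :
    torusHom 1 x = x := by
  ext i
  simp [torusHom_apply, Matrix.one_apply, ite_smul]

lemma torusHom_continuous {n : ℕ} (M : Matrix (Fin n) (Fin n) ℤ) : Continuous (torusHom M) := by
  change Continuous fun x : UnitAddTorus (Fin n) => fun i => ∑ j, M i j • x j
  fun_prop

lemma torusHom_surj {n : ℕ} (g : Matrix.GeneralLinearGroup (Fin n) ℤ) :
    Function.Surjective (torusHom (g : Matrix (Fin n) (Fin n) ℤ)) := fun y =>
  ⟨torusHom ((g⁻¹ : Matrix.GeneralLinearGroup (Fin n) ℤ) : Matrix (Fin n) (Fin n) ℤ) y, by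
    rw [← torusHom_mul, ← Units.val_mul, mul_inv_cancel, Units.val_one, torusHom_one]⟩

lemma torusHom_mp {n : ℕ} (g : Matrix.GeneralLinearGroup (Fin n) ℤ) :
    MeasurePreserving (torusHom (g : Matrix (Fin n) (Fin n) ℤ)) volume volume :=
  AddMonoidHom.measurePreserving (torusHom_continuous _) (torusHom_surj g) rfl

lemma mFourier_eq_sum {n : ℕ} (a : Fin n → ℤ) (x : UnitAddTorus (Fin n)) :
    mFourier a x = AddCircle.toCircle (∑ i, a i • x i) := by
  simp only [mFourier, ContinuousMap.coe_mk, fourier_apply]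
  induction (Finset.univ : Finset (Fin n)) using Finset.cons_induction with
  | empty => simp
  | cons i s hi ih => rw [Finset.sum_cons, Finset.prod_cons, ih, AddCircle.toCircle_add, Circle.coe_mul]

lemma sum_torusHom {n : ℕ} (M : Matrix (Fin n) (Fin n) ℤ) (a : Fin n → ℤ)
    (x : UnitAddTorus (Fin n)) :
    ∑ i, a i • torusHom M x i = ∑ i, (Matrix.vecMul a M) i • x i := by
  simp only [torusHom_apply, Matrix.vecMul, dotProduct, Finset.sum_smul, Finset.smul_sum, mul_smul]
  exact Finset.sum_comm

lemma mFourier_torusHom {n : ℕ} (M : Matrix (Fin n) (Fin n) ℤ) (a : Fin n → ℤ)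
    (x : UnitAddTorus (Fin n)) :
    mFourier a (torusHom M x) = mFourier (Matrix.vecMul a M) x := by
  rw [mFourier_eq_sum, mFourier_eq_sum, sum_torusHom]

/-- Invariant open nonempty sets are conull. -/
lemma ae_mem_of_invariant {n : ℕ} (g : Matrix.GeneralLinearGroup (Fin n) ℤ)
    (h : ∀ a : Fin n → ℤ, a ≠ 0 → ∀ k : ℕ, 0 < k →
      Matrix.vecMul a ((g : Matrix (Fin n) (Fin n) ℤ) ^ k) ≠ a)
    (U : Set (UnitAddTorus (Fin n))) (hU : IsOpen U) (hne : U.Nonempty)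
    (hinv : ∀ x, torusHom (g : Matrix (Fin n) (Fin n) ℤ) x ∈ U ↔ x ∈ U) :
    ∀ᵐ x, x ∈ U := by
  set G : Matrix (Fin n) (Fin n) ℤ := (g : Matrix (Fin n) (Fin n) ℤ) with hG
  have hmeas : MeasurableSet U := hU.measurableSet
  let f : UnitAddTorus (Fin n) → ℂ := U.indicator fun _ => 1
  have hf : MemLp f 2 volume := (memLp_const 1).indicator hmeas
  let F : Lp ℂ 2 (volume : Measure (UnitAddTorus (Fin n))) := hf.toLp f
  have hFf : F =ᵐ[volume] f := hf.coeFn_toLp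
  have hcoef : ∀ a, mFourierCoeff F a = mFourierCoeff f a := fun a => by
    apply integral_congr_ae
    filter_upwards [hFf] with x hx
    rw [hx]
  have hfinv : ∀ x, f (torusHom G x) = f x := fun x => by
    classical simp only [f, Set.indicator_apply, hinv]
  have hc1 : ∀ a, mFourierCoeff f (Matrix.vecMul a G) = mFourierCoeff f a := fun a => by
    have hemb : MeasurableEmbedding (torusHom G) := by
      refine (torusHom_continuous G).measurableEmbedding ?_
      intro x y hxy
      have := congrArg (torusHom ((g⁻¹ : Matrix.GeneralLinearGroup (Fin n) ℤ) :
        Matrix (Fin n) (Fin n) ℤ)) hxy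
      simpa only [hG, ← torusHom_mul, ← Units.val_mul, inv_mul_cancel, Units.val_one,
        torusHom_one] using this
    unfold mFourierCoeff
    rw [← (torusHom_mp g).integral_comp hemb (fun t => mFourier (-a) t • f t)]
    congr 1
    ext x
    rw [← hG, hfinv, mFourier_torusHom, Matrix.neg_vecMul]
  have hck : ∀ a, ∀ k : ℕ, mFourierCoeff f (Matrix.vecMul a (G ^ k)) = mFourierCoeff f a := by
    intro a k
    induction k with
    | zero => simp
    | succ k ih => rw [pow_succ, ← Matrix.vecMul_vecMul, hc1, ih]
  have hzero : ∀ a, a ≠ 0 → mFourierCoeff f a = 0 := by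
    intro a ha
    have hinj : Function.Injective fun k : ℕ => Matrix.vecMul a (G ^ k) := by
      have key : ∀ k l : ℕ, k < l → Matrix.vecMul a (G ^ k) ≠ Matrix.vecMul a (G ^ l) := by
        intro k l hkl heq
        apply h a ha (l - k) (by omega)
        have h2 : G ^ l = G ^ (l - k) * G ^ k := by rw [← pow_add]; congr 1; omega
        rw [h2, ← Matrix.vecMul_vecMul] at heq
        have hu : G ^ k * ((g ^ k)⁻¹ : Matrix.GeneralLinearGroup (Fin n) ℤ) = 1 := by
          rw [hG, ← Units.val_pow_eq_pow_val, ← Units.val_mul, mul_inv_cancel, Units.val_one]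
        have h3 := congrArg (fun v => Matrix.vecMul v
          (((g ^ k)⁻¹ : Matrix.GeneralLinearGroup (Fin n) ℤ) : Matrix (Fin n) (Fin n) ℤ)) heq
        simp only [Matrix.vecMul_vecMul, mul_assoc, hu, mul_one, Matrix.vecMul_one] at h3
        exact h3.symm
      intro k l hkl
      rcases lt_trichotomy k l with h1 | h1 | h1
      · exact absurd hkl (key _ _ h1)
      · exact h1
      · exact absurd hkl.symm (key _ _ h1)
    have hs := (hasSum_sq_mFourierCoeff F).summable.comp_injective hinj
    have hs' : Summable fun _ : ℕ => ‖mFourierCoeff f a‖ ^ 2 := by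
      refine hs.congr fun k => ?_
      simp only [Function.comp, hcoef, hck]
    have := tendsto_const_nhds_iff.mp hs'.tendsto_atTop_zero
    simpa using this
  have hsum := hasSum_mFourier_series_L2 F
  have hF : F = mFourierCoeff f 0 • mFourierLp 2 0 := by
    refine hsum.unique ?_
    rw [← hcoef 0]
    refine hasSum_single 0 fun a ha => ?_
    rw [hcoef, hzero a ha, zero_smul]
  set c := mFourierCoeff f 0
  have hae : ∀ᵐ x, f x = c := by
    have h1 := Lp.coeFn_smul c (mFourierLp (d := Fin n) 2 0)
    rw [← hF] at h1
    filter_upwards [hFf, h1, coeFn_mFourierLp (d := Fin n) 2 0] with x h2 h3 h4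
    rw [← h2, h3, Pi.smul_apply, h4, mFourier_zero]; simp
  have hc : c = 1 := by
    by_contra hc
    have : volume U = 0 := by
      refine measure_mono_null ?_ hae
      intro x hx hfx
      apply hc
      rw [← hfx]; simp [f, hx]
    exact (hU.measure_pos volume hne).ne' this
  filter_upwards [hae] with x hx
  by_contra hxU
  rw [hc] at hx
  simp [f, hxU] at hx

lemma exists_dense_orbit {n : ℕ} (g : Matrix.GeneralLinearGroup (Fin n) ℤ)
    (h : ∀ a : Fin n → ℤ, a ≠ 0 → ∀ k : ℕ, 0 < k →
      Matrix.vecMul a ((g : Matrix (Fin n) (Fin n) ℤ) ^ k) ≠ a) :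
    ∃ x : UnitAddTorus (Fin n), Dense {y | ∃ k : ℤ, y = torusHom
      ((g ^ k : Matrix.GeneralLinearGroup (Fin n) ℤ) : Matrix (Fin n) (Fin n) ℤ) x} := by
  obtain ⟨B, hBc, hB0, hB⟩ := TopologicalSpace.exists_countable_basis (UnitAddTorus (Fin n))
  have key : ∀ U ∈ B, ∀ᵐ x, x ∈ ⋃ k : ℤ, torusHom
      ((g ^ k : Matrix.GeneralLinearGroup (Fin n) ℤ) : Matrix (Fin n) (Fin n) ℤ) ⁻¹' U := by
    intro U hU
    apply ae_mem_of_invariant g h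
    · exact isOpen_iUnion fun k => (hB.isOpen hU).preimage (torusHom_continuous _)
    · obtain ⟨y, hy⟩ := Set.nonempty_iff_ne_empty.mpr (fun h0 => hB0 (h0 ▸ hU))
      exact ⟨y, Set.mem_iUnion.mpr ⟨0, by simpa [torusHom_one] using hy⟩⟩
    · intro x
      simp only [Set.mem_iUnion, Set.mem_preimage, ← torusHom_mul, ← Units.val_mul]
      constructor
      · rintro ⟨k, hk⟩
        exact ⟨k + 1, by rwa [zpow_add_one]⟩
      · rintro ⟨k, hk⟩
        exact ⟨k - 1, by rwa [← zpow_add_one, sub_add_cancel]⟩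
  rw [← ae_ball_iff hBc] at key
  obtain ⟨x, hx⟩ := key.exists
  refine ⟨x, ?_⟩
  rw [hB.dense_iff]
  intro U hU _
  obtain ⟨k, hk⟩ := Set.mem_iUnion.mp (hx U hU)
  exact ⟨_, hk, k, rfl⟩

lemma surj_char {n : ℕ} (a : Fin n → ℤ) (ha : a ≠ 0) :
    Function.Surjective fun y : UnitAddTorus (Fin n) => ∑ i, a i • y i := by
  obtain ⟨i, hi⟩ := Function.ne_iff.mp ha
  intro t
  obtain ⟨r, rfl⟩ := QuotientAddGroup.mk_surjective t
  refine ⟨Pi.single i ((r / a i : ℝ) : UnitAddCircle), ?_⟩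
  simp only
  rw [Finset.sum_eq_single i]
  · rw [Pi.single_eq_same, ← AddCircle.coe_zsmul]
    congr 1
    have : (a i : ℝ) ≠ 0 := by exact_mod_cast hi
    rw [zsmul_eq_mul]; field_simp
  · intro j _ hj
    rw [Pi.single_eq_of_ne hj, smul_zero]
  · simp

lemma no_finite {n : ℕ} (a : Fin n → ℤ) (ha : a ≠ 0) (S : Set (Matrix (Fin n) (Fin n) ℤ))
    (x : UnitAddTorus (Fin n)) (hd : Dense {y | ∃ g ∈ S, y = torusHom g x}) :
    ¬ ((fun g => Matrix.vecMul a g) '' S).Finite := by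
  intro hfin
  have hsurj := surj_char a ha
  have hcont : Continuous fun y : UnitAddTorus (Fin n) => ∑ i, a i • y i := by fun_prop
  have hd' := hsurj.denseRange.dense_image hcont hd
  have hf : ((fun y : UnitAddTorus (Fin n) => ∑ i, a i • y i) ''
      {y | ∃ g ∈ S, y = torusHom g x}).Finite := by
    refine (hfin.image fun b => ∑ i, b i • x i).subset ?_
    rintro _ ⟨_, ⟨g, hg, rfl⟩, rfl⟩
    exact ⟨_, ⟨g, hg, rfl⟩, (sum_torusHom g a x).symm⟩
  have huniv := hd'.closure_eq
  rw [hf.isClosed.closure_eq] at huniv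
  rw [huniv] at hf
  have h1 : Finite UnitAddCircle := Set.finite_univ_iff.mp hf
  have h2 : Finite (Set.Ico (0 : ℝ) (0 + 1)) :=
    Finite.of_equiv _ (AddCircle.equivIco (1 : ℝ) 0)
  exact Set.Ico_infinite (show (0 : ℝ) < 0 + 1 by norm_num) (Set.toFinite _)

open scoped IsMulCommutative in
lemma exists_elt_end {V A : Type*} [AddCommGroup V] [Module ℚ V] [FiniteDimensional ℚ V]
    [CommGroup A] (φ : A →* Module.End ℚ V)
    (h : ∀ v : V, v ≠ 0 → ¬ (Set.range fun a => φ a v).Finite) :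
    ∃ g, ∀ v : V, v ≠ 0 → ∀ k : ℕ, 0 < k → φ (g ^ k) v ≠ v := by
  have hcomm : ∀ a ∈ Set.range φ, ∀ b ∈ Set.range φ, a * b = b * a := by
    rintro _ ⟨a, rfl⟩ _ ⟨b, rfl⟩
    rw [← map_mul, ← map_mul, mul_comm]
  have hmc := Algebra.isMulCommutative_adjoin ℚ hcomm
  have hsub : ∀ a, φ a ∈ Algebra.adjoin ℚ (Set.range φ) := fun a =>
    Algebra.subset_adjoin ⟨a, rfl⟩
  generalize Algebra.adjoin ℚ (Set.range φ) = R at hmc hsub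
  let ρ : A →* R :=
    { toFun := fun a => ⟨φ a, hsub a⟩
      map_one' := Subtype.ext (map_one φ)
      map_mul' := fun a b => Subtype.ext (map_mul φ a b) }
  have hρ : ∀ a (v : V), ρ a • v = φ a v := fun a v => rfl
  have : FiniteDimensional ℚ R := inferInstanceAs (FiniteDimensional ℚ (Subalgebra.toSubmodule R))
  have : IsScalarTower ℚ R V := ⟨fun _ _ _ => rfl⟩
  have : Module.Finite R V := Module.Finite.of_restrictScalars_finite ℚ R _
  obtain ⟨g, hg⟩ := exists_elt (R := R) (V := V) ρ h
  refine ⟨g, fun v hv k hk => ?_⟩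
  rw [← hρ, map_pow]
  exact hg v hv k hk

lemma exists_good {n : ℕ} (A : Subgroup (Matrix.GeneralLinearGroup (Fin n) ℤ))
    (hab : ∀ a ∈ A, ∀ b ∈ A, a * b = b * a)
    (h : ∀ a : Fin n → ℤ, a ≠ 0 → ¬ ((fun g => Matrix.vecMul a g) ''
      {M : Matrix (Fin n) (Fin n) ℤ | ∃ g ∈ A, M = g}).Finite) :
    ∃ g ∈ A, ∀ a : Fin n → ℤ, a ≠ 0 → ∀ k : ℕ, 0 < k →
      Matrix.vecMul a ((g : Matrix (Fin n) (Fin n) ℤ) ^ k) ≠ a := by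
  let _ : CommGroup A := { (inferInstance : Group A) with
    mul_comm := fun a b => Subtype.ext (hab a a.2 b b.2) }
  let c : Matrix (Fin n) (Fin n) ℤ →+* Matrix (Fin n) (Fin n) ℚ := (Int.castRingHom ℚ).mapMatrix
  let φ : A →* Module.End ℚ (Fin n → ℚ) :=
    { toFun := fun a => Matrix.toLin' (c ((a : Matrix.GeneralLinearGroup (Fin n) ℤ) :
        Matrix (Fin n) (Fin n) ℤ)).transpose
      map_one' := by simp; rfl
      map_mul' := fun a b => by
        rw [mul_comm a b]
        simp only [Subgroup.coe_mul, Units.val_mul, map_mul, Matrix.transpose_mul,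
          Matrix.toLin'_mul]
        rfl }
  have hφ : ∀ (a : A) (v : Fin n → ℚ), φ a v = Matrix.vecMul v
      (c ((a : Matrix.GeneralLinearGroup (Fin n) ℤ) : Matrix (Fin n) (Fin n) ℤ)) := by
    intro a v
    change Matrix.toLin' _ v = _
    rw [Matrix.toLin'_apply, Matrix.mulVec_transpose]
  have hcast : ∀ (b : Fin n → ℤ) (M : Matrix (Fin n) (Fin n) ℤ),
      Matrix.vecMul (fun i => (b i : ℚ)) (c M) = fun i => ((Matrix.vecMul b M i : ℤ) : ℚ) := by
    intro b M
    ext i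
    simp [Matrix.vecMul, dotProduct, c]
  obtain ⟨g, hg⟩ := exists_elt_end φ (by
    intro v hv hfin
    obtain ⟨N, hN⟩ := IsLocalization.exist_integer_multiples_of_finite (nonZeroDivisors ℤ) v
    choose b hb using hN
    have hN0 : ((N : ℤ) : ℚ) ≠ 0 := by exact_mod_cast nonZeroDivisors.ne_zero N.2
    have hb' : (fun i => (b i : ℚ)) = ((N : ℤ) : ℚ) • v := by
      ext i
      simpa using hb i
    have hb0 : b ≠ 0 := by
      rintro rfl
      apply hv
      have : ((N : ℤ) : ℚ) • v = 0 := by rw [← hb']; ext; simp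
      exact (smul_eq_zero.mp this).resolve_left hN0
    apply h b hb0
    have hinj : Function.Injective fun (u : Fin n → ℤ) (i : Fin n) => (u i : ℚ) := by
      intro u w huw
      ext i
      exact Int.cast_injective (α := ℚ) (congrFun huw i)
    refine Set.Finite.of_finite_image (f := fun (u : Fin n → ℤ) (i : Fin n) => (u i : ℚ)) ?_
      hinj.injOn
    refine (hfin.image fun w => ((N : ℤ) : ℚ) • w).subset ?_
    rintro _ ⟨_, ⟨_, ⟨g, hg, rfl⟩, rfl⟩, rfl⟩
    refine ⟨_, ⟨⟨g, hg⟩, rfl⟩, ?_⟩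
    simp only [hφ]
    rw [← hcast, hb', Matrix.smul_vecMul])
  refine ⟨g, g.2, fun a ha k hk heq => ?_⟩
  refine hg (fun i => (a i : ℚ)) ?_ k hk ?_
  · intro h0
    apply ha
    ext i
    simpa using congrFun h0 i
  · rw [hφ, hcast]
    ext i
    rw [Subgroup.coe_pow, Units.val_pow_eq_pow_val, heq]


end Helpers

/-- **Abelian groups of toral automorphisms with dense orbits contain a single
automorphism with a dense orbit.**
Let `n ≥ 2` and let `A` be an abelian subgroup of `GL(n,ℤ)` such that some point of the
torus `T^n = (ℝ/ℤ)^n` has a dense orbit under the induced action of `A`. Then there are a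
single `g ∈ A` and a point `x ∈ T^n` whose orbit `{gᵏ(x) : k ∈ ℤ}` under the automorphism
induced by `g` is dense in `T^n`. -/
theorem abelian_dense_orbit_implies_single_dense_orbit (n : ℕ) (hn : 2 ≤ n)
    (A : Subgroup (Matrix.GeneralLinearGroup (Fin n) ℤ))
    (hab : ∀ a ∈ A, ∀ b ∈ A, a * b = b * a)
    (hdense : ∃ x : Fin n → AddCircle (1 : ℝ),
      Dense {y : Fin n → AddCircle (1 : ℝ) |
        ∃ g ∈ A, y = fun i => ∑ j, ((g : Matrix (Fin n) (Fin n) ℤ) i j) • x j}) :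
    ∃ g ∈ A, ∃ x : Fin n → AddCircle (1 : ℝ),
      Dense {y : Fin n → AddCircle (1 : ℝ) |
        ∃ k : ℤ, y = fun i =>
          ∑ j, (((g ^ k : Matrix.GeneralLinearGroup (Fin n) ℤ) :
            Matrix (Fin n) (Fin n) ℤ) i j) • x j} := by
  obtain ⟨x, hx⟩ := hdense
  obtain ⟨g, hgA, hg⟩ := exists_good A hab (fun a ha => no_finite a ha _ x (by
    convert hx using 1
    ext y
    constructor
    · rintro ⟨_, ⟨g, hg, rfl⟩, rfl⟩
      exact ⟨g, hg, rfl⟩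
    · rintro ⟨g, hg, rfl⟩
      exact ⟨_, ⟨g, hg, rfl⟩, rfl⟩))
  exact ⟨g, hgA, exists_dense_orbit g hg⟩
end

section
/- Let n ≥ 2 and let H be the set of matrices in GL(n,ℂ) of the block form with (i) the upper-left (n−1)×(n−1) block equal to z·I for some z ∈ ℂ with z ≠ 0, (ii) the last column above the diagonal an arbitrary vector w ∈ ℂ^{n−1}, (iii) the (n,n) entry equal to the same z, and (iv) all remaining entries 0. Then H is an abelian subgroup of GL(n,ℂ), and the H-orbit of the standard basis vector e_n under matrix–vector multiplication equals {v ∈ ℂ^n : v_n ≠ 0}, which is an open dense subset of ℂ^n. -/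
/-- The strictly-upper part: `u` in column `l` off the diagonal. -/
def colN {n : ℕ} (l : Fin n) (u : Fin n → ℂ) : Matrix (Fin n) (Fin n) ℂ :=
  fun i j => if i = j then 0 else if j = l then u i else 0

/-- The matrices of the family. -/
def colM {n : ℕ} (l : Fin n) (z : ℂ) (u : Fin n → ℂ) : Matrix (Fin n) (Fin n) ℂ :=
  fun i j => if i = j then z else if j = l then u i else 0

lemma colM_eq {n : ℕ} (l : Fin n) (z : ℂ) (u : Fin n → ℂ) :
    colM l z u = z • (1 : Matrix (Fin n) (Fin n) ℂ) + colN l u := by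
  ext i j
  by_cases h : i = j <;> simp [colM, colN, Matrix.one_apply, h]

lemma colN_mul {n : ℕ} (l : Fin n) (u v : Fin n → ℂ) : colN l u * colN l v = 0 := by
  ext i j
  rw [Matrix.mul_apply]
  apply Finset.sum_eq_zero
  intro k _
  simp only [colN]
  by_cases h : k = l
  · by_cases h2 : j = l <;> simp [h, h2]
  · simp [h]

lemma colN_comb {n : ℕ} (l : Fin n) (a b : ℂ) (u v : Fin n → ℂ) :
    colN l (a • u + b • v) = a • colN l u + b • colN l v := by
  ext i j
  simp only [colN, Matrix.add_apply, Matrix.smul_apply, Pi.add_apply, Pi.smul_apply, smul_eq_mul]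
  split_ifs <;> simp

lemma colM_mul {n : ℕ} (l : Fin n) (a b : ℂ) (u v : Fin n → ℂ) :
    colM l a u * colM l b v = colM l (a * b) (b • u + a • v) := by
  rw [colM_eq, colM_eq, colM_eq, colN_comb]
  simp only [add_mul, mul_add, colN_mul, smul_mul_assoc, mul_smul_comm, one_mul, mul_one,
    smul_add, smul_smul, mul_comm a b]
  abel

lemma colM_one {n : ℕ} (l : Fin n) : colM l 1 0 = 1 := by
  ext i j
  simp [colM, Matrix.one_apply]

lemma colM_mul_inv {n : ℕ} (l : Fin n) (z : ℂ) (hz : z ≠ 0) (u : Fin n → ℂ) :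
    colM l z u * colM l z⁻¹ (-(z⁻¹ * z⁻¹) • u) = 1 := by
  rw [colM_mul, mul_inv_cancel₀ hz, ← colM_one l]
  congr 1
  ext i
  simp only [Pi.add_apply, Pi.smul_apply, smul_eq_mul, Pi.zero_apply]
  field_simp
  ring

/-- The subgroup. -/
def colH {n : ℕ} (l : Fin n) : Subgroup (Matrix.GeneralLinearGroup (Fin n) ℂ) where
  carrier := {g | ∃ z : ℂ, z ≠ 0 ∧ ∃ w : Fin n → ℂ, g.val = colM l z w}
  one_mem' := ⟨1, one_ne_zero, 0, by rw [colM_one]; rfl⟩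
  mul_mem' := by
    rintro a b ⟨z, hz, w, h⟩ ⟨z', hz', w', h'⟩
    exact ⟨z * z', mul_ne_zero hz hz', _, by rw [Units.val_mul, h, h', colM_mul]⟩
  inv_mem' := by
    rintro a ⟨z, hz, w, h⟩
    refine ⟨z⁻¹, inv_ne_zero hz, -(z⁻¹ * z⁻¹) • w, ?_⟩
    apply Units.inv_eq_of_mul_eq_one_right
    rw [h, colM_mul_inv l z hz]

lemma colM_mulVec {n : ℕ} (l : Fin n) (z : ℂ) (u : Fin n → ℂ) (i : Fin n) :
    (colM l z u).mulVec (Pi.single l 1) i = if i = l then z else u i := by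
  simp [colM]

/-- **An abelian subgroup of `GL(n,ℂ)` with an open dense orbit on `ℂⁿ`.**
For `n ≥ 2`, the set `H` of invertible matrices whose upper-left `(n-1)×(n-1)` block is
`z·I` (`z ≠ 0`), whose last column above the diagonal is an arbitrary vector
`w ∈ ℂ^{n-1}`, whose `(n,n)` entry is the same `z`, and whose remaining entries vanish,
is an abelian subgroup of `GL(n,ℂ)`; the `H`-orbit of the last standard basis vector `eₙ`
equals `{v ∈ ℂⁿ : vₙ ≠ 0}`, which is open and dense in `ℂⁿ`. -/
theorem abelian_subgroup_open_dense_orbit (n : ℕ) (hn : 2 ≤ n) :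
    ∃ H : Subgroup (Matrix.GeneralLinearGroup (Fin n) ℂ),
      (∀ g : Matrix.GeneralLinearGroup (Fin n) ℂ, g ∈ H ↔
        ∃ z : ℂ, z ≠ 0 ∧ ∃ w : Fin n → ℂ, ∀ i j : Fin n,
          (g : Matrix (Fin n) (Fin n) ℂ) i j =
            if i = j then z
            else if j = (⟨n - 1, by omega⟩ : Fin n) then w i
            else 0) ∧
      (∀ a ∈ H, ∀ b ∈ H, a * b = b * a) ∧
      {v : Fin n → ℂ | ∃ g ∈ H,
          v = ((g : Matrix (Fin n) (Fin n) ℂ)).mulVec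
            (Pi.single (⟨n - 1, by omega⟩ : Fin n) 1)} =
        {v : Fin n → ℂ | v (⟨n - 1, by omega⟩ : Fin n) ≠ 0} ∧
      IsOpen {v : Fin n → ℂ | v (⟨n - 1, by omega⟩ : Fin n) ≠ 0} ∧
      Dense {v : Fin n → ℂ | v (⟨n - 1, by omega⟩ : Fin n) ≠ 0} := by
  generalize (⟨n - 1, by omega⟩ : Fin n) = l
  refine ⟨colH l, ?_, ?_, ?_, ?_, ?_⟩
  · intro g
    constructor
    · rintro ⟨z, hz, w, h⟩
      exact ⟨z, hz, w, fun i j => by rw [h]; rfl⟩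
    · rintro ⟨z, hz, w, h⟩
      exact ⟨z, hz, w, by ext i j; exact h i j⟩
  · rintro a ⟨z, hz, w, h⟩ b ⟨z', hz', w', h'⟩
    apply Units.ext
    rw [Units.val_mul, Units.val_mul, h, h', colM_mul, colM_mul, mul_comm z, add_comm]
  · ext v
    constructor
    · rintro ⟨g, ⟨z, hz, w, h⟩, rfl⟩
      show _ ≠ _
      rw [h, colM_mulVec]
      simpa using hz
    · intro hv
      have hv' : v l ≠ 0 := hv
      have h1 := colM_mul_inv l (v l) hv' v
      refine ⟨⟨colM l (v l) v, _, h1, mul_eq_one_comm.mp h1⟩, ⟨v l, hv', v, rfl⟩, ?_⟩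
      ext i
      show _ = (colM l (v l) v).mulVec _ i
      rw [colM_mulVec]
      split_ifs with h
      · rw [h]
      · rfl
  · exact isOpen_ne_fun (continuous_apply l) continuous_const
  · have h : Dense ({0}ᶜ : Set ℂ) := dense_compl_singleton 0
    exact h.preimage (isOpenMap_eval l)
end
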